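/- Hopf bifurcation in the plane and the 2-sphere: counting components. Let M be either ℝ² or the 2-sphere S², and let f : [0,1] × M → M be a continuous family of homeomorphisms of M. Suppose K ⊊ M is a connected compact attractor of f₀ that is a repeller of f_λ for every λ ∈ (0,1]. Then M \ K has a finite number k of connected components, and there exists λ₀ > 0 such that for every λ with 0 < λ < λ₀ there exists a compact attractor K_λ of f_λ which is a topological spine of a compact subset of M homeomorphic to (Fin k × S¹) × [0,1] (so K_λ has the Borsuk homotopy type of a disjoint union of exactly k circles); moreover K_λ converges to K upper semicontinuously as λ → 0. -/

import Mathlib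

open Set Topology unitInterval

/-- `A` is homeomorphic to an open subset of `B`. -/
def HomeoToOpen (A : Type*) [TopologicalSpace A] (B : Type*) [TopologicalSpace B] : Prop :=
  ∃ U : Set B, IsOpen U ∧ Nonempty (A ≃ₜ U)

/-- The half-space `ℝ^{n-1} × [0,∞)`. -/
abbrev HalfSpace (n : ℕ) : Type :=
  EuclideanSpace ℝ (Fin (n - 1)) × {t : ℝ // 0 ≤ t}

/-- Every point has an open neighborhood homeomorphic to an open subset of `ℝⁿ`. -/
def LocallyEuclidean (n : ℕ) (M : Type*) [TopologicalSpace M] : Prop :=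
  ∀ x : M, ∃ V : Set M, IsOpen V ∧ x ∈ V ∧ HomeoToOpen V (EuclideanSpace ℝ (Fin n))

/-- Every point has an open neighborhood homeomorphic to an open subset of the
half-space `ℝ^{n-1} × [0,∞)`. -/
def LocallyHalfSpace (n : ℕ) (M : Type*) [TopologicalSpace M] : Prop :=
  ∀ x : M, ∃ V : Set M, IsOpen V ∧ x ∈ V ∧ HomeoToOpen V (HalfSpace n)

/-- The manifold boundary of a space: points with no open neighborhood homeomorphic to
an open subset of `ℝⁿ`. -/
def spaceBoundary (n : ℕ) (M : Type*) [TopologicalSpace M] : Set M :=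
  {x | ¬ ∃ V : Set M, IsOpen V ∧ x ∈ V ∧ HomeoToOpen V (EuclideanSpace ℝ (Fin n))}

variable {X : Type*} [TopologicalSpace X]

/-- A subset which is a compact `n`-manifold with boundary (subspace topology). -/
def IsCompactMfldBdry (n : ℕ) (N : Set X) : Prop :=
  IsCompact N ∧ LocallyHalfSpace n ↥N

/-- The boundary of a subset which is a manifold with boundary, as a subset of the
ambient space. -/
def subsetBoundary (n : ℕ) (N : Set X) : Set X :=
  Subtype.val '' spaceBoundary n ↥N

/-- `S` is bicollared in the ambient space. -/
def Bicollared (S : Set X) : Prop :=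
  ∃ b : ↥S × ↥(Set.Icc (-1 : ℝ) 1) → X,
    Topology.IsEmbedding b ∧ ∀ x : ↥S, b (x, ⟨0, by norm_num⟩) = (x : X)

/-- `M` and `N` (compact `n`-manifolds with boundary, `N ⊆ int M`) are concentric:
`M \ int N` is homeomorphic to `∂M × [0,1]`. -/
def Concentric (n : ℕ) (M N : Set X) : Prop :=
  Nonempty (↥(M \ interior N) ≃ₜ ↥(subsetBoundary n M) × ↥(Set.Icc (0 : ℝ) 1))

/-- `K` is a topological spine of the compact `n`-manifold with boundary `N`:
`K ⊆ int N` and `N \ K` is homeomorphic to `∂N × [0,∞)`. -/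
def IsSpine (n : ℕ) (N K : Set X) : Prop :=
  K ⊆ interior N ∧
    Nonempty (↥(N \ K) ≃ₜ ↥(subsetBoundary n N) × ↥(Set.Ici (0 : ℝ)))

/-- The ω-limit set of `Y` under a map `f`. -/
def omegaSet (f : X → X) (Y : Set X) : Set X :=
  ⋂ (n : ℕ) (_ : 1 ≤ n), closure (⋃ (k : ℕ) (_ : n ≤ k), f^[k] '' Y)

/-- `K` is an attractor of the homeomorphism `f`. -/
def IsAttractor (f : X ≃ₜ X) (K : Set X) : Prop :=
  IsCompact K ∧ ∃ U : Set X, U ∈ 𝓝ˢ K ∧ K = omegaSet f U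

/-- `K` is a repeller of the homeomorphism `f`. -/
def IsRepeller (f : X ≃ₜ X) (K : Set X) : Prop :=
  IsAttractor f.symm K

/-- A continuous family of homeomorphisms parametrized by the unit interval. -/
def ContinuousFamily {M : Type*} [TopologicalSpace M] (f : unitInterval → M ≃ₜ M) : Prop :=
  Continuous (fun p : unitInterval × M => f p.1 p.2) ∧
    Continuous (fun p : unitInterval × M => (f p.1).symm p.2)

/-- `M` has the concentric rigidity property (as a subset of the ambient space). -/
def ConcentricRigidity (n : ℕ) (M : Set X) : Prop :=
  ∀ M₀ M₁ : Set X, IsCompactMfldBdry n M₀ → IsCompactMfldBdry n M₁ →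
    M₀ ⊆ interior M₁ → M₁ ⊆ interior M →
    Bicollared (subsetBoundary n M₁) →
    Nonempty (↥(subsetBoundary n M₁) ≃ₜ ↥(subsetBoundary n M)) →
    Concentric n M M₀ →
    Concentric n M₁ M₀ ∧ Concentric n M M₁


open Set Topology

def PrimInv (Q : Set ℂ) (a : ℂ) : Prop :=
  ∃ L : ℂ → ℂ, ∀ z ∈ Q, HasDerivAt L (1 / (z - a)) z

def CompUnb (Ω : Set ℂ) : Prop :=
  ∀ T : Set ℂ, T ⊆ Ωᶜ → IsCompact T → IsClosed (Ωᶜ \ T) → T = ∅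

lemma PrimInv.far {Q : Set ℂ} {R : ℝ} (hQ : ∀ z ∈ Q, ‖z‖ < R) {b : ℂ} (hb : R ≤ ‖b‖) :
    PrimInv Q b := by
  refine ⟨fun z => Complex.log (1 + (-z / b)), fun z hz => ?_⟩
  have h1 : ‖z‖ < ‖b‖ := (hQ z hz).trans_le hb
  have hb0 : b ≠ 0 := by
    rintro rfl
    simp at h1
    exact absurd h1 (not_lt.2 (norm_nonneg _))
  have hs : 1 + (-z / b) ∈ Complex.slitPlane := by
    apply Complex.mem_slitPlane_of_norm_lt_one
    rw [norm_div, norm_neg, div_lt_one (norm_pos_iff.2 hb0)]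
    exact h1
  have hd : HasDerivAt (fun z : ℂ => 1 + (-z / b)) (-1 / b) z :=
    ((hasDerivAt_id z).neg.div_const b).const_add 1
  refine (hd.clog hs).congr_deriv ?_
  have : z - b ≠ 0 := by
    intro h
    rw [sub_eq_zero] at h
    rw [h] at h1
    exact lt_irrefl _ h1
  have h3 : b - z ≠ 0 := by
    intro h
    apply this
    linear_combination -h
  have h2 : 1 + -z / b = (b - z) / b := by field_simp; ring
  rw [h2]
  field_simp
  ring

lemma PrimInv.step {Q : Set ℂ} {ε : ℝ} {a b : ℂ} (hQ : ∀ z ∈ Q, ε ≤ dist z b)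
    (hab : dist a b < ε) (h : PrimInv Q b) : PrimInv Q a := by
  obtain ⟨L, hL⟩ := h
  refine ⟨fun z => L z + Complex.log (1 + (b - a) / (z - b)), fun z hz => ?_⟩
  have hlt : dist a b < dist z b := hab.trans_le (hQ z hz)
  have hzb : z - b ≠ 0 := by
    intro h
    rw [sub_eq_zero] at h
    rw [h, dist_self] at hlt
    exact absurd hlt (not_lt.2 dist_nonneg)
  have hza : z - a ≠ 0 := by
    intro h
    rw [sub_eq_zero] at h
    rw [h] at hlt
    exact lt_irrefl _ hlt
  have hs : 1 + (b - a) / (z - b) ∈ Complex.slitPlane := by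
    apply Complex.mem_slitPlane_of_norm_lt_one
    rw [norm_div, div_lt_one (norm_pos_iff.2 hzb), ← dist_eq_norm, ← dist_eq_norm, dist_comm]
    exact hlt
  have hd : HasDerivAt (fun z : ℂ => 1 + (b - a) / (z - b)) (-(b - a) / (z - b) ^ 2) z := by
    have := ((((hasDerivAt_id' z).sub_const b).fun_inv hzb).const_mul (b - a)).const_add 1
    simp only [← div_eq_mul_inv] at this
    refine this.congr_deriv ?_
    ring
  refine ((hL z hz).add (hd.clog hs)).congr_deriv ?_
  have h2 : 1 + (b - a) / (z - b) = (z - a) / (z - b) := by field_simp; ring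
  rw [h2]
  field_simp
  ring

lemma exists_primInv {Ω Q : Set ℂ} (hΩ : IsOpen Ω) (H : CompUnb Ω) (hQ : IsCompact Q)
    (hQΩ : Q ⊆ Ω) : ∃ δ > 0, ∀ b ∈ Ωᶜ, ∀ a, dist a b < δ → a ∉ Q ∧ PrimInv Q a := by
  obtain ⟨ε, hε, hεQ⟩ := hQ.exists_thickening_subset_open hΩ hQΩ
  have hfar : ∀ b ∈ Ωᶜ, ∀ z ∈ Q, ε ≤ dist z b := by
    intro b hb z hz
    by_contra hlt
    push Not at hlt
    exact hb (hεQ (Metric.mem_thickening_iff.2 ⟨z, hz, by rwa [dist_comm]⟩))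
  obtain ⟨R, hR⟩ := hQ.isBounded.exists_norm_le
  have hclosed : ∀ S : Set ℂ, S ⊆ Ωᶜ → (∀ a ∈ Ωᶜ, ∀ b ∈ S, dist a b < ε → a ∈ S) → IsClosed S := by
    intro S hS hst
    rw [← closure_subset_iff_isClosed]
    intro x hx
    have hxΩ : x ∈ Ωᶜ := closure_minimal hS hΩ.isClosed_compl hx
    obtain ⟨b, hb, hxb⟩ := Metric.mem_closure_iff.1 hx ε hε
    exact hst x hxΩ b hb hxb
  set T : Set ℂ := {a ∈ Ωᶜ | ¬ PrimInv Q a} with hT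
  have hT0 : T = ∅ := by
    apply H T (fun a ha => ha.1)
    · refine Metric.isCompact_of_isClosed_isBounded ?_ ?_
      · apply hclosed T (fun a ha => ha.1)
        intro a ha b hb hab
        refine ⟨ha, fun hP => hb.2 ?_⟩
        exact hP.step (hfar a ha) (by rwa [dist_comm])
      · refine (Metric.isBounded_ball (x := (0:ℂ)) (r := R + 1)).subset ?_
        intro a ha
        rw [mem_ball_zero_iff]
        by_contra hlt
        push Not at hlt
        exact ha.2 (PrimInv.far (fun z hz => lt_of_le_of_lt (hR z hz) (lt_add_one R)) hlt)
    · apply hclosed _ sdiff_subset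
      intro a ha b hb hab
      refine ⟨ha, fun haT => haT.2 ?_⟩
      have hbP : PrimInv Q b := by
        by_contra hb'
        exact hb.2 ⟨hb.1, hb'⟩
      exact hbP.step (hfar b hb.1) hab
  refine ⟨ε, hε, fun b hb a hab => ?_⟩
  have hbP : PrimInv Q b := by
    by_contra hb'
    have : b ∈ T := ⟨hb, hb'⟩
    rw [hT0] at this
    exact this
  exact ⟨fun haQ => absurd hab (not_lt.2 (hfar b hb a haQ)), hbP.step (hfar b hb) hab⟩

open Set Topology Filter

lemma lip_of_bound {f : ℂ → ℂ} {z₀ : ℂ} {r M : ℝ} (hr : 0 < r)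
    (hd : DifferentiableOn ℂ f (Metric.ball z₀ (2 * r)))
    (hM : ∀ z ∈ Metric.ball z₀ (2 * r), ‖f z‖ ≤ M) :
    LipschitzOnWith (Real.nnabs (2 * M / r)) f (Metric.ball z₀ r) := by
  apply Convex.lipschitzOnWith_of_nnnorm_deriv_le (𝕜 := ℂ) _ _ (convex_ball z₀ r)
  · intro x hx
    apply hd.differentiableAt
    apply Metric.isOpen_ball.mem_nhds
    exact Metric.ball_subset_ball (by linarith) hx
  · intro x hx
    have hsub : Metric.closedBall x (r / 2) ⊆ Metric.ball z₀ (2 * r) := by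
      intro y hy
      rw [Metric.mem_closedBall] at hy
      rw [Metric.mem_ball] at hx ⊢
      linarith [dist_triangle y x z₀]
    have := Complex.norm_deriv_le_of_forall_mem_sphere_norm_le (f := f) (C := M) (half_pos hr)
      (c := x) ((hd.mono hsub).diffContOnCl_ball subset_rfl)
      (fun z hz => hM z (hsub (Metric.sphere_subset_closedBall hz)))
    rw [← NNReal.coe_le_coe, coe_nnnorm, Real.coe_nnabs]
    refine (this.trans (le_of_eq ?_)).trans (le_abs_self _)
    field_simp

lemma param_diff {F : ℂ → ℝ → ℂ} {z₀ : ℂ} {r : ℝ} (hr : 0 < r)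
    (hc : ContinuousOn (fun p : ℂ × ℝ => F p.1 p.2) (Metric.ball z₀ r ×ˢ Icc 0 1))
    (hd : ∀ t ∈ Icc (0 : ℝ) 1, DifferentiableOn ℂ (fun z => F z t) (Metric.ball z₀ r)) :
    DifferentiableAt ℂ (fun z => ∫ t in (0 : ℝ)..1, F z t) z₀ := by
  have hs : Metric.closedBall z₀ (r / 2) ⊆ Metric.ball z₀ r :=
    Metric.closedBall_subset_ball (by linarith)
  have hIoc : uIoc (0 : ℝ) 1 ⊆ Icc 0 1 := by
    rw [uIoc_of_le zero_le_one]; exact Ioc_subset_Icc_self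
  obtain ⟨M, hM⟩ := ((isCompact_closedBall z₀ (r / 2)).prod (isCompact_Icc (a := (0 : ℝ))
    (b := 1))).exists_bound_of_continuousOn (hc.mono (prod_mono hs subset_rfl))
  have hct : ∀ z ∈ Metric.ball z₀ r, ContinuousOn (F z) (Icc 0 1) := by
    intro z hz
    exact hc.comp (f := fun t => (z, t)) (by fun_prop) (fun t ht => ⟨hz, ht⟩)
  have hmeas : ∀ z ∈ Metric.ball z₀ r, MeasureTheory.AEStronglyMeasurable (F z)
      (MeasureTheory.volume.restrict (uIoc (0 : ℝ) 1)) := by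
    intro z hz
    exact ((hct z hz).mono hIoc).aestronglyMeasurable measurableSet_uIoc
  have hz₀ : z₀ ∈ Metric.ball z₀ r := Metric.mem_ball_self hr
  have hda : ∀ t ∈ Icc (0 : ℝ) 1, DifferentiableAt ℂ (fun z => F z t) z₀ := fun t ht =>
    (hd t ht).differentiableAt (Metric.isOpen_ball.mem_nhds hz₀)
  have key := intervalIntegral.hasDerivAt_integral_of_dominated_loc_of_lip (𝕜 := ℂ)
    (μ := MeasureTheory.volume) (F := F) (F' := fun t => deriv (fun z => F z t) z₀) (x₀ := z₀)
    (bound := fun _ => 2 * M / (r / 4)) (a := 0) (b := 1) (s := Metric.ball z₀ (r / 4))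
    (Metric.ball_mem_nhds _ (by linarith)) ?_ ?_ ?_ ?_ ?_ ?_
  · exact key.2.differentiableAt
  · filter_upwards [Metric.isOpen_ball.mem_nhds hz₀] with z hz using hmeas z hz
  · apply ContinuousOn.intervalIntegrable
    rw [uIcc_of_le zero_le_one]
    exact hct z₀ hz₀
  · obtain ⟨u, hu0, hu⟩ : ∃ u : ℕ → ℂ, (∀ n, z₀ + u n ∈ Metric.ball z₀ r ∧ u n ≠ 0) ∧
        Tendsto u atTop (𝓝 0) := by
      have h1 : Tendsto (fun n : ℕ => ((r / (n + 2) : ℝ) : ℂ)) atTop (𝓝 0) := by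
        have h2 : Tendsto (fun n : ℕ => (r / (n + 2) : ℝ)) atTop (𝓝 0) := by
          apply Tendsto.div_atTop tendsto_const_nhds
          exact tendsto_atTop_add_const_right _ _ tendsto_natCast_atTop_atTop
        have := (Complex.continuous_ofReal.tendsto 0).comp h2
        rw [Complex.ofReal_zero] at this
        exact this
      refine ⟨_, fun n => ⟨?_, ?_⟩, h1⟩
      · rw [Metric.mem_ball, dist_self_add_left, Complex.norm_real, Real.norm_eq_abs,
          abs_of_pos (by positivity)]
        apply div_lt_self hr
        have : (0 : ℝ) ≤ n := Nat.cast_nonneg n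
        linarith
      · rw [Complex.ofReal_ne_zero]
        positivity
    refine aestronglyMeasurable_of_tendsto_ae (u := atTop)
      (f := fun n t => (u n)⁻¹ • (F (z₀ + u n) t - F z₀ t)) ?_ ?_
    · intro n
      exact ((hmeas _ (hu0 n).1).sub (hmeas _ hz₀)).const_smul ((u n)⁻¹)
    · rw [MeasureTheory.ae_restrict_iff' measurableSet_uIoc]
      refine Eventually.of_forall fun t ht => ?_
      have := (hda t (hIoc ht)).hasDerivAt.tendsto_slope_zero
      exact this.comp (tendsto_nhdsWithin_iff.2 ⟨hu, Eventually.of_forall fun n => (hu0 n).2⟩)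
  · refine Eventually.of_forall fun t ht => ?_
    have hsub : Metric.ball z₀ (2 * (r / 4)) ⊆ Metric.closedBall z₀ (r / 2) := by
      rw [show 2 * (r / 4) = r / 2 by ring]
      exact Metric.ball_subset_closedBall
    exact lip_of_bound (by linarith) ((hd t (hIoc ht)).mono (hsub.trans hs))
      (fun z hz => hM (z, t) ⟨hsub hz, hIoc ht⟩)
  · exact intervalIntegrable_const
  · exact Eventually.of_forall fun t ht => (hda t (hIoc ht)).hasDerivAt

lemma continuousOn_dslope2 {Ω : Set ℂ} (hΩ : IsOpen Ω) {f : ℂ → ℂ} (hf : DifferentiableOn ℂ f Ω) :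
    ContinuousOn (fun p : ℂ × ℂ => dslope f p.1 p.2) (Ω ×ˢ Ω) := by
  rintro ⟨a, b⟩ ⟨ha, hb⟩
  apply ContinuousAt.continuousWithinAt
  have hfa : ContinuousAt f a := (hf.differentiableAt (hΩ.mem_nhds ha)).continuousAt
  have hfb : ContinuousAt f b := (hf.differentiableAt (hΩ.mem_nhds hb)).continuousAt
  by_cases hab : b = a
  · subst hab
    have hst : HasStrictDerivAt f (deriv f b) b :=
      (hf.analyticAt (hΩ.mem_nhds hb)).hasStrictDerivAt
    rw [Metric.continuousAt_iff']
    intro ε hε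
    have h1 := (hasStrictFDerivAt_iff_isLittleO.1 hst.hasStrictFDerivAt).def (half_pos hε)
    have hdc : ContinuousAt (deriv f) b :=
      (hf.analyticAt (hΩ.mem_nhds hb)).deriv.continuousAt
    have h2 : ∀ᶠ p : ℂ × ℂ in 𝓝 (b, b), dist (deriv f p.1) (deriv f b) < ε :=
      (continuousAt_fst (p := (b, b))).eventually (Metric.continuousAt_iff'.1 hdc ε hε)
    filter_upwards [h1, h2] with p hp hp2
    rw [dslope_same]
    by_cases h : p.2 = p.1
    · rw [h, dslope_same]; exact hp2
    · rw [dslope_of_ne f h, slope_def_field]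
      have hne : p.2 - p.1 ≠ 0 := sub_ne_zero.2 h
      have hpos : 0 < ‖p.2 - p.1‖ := norm_pos_iff.2 hne
      rw [dist_eq_norm]
      have e1 : (f p.2 - f p.1) / (p.2 - p.1) - deriv f b
          = (f p.1 - f p.2 - (p.1 - p.2) • deriv f b) / (p.1 - p.2) := by
        have : p.1 - p.2 ≠ 0 := sub_ne_zero.2 (Ne.symm h)
        rw [smul_eq_mul]
        field_simp
        ring
      rw [e1, norm_div, div_lt_iff₀ (by rw [norm_sub_rev]; exact hpos)]
      refine lt_of_le_of_lt hp ?_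
      rw [norm_sub_rev]
      nlinarith
  · have : ContinuousAt (fun p : ℂ × ℂ => (f p.2 - f p.1) / (p.2 - p.1)) (a, b) := by
      apply ContinuousAt.div
      · exact (ContinuousAt.comp (f := Prod.snd) (x := (a, b)) hfb continuousAt_snd).sub
          (ContinuousAt.comp (f := Prod.fst) (x := (a, b)) hfa continuousAt_fst)
      · fun_prop
      · exact sub_ne_zero.2 hab
    apply this.congr
    have hne : ∀ᶠ p : ℂ × ℂ in 𝓝 (a, b), p.2 ≠ p.1 :=
      (isOpen_ne_fun continuous_snd continuous_fst).mem_nhds hab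
    filter_upwards [hne] with p hp
    rw [dslope_of_ne f hp, slope_def_field]

open Set Topology Filter

noncomputable def sgp (p q : ℂ) (t : ℝ) : ℂ := p + t * (q - p)
noncomputable def segInt (f : ℂ → ℂ) (p q : ℂ) : ℂ := ∫ t in (0 : ℝ)..1, f (sgp p q t) * (q - p)
noncomputable def intL (L : List (ℂ × ℂ)) (f : ℂ → ℂ) : ℂ :=
  (L.map fun s => segInt f s.1 s.2).sum
def bdL (L : List (ℂ × ℂ)) (F : ℂ → ℂ) : ℂ := (L.map fun s => F s.2 - F s.1).sum
def InL (L : List (ℂ × ℂ)) (Ω : Set ℂ) : Prop := ∀ s ∈ L, ∀ t ∈ Icc (0 : ℝ) 1, sgp s.1 s.2 t ∈ Ω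

lemma continuous_sgp (p q : ℂ) : Continuous (sgp p q) := by unfold sgp; fun_prop

lemma hasDerivAt_sgp (p q : ℂ) (t : ℝ) : HasDerivAt (sgp p q) (q - p) t := by
  unfold sgp
  have := ((Complex.ofRealCLM.hasDerivAt (x := t)).mul_const (q - p)).const_add p
  simpa using! this

lemma segInt_prim {f F : ℂ → ℂ} {p q : ℂ}
    (h : ∀ t ∈ Icc (0 : ℝ) 1, HasDerivAt F (f (sgp p q t)) (sgp p q t))
    (hc : ContinuousOn (fun t => f (sgp p q t)) (Icc 0 1)) :
    segInt f p q = F q - F p := by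
  have := intervalIntegral.integral_eq_sub_of_hasDerivAt (a := (0 : ℝ)) (b := 1)
    (f := fun t => F (sgp p q t)) (f' := fun t => f (sgp p q t) * (q - p)) ?_ ?_
  · unfold segInt
    rw [this]
    simp [sgp]
  · intro t ht
    rw [uIcc_of_le zero_le_one] at ht
    exact (h t ht).comp t (hasDerivAt_sgp p q t)
  · apply ContinuousOn.intervalIntegrable
    rw [uIcc_of_le zero_le_one]
    exact hc.mul continuousOn_const

lemma InL.cont {L : List (ℂ × ℂ)} {Ω : Set ℂ} (h : InL L Ω) {f : ℂ → ℂ} (hf : ContinuousOn f Ω)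
    {s : ℂ × ℂ} (hs : s ∈ L) : ContinuousOn (fun t => f (sgp s.1 s.2 t)) (Icc 0 1) :=
  hf.comp (continuous_sgp _ _).continuousOn (fun t ht => h s hs t ht)

lemma intL_prim {f F : ℂ → ℂ} {L : List (ℂ × ℂ)} {Q : Set ℂ} (hL : InL L Q)
    (h : ∀ z ∈ Q, HasDerivAt F (f z) z) (hc : ContinuousOn f Q) : intL L f = bdL L F := by
  unfold intL bdL
  congr 1
  apply List.map_congr_left
  intro s hs
  exact segInt_prim (fun t ht => h _ (hL s hs t ht)) (hL.cont hc hs)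

lemma intL_diff {L : List (ℂ × ℂ)} {G : ℂ → ℂ → ℂ} {z₀ : ℂ} {r : ℝ} (hr : 0 < r) {Q : Set ℂ}
    (hL : InL L Q)
    (hc : ContinuousOn (fun p : ℂ × ℂ => G p.1 p.2) (Metric.ball z₀ r ×ˢ Q))
    (hd : ∀ w ∈ Q, DifferentiableOn ℂ (fun z => G z w) (Metric.ball z₀ r)) :
    DifferentiableAt ℂ (fun z => intL L (G z)) z₀ := by
  induction L with
  | nil => simp [intL]
  | cons s L ih =>
    have h1 : InL L Q := fun x hx => hL x (List.mem_cons_of_mem _ hx)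
    have h2 := fun t ht => hL s List.mem_cons_self t ht
    simp only [intL, List.map_cons, List.sum_cons] at ih ⊢
    refine DifferentiableAt.fun_add ?_ (ih h1)
    unfold segInt
    apply param_diff hr
    · refine ContinuousOn.mul ?_ continuousOn_const
      refine hc.comp (f := fun p : ℂ × ℝ => (p.1, sgp s.1 s.2 p.2)) ?_ ?_
      · have := continuous_sgp s.1 s.2
        fun_prop
      · rintro ⟨z, t⟩ ⟨hz, ht⟩
        exact ⟨hz, h2 t ht⟩
    · intro t ht
      exact (hd _ (h2 t ht)).mul_const _

lemma intL_congr {L : List (ℂ × ℂ)} {Q : Set ℂ} (hL : InL L Q) {f g : ℂ → ℂ}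
    (h : ∀ z ∈ Q, f z = g z) : intL L f = intL L g := by
  unfold intL
  congr 1
  apply List.map_congr_left
  intro s hs
  unfold segInt
  apply intervalIntegral.integral_congr
  intro t ht
  rw [uIcc_of_le zero_le_one] at ht
  simp only
  rw [h _ (hL s hs t ht)]

lemma intL_lin {L : List (ℂ × ℂ)} {Q : Set ℂ} (hL : InL L Q) {f g : ℂ → ℂ} (c : ℂ)
    (hf : ContinuousOn f Q) (hg : ContinuousOn g Q) :
    intL L (fun z => f z - c * g z) = intL L f - c * intL L g := by
  induction L with
  | nil => simp [intL]
  | cons s L ih =>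
    have h1 : InL L Q := fun x hx => hL x (List.mem_cons_of_mem _ hx)
    have hI : ∀ k : ℂ → ℂ, ContinuousOn k Q → IntervalIntegrable
        (fun t => k (sgp s.1 s.2 t) * (s.2 - s.1)) MeasureTheory.volume 0 1 := by
      intro k hk
      apply ContinuousOn.intervalIntegrable
      rw [uIcc_of_le zero_le_one]
      exact (hL.cont hk List.mem_cons_self).mul continuousOn_const
    have h3 : segInt (fun z => f z - c * g z) s.1 s.2
        = segInt f s.1 s.2 - c * segInt g s.1 s.2 := by
      unfold segInt
      rw [← intervalIntegral.integral_const_mul, ← intervalIntegral.integral_sub (hI f hf)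
        ((hI g hg).const_mul c)]
      congr 1
      funext t
      ring
    have := ih h1
    simp only [intL, List.map_cons, List.sum_cons] at this ⊢
    rw [this, h3]
    ring

lemma InL.exists_compact {L : List (ℂ × ℂ)} {Ω : Set ℂ} (h : InL L Ω) :
    ∃ Q, IsCompact Q ∧ Q ⊆ Ω ∧ InL L Q := by
  refine ⟨⋃ s ∈ {s | s ∈ L}, sgp s.1 s.2 '' Icc 0 1, ?_, ?_, ?_⟩
  · exact (List.finite_toSet L).isCompact_biUnion
      fun s _ => isCompact_Icc.image (continuous_sgp _ _)
  · simp only [iUnion_subset_iff]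
    rintro s hs _ ⟨t, ht, rfl⟩
    exact h s hs t ht
  · intro s hs t ht
    exact mem_biUnion (x := s) hs ⟨t, ht, rfl⟩

lemma segInt_far {f : ℂ → ℂ} {p q : ℂ} {Q : Set ℂ} {R B : ℝ} (hQ : ∀ z ∈ Q, ‖z‖ ≤ R)
    (hB : ∀ z ∈ Q, ‖f z‖ ≤ B) (hs : ∀ t ∈ Icc (0 : ℝ) 1, sgp p q t ∈ Q) :
    Tendsto (fun z => segInt (fun w => f w / (w - z)) p q) (cocompact ℂ) (𝓝 0) := by
  have h1 : Tendsto (fun z : ℂ => B / (‖z‖ - R) * ‖q - p‖) (cocompact ℂ) (𝓝 0) := by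
    have : Tendsto (fun z : ℂ => B / (‖z‖ - R)) (cocompact ℂ) (𝓝 0) := by
      apply Tendsto.div_atTop tendsto_const_nhds
      exact tendsto_atTop_add_const_right _ _ (tendsto_norm_cocompact_atTop)
    simpa using this.mul_const ‖q - p‖
  refine squeeze_zero_norm' ?_ h1
  filter_upwards [(tendsto_norm_cocompact_atTop (E := ℂ)).eventually_gt_atTop R] with z hz
  have := intervalIntegral.norm_integral_le_of_norm_le_const (a := 0) (b := 1)
    (f := fun t => f (sgp p q t) / (sgp p q t - z) * (q - p)) (C := B / (‖z‖ - R) * ‖q - p‖) ?_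
  · simpa [segInt] using this
  · intro t ht
    rw [uIoc_of_le zero_le_one] at ht
    have hQ' := hs t ⟨ht.1.le, ht.2⟩
    rw [norm_mul, norm_div]
    gcongr
    · exact (norm_nonneg _).trans (hB _ hQ')
    · exact hB _ hQ'
    · rw [norm_sub_rev]
      linarith [norm_sub_norm_le z (sgp p q t), hQ _ hQ']

lemma intL_far {L : List (ℂ × ℂ)} {f : ℂ → ℂ} {Q : Set ℂ} {R B : ℝ} (hQ : ∀ z ∈ Q, ‖z‖ ≤ R)
    (hB : ∀ z ∈ Q, ‖f z‖ ≤ B) (hL : InL L Q) :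
    Tendsto (fun z => intL L (fun w => f w / (w - z))) (cocompact ℂ) (𝓝 0) := by
  induction L with
  | nil => simp [intL]
  | cons s L ih =>
    have h1 : InL L Q := fun x hx => hL x (List.mem_cons_of_mem _ hx)
    have h2 := fun t ht => hL s List.mem_cons_self t ht
    simp only [intL, List.map_cons, List.sum_cons] at ih ⊢
    simpa using (segInt_far hQ hB h2).add (ih h1)

lemma dixon {Ω : Set ℂ} (hΩ : IsOpen Ω) (H : CompUnb Ω) {L : List (ℂ × ℂ)} (hL : InL L Ω)
    (hL0 : ∀ F, bdL L F = 0) {f : ℂ → ℂ} (hf : DifferentiableOn ℂ f Ω) {z : ℂ} (hz : z ∈ Ω) :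
    intL L (fun w => dslope f w z) = 0 := by
  obtain ⟨Q, hQ, hQΩ, hLQ⟩ := hL.exists_compact
  obtain ⟨δ, hδ, hprim⟩ := exists_primInv hΩ H hQ hQΩ
  obtain ⟨R, hR⟩ := hQ.isBounded.exists_norm_le
  obtain ⟨B, hB⟩ := hQ.exists_bound_of_continuousOn (hf.continuousOn.mono hQΩ)
  have hinvc : ∀ a ∉ Q, ContinuousOn (fun w : ℂ => 1 / (w - a)) Q := by
    intro a ha
    refine ContinuousOn.div continuousOn_const (by fun_prop) ?_
    intro w hw h
    rw [sub_eq_zero] at h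
    exact ha (h ▸ hw)
  have hind : ∀ a, a ∈ Ω → a ∉ Q → PrimInv Q a →
      intL L (fun w => dslope f w a) = intL L (fun w => f w / (w - a)) := by
    rintro a haΩ haQ ⟨F, hF⟩
    have h0 : intL L (fun w => 1 / (w - a)) = 0 := by
      rw [intL_prim hLQ hF (hinvc a haQ), hL0]
    have h1 : ContinuousOn (fun w => f w / (w - a)) Q := by
      have := (hf.continuousOn.mono hQΩ).mul (hinvc a haQ)
      refine this.congr fun w hw => ?_
      simp [div_eq_mul_inv]
    rw [intL_congr hLQ (g := fun w => f w / (w - a) - f a * (1 / (w - a)))]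
    · rw [intL_lin hLQ (f a) h1 (hinvc a haQ), h0]
      ring
    · intro w hw
      have hne : a ≠ w := fun h => haQ (h ▸ hw)
      rw [dslope_of_ne f hne, slope_def_field]
      have h2 : a - w ≠ 0 := sub_ne_zero.2 hne
      have h3 : w - a ≠ 0 := sub_ne_zero.2 hne.symm
      field_simp
      ring
  classical
  set h : ℂ → ℂ := fun a => if a ∈ Ω then intL L (fun w => dslope f w a) else
    intL L (fun w => f w / (w - a)) with hh
  have hdiff : Differentiable ℂ h := by
    intro a
    by_cases ha : a ∈ Ω
    · obtain ⟨r, hr, hrΩ⟩ := Metric.isOpen_iff.1 hΩ a ha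
      have : DifferentiableAt ℂ (fun a => intL L (fun w => dslope f w a)) a := by
        apply intL_diff (G := fun a w => dslope f w a) hr hL
        · refine (continuousOn_dslope2 hΩ hf).comp (f := fun p : ℂ × ℂ => (p.2, p.1))
            (by fun_prop) ?_
          rintro ⟨x, y⟩ ⟨hx, hy⟩
          exact ⟨hy, hrΩ hx⟩
        · intro w hw
          exact ((Complex.differentiableOn_dslope (hΩ.mem_nhds hw)).2 hf).mono hrΩ
      refine this.congr_of_eventuallyEq ?_
      filter_upwards [hΩ.mem_nhds ha] with x hx
      simp [hh, hx]
    · have hnQ : ∀ x ∈ Metric.ball a δ, x ∉ Q := fun x hx => (hprim a ha x hx).1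
      have hne : ∀ x ∈ Metric.ball a δ, ∀ y ∈ Q, y - x ≠ 0 := by
        intro x hx y hy h
        rw [sub_eq_zero] at h
        exact hnQ x hx (h ▸ hy)
      have : DifferentiableAt ℂ (fun a => intL L (fun w => f w / (w - a))) a := by
        apply intL_diff (G := fun a w => f w / (w - a)) hδ hLQ
        · refine ContinuousOn.div ?_ (by fun_prop) ?_
          · exact (hf.continuousOn.mono hQΩ).comp continuousOn_snd (fun p hp => hp.2)
          · rintro ⟨x, y⟩ ⟨hx, hy⟩
            exact hne x hx y hy
        · intro w hw
          refine DifferentiableOn.div (differentiableOn_const _) (by fun_prop) ?_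
          intro x hx
          exact hne x hx w hw
      refine this.congr_of_eventuallyEq ?_
      filter_upwards [Metric.ball_mem_nhds a hδ] with x hx
      by_cases hxΩ : x ∈ Ω
      · simp only [hh, hxΩ, if_true]
        exact hind x hxΩ (hprim a ha x hx).1 (hprim a ha x hx).2
      · simp [hh, hxΩ]
  have hlim : Tendsto h (cocompact ℂ) (𝓝 0) := by
    refine (intL_far hR hB hLQ).congr' ?_
    filter_upwards [(tendsto_norm_cocompact_atTop (E := ℂ)).eventually_ge_atTop (R + 1)] with x hx
    by_cases hxΩ : x ∈ Ω
    · simp only [hh, hxΩ, if_true]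
      refine (hind x hxΩ ?_ ?_).symm
      · intro hxQ
        linarith [hR x hxQ]
      · exact PrimInv.far (R := R + 1) (fun z hz => by linarith [hR z hz]) hx
    · simp [hh, hxΩ]
  have := hdiff.apply_eq_of_tendsto_cocompact z hlim
  simpa [hh, hz] using this

lemma cauchyL {Ω : Set ℂ} (hΩ : IsOpen Ω) (H : CompUnb Ω) {L : List (ℂ × ℂ)} (hL : InL L Ω)
    (hL0 : ∀ F, bdL L F = 0) {f : ℂ → ℂ} (hf : DifferentiableOn ℂ f Ω) :
    intL L f = 0 := by
  rcases Ω.eq_empty_or_nonempty with rfl | ⟨z, hz⟩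
  · cases L with
    | nil => simp [intL]
    | cons s L => exact absurd (hL s List.mem_cons_self 0 (by simp)) (by simp)
  have hf1 : DifferentiableOn ℂ (fun w => f w * (w - z)) Ω := hf.mul (by fun_prop)
  have := dixon hΩ H hL hL0 hf1 hz
  rw [← this]
  apply intL_congr hL
  intro w hw
  by_cases hwz : z = w
  · subst hwz
    rw [dslope_same]
    have hfd := (hf.differentiableAt (hΩ.mem_nhds hz)).hasDerivAt
    have := (hfd.fun_mul ((hasDerivAt_id' z).sub_const z)).deriv
    simpa using this.symm
  · rw [dslope_of_ne _ hwz, slope_def_field]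
    have h2 : z - w ≠ 0 := sub_ne_zero.2 hwz
    field_simp
    ring

lemma list_sum_map_neg {α : Type*} (L : List α) (g : α → ℂ) :
    (L.map fun s => - g s).sum = - (L.map g).sum := by
  induction L with
  | nil => simp
  | cons s L ih => simp only [List.map_cons, List.sum_cons, ih]; ring

lemma exists_primitive {Ω : Set ℂ} (hΩ : IsOpen Ω) (H : CompUnb Ω) (hcon : IsPreconnected Ω)
    {f : ℂ → ℂ} (hf : DifferentiableOn ℂ f Ω) : ∃ F : ℂ → ℂ, ∀ z ∈ Ω, HasDerivAt F (f z) z := by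
  rcases Ω.eq_empty_or_nonempty with rfl | ⟨z₀, hz₀⟩
  · exact ⟨f, by simp⟩
  let P : ℂ → List (ℂ × ℂ) → Prop := fun z L => InL L Ω ∧ ∀ F, bdL L F = F z - F z₀
  have happ : ∀ z w L, P z L → (∀ t ∈ Icc (0 : ℝ) 1, sgp z w t ∈ Ω) → P w ((z, w) :: L) := by
    rintro z w L ⟨h1, h2⟩ hs
    refine ⟨?_, fun F => ?_⟩
    · intro s hs' t ht
      rcases List.mem_cons.1 hs' with rfl | h
      · exact hs t ht
      · exact h1 s h t ht
    · have := h2 F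
      simp only [bdL, List.map_cons, List.sum_cons] at this ⊢
      rw [this]; ring
  have hball : ∀ z r, Metric.ball z r ⊆ Ω → ∀ x ∈ Metric.ball z r, ∀ y ∈ Metric.ball z r,
      ∀ t ∈ Icc (0 : ℝ) 1, sgp x y t ∈ Metric.ball z r := by
    intro z r hr x hx y hy t ht
    have := (convex_ball z r).add_smul_sub_mem hx hy ht
    simpa [sgp] using this
  have hex : ∀ z ∈ Ω, ∃ L, P z L := by
    set S : Set ℂ := {z | ∃ L, P z L} with hS
    have hSne : (Ω ∩ S).Nonempty := ⟨z₀, hz₀, [], by intro s hs; simp at hs, by simp [bdL]⟩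
    by_contra hcontra
    push Not at hcontra
    obtain ⟨x, hx, hxn⟩ := hcontra
    have hloc : ∀ z ∈ Ω, ∃ r > 0, Metric.ball z r ⊆ Ω ∧ ∀ a ∈ Metric.ball z r,
        ∀ b ∈ Metric.ball z r, a ∈ S → b ∈ S := by
      intro z hz
      obtain ⟨r, hr, hrΩ⟩ := Metric.isOpen_iff.1 hΩ z hz
      refine ⟨r, hr, hrΩ, ?_⟩
      rintro a ha b hb ⟨L, hL⟩
      exact ⟨_, happ a b L hL fun t ht => hrΩ (hball z r hrΩ a ha b hb t ht)⟩
    have ho1 : IsOpen (Ω ∩ S) := by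
      rw [Metric.isOpen_iff]
      rintro z ⟨hz, hzS⟩
      obtain ⟨r, hr, hrΩ, hrS⟩ := hloc z hz
      exact ⟨r, hr, fun w hw => ⟨hrΩ hw, hrS z (Metric.mem_ball_self hr) w hw hzS⟩⟩
    have ho2 : IsOpen (Ω ∩ Sᶜ) := by
      rw [Metric.isOpen_iff]
      rintro z ⟨hz, hzS⟩
      obtain ⟨r, hr, hrΩ, hrS⟩ := hloc z hz
      exact ⟨r, hr, fun w hw => ⟨hrΩ hw, fun hwS => hzS (hrS w hw z (Metric.mem_ball_self hr) hwS)⟩⟩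
    obtain ⟨y, -, hy1, hy2⟩ := hcon _ _ ho1 ho2
      (fun y hy => (em (y ∈ S)).imp (fun h => ⟨hy, h⟩) (fun h => ⟨hy, h⟩))
      (hSne.mono fun y hy => ⟨hy.1, hy⟩) ⟨x, hx, hx, fun ⟨L, hL⟩ => hxn L hL⟩
    exact hy2.2 hy1.2
  choose! A hA using hex
  have huniq : ∀ z L L', P z L → P z L' → intL L f = intL L' f := by
    intro z L L' h h'
    let Lr := L'.map fun s => (s.2, s.1)
    have hrev : ∀ s : ℂ × ℂ, ∀ t : ℝ, sgp s.2 s.1 t = sgp s.1 s.2 (1 - t) := by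
      intro s t; simp [sgp]; ring
    have e1 : ∀ g, intL Lr g = - intL L' g := by
      intro g
      simp only [intL, Lr, List.map_map]
      rw [← list_sum_map_neg]
      congr 1
      apply List.map_congr_left
      intro s _
      simp only [Function.comp, segInt]
      rw [← intervalIntegral.integral_neg]
      have := intervalIntegral.integral_comp_sub_left (a := 0) (b := 1)
        (fun t => g (sgp s.1 s.2 t) * (s.1 - s.2)) 1
      simp only [hrev]
      rw [this]
      simp only [sub_self, sub_zero]
      congr 1
      funext t
      ring
    have e2 : ∀ F, bdL Lr F = - bdL L' F := by
      intro F
      simp only [bdL, Lr, List.map_map]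
      rw [← list_sum_map_neg]
      congr 1
      apply List.map_congr_left
      intro s _
      simp only [Function.comp]
      ring
    have := cauchyL (L := L ++ Lr) hΩ H ?_ ?_ hf
    · have e3 : intL (L ++ Lr) f = intL L f + intL Lr f := by simp [intL]
      rw [e3, e1] at this
      linear_combination this
    · intro s hs t ht
      rcases List.mem_append.1 hs with hs | hs
      · exact h.1 s hs t ht
      · obtain ⟨s', hs', rfl⟩ := List.mem_map.1 hs
        rw [hrev]
        exact h'.1 s' hs' _ ⟨by linarith [ht.2], by linarith [ht.1]⟩
    · intro F
      have e3 : bdL (L ++ Lr) F = bdL L F + bdL Lr F := by simp [bdL]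
      rw [e3, e2, h.2, h'.2]
      ring
  refine ⟨fun z => intL (A z) f, fun z hz => ?_⟩
  obtain ⟨r, hr, hrΩ⟩ := Metric.isOpen_iff.1 hΩ z hz
  obtain ⟨G, hG⟩ := (hf.mono hrΩ).isExactOn_ball
  have hzr := Metric.mem_ball_self (x := z) hr
  have hev : (fun w => intL (A w) f) =ᶠ[𝓝 z] fun w => G w + (intL (A z) f - G z) := by
    filter_upwards [Metric.ball_mem_nhds z hr] with w hw
    have hsb := hball z r hrΩ z hzr w hw
    have h1 := huniq w (A w) ((z, w) :: A z) (hA w (hrΩ hw))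
      (happ z w _ (hA z hz) fun t ht => hrΩ (hsb t ht))
    rw [h1]
    have h2 : segInt f z w = G w - G z := by
      apply segInt_prim (fun t ht => hG _ (hsb t ht))
      exact hf.continuousOn.comp (continuous_sgp _ _).continuousOn fun t ht => hrΩ (hsb t ht)
    have h3 : intL ((z, w) :: A z) f = segInt f z w + intL (A z) f := by
      simp [intL]
    rw [h3, h2]
    ring
  exact ((hG z hzr).add_const _).congr_of_eventuallyEq hev

open Set Topology Filter ComplexConjugate

lemma exists_sqrt {Ω : Set ℂ} (hΩ : IsOpen Ω) (H : CompUnb Ω) (hcon : IsPreconnected Ω)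
    {g : ℂ → ℂ} (hg : DifferentiableOn ℂ g Ω) (hg0 : ∀ z ∈ Ω, g z ≠ 0) :
    ∃ s : ℂ → ℂ, DifferentiableOn ℂ s Ω ∧ ∀ z ∈ Ω, s z ^ 2 = g z := by
  obtain ⟨F, hF⟩ := exists_primitive hΩ H hcon (f := fun z => deriv g z / g z)
    ((hg.deriv hΩ).div hg hg0)
  have hFd : DifferentiableOn ℂ F Ω := fun z hz => (hF z hz).differentiableAt.differentiableWithinAt
  have hd : ∀ z ∈ Ω, HasDerivAt (fun z => g z * Complex.exp (-F z)) 0 z := by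
    intro z hz
    have h1 := (hg.differentiableAt (hΩ.mem_nhds hz)).hasDerivAt
    refine (h1.fun_mul (hF z hz).fun_neg.cexp).congr_deriv ?_
    have := hg0 z hz
    field_simp
    ring
  obtain ⟨c, hc⟩ := hΩ.exists_is_const_of_deriv_eq_zero hcon
    (fun z hz => (hd z hz).differentiableAt.differentiableWithinAt) (fun z hz => (hd z hz).deriv)
  refine ⟨fun z => Complex.exp ((F z + Complex.log c) / 2), ?_, ?_⟩
  · exact ((hFd.add_const _).div_const _).cexp
  · intro z hz
    have h1 : g z * Complex.exp (-F z) = c := hc z hz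
    have hc0 : c ≠ 0 := by
      rw [← h1]
      exact mul_ne_zero (hg0 z hz) (Complex.exp_ne_zero _)
    rw [← Complex.exp_nat_mul]
    rw [show ((2 : ℕ) : ℂ) * ((F z + Complex.log c) / 2) = F z + Complex.log c by push_cast; ring]
    rw [Complex.exp_add, Complex.exp_log hc0, ← h1, mul_comm, mul_assoc, ← Complex.exp_add]
    simp

noncomputable def mob (a u : ℂ) : ℂ := (u - a) / (1 - conj a * u)

lemma mob_den {a u : ℂ} (ha : ‖a‖ < 1) (hu : ‖u‖ < 1) : 1 - conj a * u ≠ 0 := by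
  intro h
  have h1 : conj a * u = 1 := by linear_combination -h
  have h2 : ‖a‖ * ‖u‖ = 1 := by
    have := congrArg norm h1
    rw [norm_mul, RCLike.norm_conj, norm_one] at this
    exact this
  nlinarith [norm_nonneg a, norm_nonneg u]

lemma mob_norm {a u : ℂ} (ha : ‖a‖ < 1) (hu : ‖u‖ < 1) : ‖mob a u‖ < 1 := by
  have h0 := mob_den ha hu
  rw [mob, norm_div, div_lt_one (norm_pos_iff.2 h0)]
  have key : ‖1 - conj a * u‖ ^ 2 - ‖u - a‖ ^ 2 = (1 - ‖a‖ ^ 2) * (1 - ‖u‖ ^ 2) := by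
    simp only [← Complex.normSq_eq_norm_sq, Complex.normSq_apply, Complex.sub_re, Complex.sub_im,
      Complex.mul_re, Complex.mul_im, Complex.conj_re, Complex.conj_im, Complex.one_re,
      Complex.one_im]
    ring
  have h1 : 0 < (1 - ‖a‖ ^ 2) * (1 - ‖u‖ ^ 2) := by
    apply mul_pos <;> nlinarith [norm_nonneg a, norm_nonneg u]
  nlinarith [norm_nonneg (1 - conj a * u), norm_nonneg (u - a)]

lemma one_sub_normSq_ne {a : ℂ} (ha : ‖a‖ < 1) : 1 - conj a * a ≠ 0 := mob_den ha ha

lemma mob_inj {a u v : ℂ} (ha : ‖a‖ < 1) (hu : ‖u‖ < 1) (hv : ‖v‖ < 1) (h : mob a u = mob a v) :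
    u = v := by
  rw [mob, mob, div_eq_div_iff (mob_den ha hu) (mob_den ha hv)] at h
  have : (1 - conj a * a) * (u - v) = 0 := by linear_combination h
  rcases mul_eq_zero.1 this with h | h
  · exact absurd h (one_sub_normSq_ne ha)
  · exact sub_eq_zero.1 h

lemma mob_deriv {a u : ℂ} (ha : ‖a‖ < 1) (hu : ‖u‖ < 1) :
    HasDerivAt (mob a) ((1 - conj a * a) / (1 - conj a * u) ^ 2) u := by
  have h0 := mob_den ha hu
  have h1 := ((hasDerivAt_id' u).sub_const a).fun_div
    (((hasDerivAt_id' u).const_mul (conj a)).const_sub 1) h0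
  refine HasDerivAt.congr_deriv (f := mob a) h1 ?_
  congr 1
  ring

lemma tlu_of_pointwise {ι : Type*} {Ω : Set ℂ} (hΩ : IsOpen Ω) {F : ι → ℂ → ℂ} {p : Filter ι}
    [p.NeBot] {g : ℂ → ℂ} (hF : ∀ n, DifferentiableOn ℂ (F n) Ω)
    (hb : ∀ n, ∀ z ∈ Ω, ‖F n z‖ ≤ 1) (hg : ∀ z ∈ Ω, Tendsto (fun n => F n z) p (𝓝 (g z))) :
    TendstoLocallyUniformlyOn F g p Ω := by
  rw [Metric.tendstoLocallyUniformlyOn_iff]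
  intro ε hε z hz
  obtain ⟨R, hR, hRΩ⟩ := Metric.isOpen_iff.1 hΩ z hz
  obtain ⟨r, hr, rfl⟩ : ∃ r > 0, R = 2 * r := ⟨R / 2, by linarith, by ring⟩
  set C := Real.nnabs (2 * 1 / r)
  have hlip : ∀ n, LipschitzOnWith C (F n) (Metric.ball z r) := fun n =>
    lip_of_bound hr ((hF n).mono hRΩ) (fun w hw => hb n w (hRΩ hw))
  have hsub : Metric.ball z r ⊆ Ω := (Metric.ball_subset_ball (by linarith)).trans hRΩ
  have hzr := Metric.mem_ball_self (x := z) hr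
  have hglip : ∀ y ∈ Metric.ball z r, dist (g y) (g z) ≤ C * dist y z := by
    intro y hy
    exact le_of_tendsto ((hg y (hsub hy)).dist (hg z hz))
      (Eventually.of_forall fun n => (hlip n).dist_le_mul y hy z hzr)
  set η := min r (ε / (3 * (C + 1))) with hη
  have hC : (0 : ℝ) ≤ C := C.2
  have hηpos : 0 < η := lt_min hr (by positivity)
  refine ⟨Metric.ball z η, mem_nhdsWithin_of_mem_nhds (Metric.ball_mem_nhds z hηpos), ?_⟩
  filter_upwards [(Metric.tendsto_nhds.1 (hg z hz)) (ε / 3) (by linarith)] with n hn y hy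
  have hyr : y ∈ Metric.ball z r := Metric.ball_subset_ball (min_le_left _ _) hy
  have hyε : C * dist y z < ε / 3 := by
    have h1 : dist y z < ε / (3 * (C + 1)) := lt_of_lt_of_le hy (min_le_right _ _)
    rw [lt_div_iff₀ (by positivity)] at h1
    nlinarith [dist_nonneg (x := y) (y := z)]
  calc dist (g y) (F n y) ≤ dist (g y) (g z) + dist (g z) (F n z) + dist (F n z) (F n y) :=
        dist_triangle4 _ _ _ _
    _ < ε / 3 + ε / 3 + ε / 3 := by
        have h2 := (hlip n).dist_le_mul z hzr y hyr
        rw [dist_comm z y] at h2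
        rw [dist_comm] at hn
        have h3 := hglip y hyr
        linarith
    _ = ε := by ring

lemma hurwitz_inj {ι : Type*} {Ω : Set ℂ} (hΩ : IsOpen Ω) (hcon : IsPreconnected Ω)
    {F : ι → ℂ → ℂ} {p : Filter ι} [p.NeBot] {g : ℂ → ℂ} (hF : ∀ n, DifferentiableOn ℂ (F n) Ω)
    (hinj : ∀ n, InjOn (F n) Ω) (hg : TendstoLocallyUniformlyOn F g p Ω)
    {z₀ : ℂ} (hz₀ : z₀ ∈ Ω) (hd : deriv g z₀ ≠ 0) : InjOn g Ω := by
  intro z₁ h1 z₂ h2 h12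
  by_contra hne
  have hgd : DifferentiableOn ℂ g Ω := hg.differentiableOn (Eventually.of_forall hF) hΩ
  have hga : AnalyticOnNhd ℂ (fun z => g z - g z₁) Ω :=
    (hgd.sub (differentiableOn_const _)).analyticOnNhd hΩ
  have hiso : ∀ᶠ z in 𝓝[≠] z₂, g z - g z₁ ≠ 0 := by
    rcases (hga z₂ h2).eventually_eq_zero_or_eventually_ne_zero with h | h
    · exfalso
      have hz := hga.eqOn_zero_of_preconnected_of_eventuallyEq_zero hcon h2 h
      apply hd
      have : g =ᶠ[𝓝 z₀] fun _ => g z₁ := by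
        filter_upwards [hΩ.mem_nhds hz₀] with z hzΩ
        exact sub_eq_zero.1 (hz hzΩ)
      rw [this.deriv_eq]
      simp
    · exact h
  rw [eventually_nhdsWithin_iff] at hiso
  have hopen : IsOpen (Ω \ {z₁}) := hΩ.sdiff isClosed_singleton
  obtain ⟨R, hR, hRs⟩ := Metric.mem_nhds_iff.1 (inter_mem hiso
    (hopen.mem_nhds ⟨h2, fun h => hne h.symm⟩))
  have hR2 : 0 < R / 2 := half_pos hR
  have hcb : Metric.closedBall z₂ (R / 2) ⊆ Metric.ball z₂ R :=
    Metric.closedBall_subset_ball (by linarith)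
  have hcbΩ : Metric.closedBall z₂ (R / 2) ⊆ Ω := fun z hz => (hRs (hcb hz)).2.1
  have hsphΩ : Metric.sphere z₂ (R / 2) ⊆ Ω := Metric.sphere_subset_closedBall.trans hcbΩ
  have hsc : IsCompact (Metric.sphere z₂ (R / 2)) := isCompact_sphere _ _
  obtain ⟨zm, hzm, hmin⟩ := hsc.exists_isMinOn (NormedSpace.sphere_nonempty.2 hR2.le)
    (f := fun z => ‖g z - g z₁‖) ((hgd.continuousOn.mono hsphΩ).sub continuousOn_const).norm
  set δ := ‖g zm - g z₁‖ / 3 with hδ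
  have hδpos : 0 < δ := by
    have : g zm - g z₁ ≠ 0 := by
      apply (hRs (hcb (Metric.sphere_subset_closedBall hzm))).1
      rintro rfl
      rw [Metric.mem_sphere, dist_self] at hzm
      linarith
    positivity
  have hun : TendstoUniformlyOn F g p (Metric.sphere z₂ (R / 2)) :=
    (tendstoLocallyUniformlyOn_iff_tendstoUniformlyOn_of_compact hsc).1 (hg.mono hsphΩ)
  have e1 := Metric.tendstoUniformlyOn_iff.1 hun δ hδpos
  have hpt : ∀ z ∈ Ω, Tendsto (fun n => F n z) p (𝓝 (g z)) := fun z hz => hg.tendsto_at hz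
  have e2 := Metric.tendsto_nhds.1 (hpt z₁ h1) δ hδpos
  have e3 := Metric.tendsto_nhds.1 ((hpt z₂ h2).sub (hpt z₁ h1)) δ hδpos
  obtain ⟨n, hn1, hn2, hn3⟩ := (e1.and (e2.and e3)).exists
  have hnz : ∀ z ∈ Metric.closedBall z₂ (R / 2), F n z - F n z₁ ≠ 0 := by
    intro z hz h
    have := hinj n (hcbΩ hz) h1 (sub_eq_zero.1 h)
    exact (hRs (hcb hz)).2.2 this
  have hdi : DifferentiableOn ℂ (fun z => (F n z - F n z₁)⁻¹) (Metric.closedBall z₂ (R / 2)) :=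
    (((hF n).mono hcbΩ).sub (differentiableOn_const _)).inv hnz
  have hbound := Complex.norm_le_of_forall_mem_frontier_norm_le (U := Metric.ball z₂ (R / 2))
    (C := δ⁻¹) Metric.isBounded_ball (hdi.diffContOnCl_ball subset_rfl) (z := z₂) ?_
    (subset_closure (Metric.mem_ball_self hR2))
  · rw [norm_inv, inv_le_inv₀ (norm_pos_iff.2 (hnz z₂ (Metric.mem_closedBall_self hR2.le))) hδpos]
      at hbound
    rw [h12, sub_self, dist_zero_right] at hn3
    linarith
  · intro z hz
    rw [frontier_ball _ hR2.ne'] at hz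
    rw [norm_inv]
    apply inv_anti₀ hδpos
    have a1 : 3 * δ ≤ ‖g z - g z₁‖ := by
      have : ‖g zm - g z₁‖ ≤ ‖g z - g z₁‖ := hmin hz
      rw [hδ]; linarith
    have a2 := hn1 z hz
    rw [dist_eq_norm] at a2 hn2
    have a3 : g z - g z₁ = (g z - F n z) + (F n z - F n z₁) + (F n z₁ - g z₁) := by ring
    have a4 := norm_add₃_le (a := g z - F n z) (b := F n z - F n z₁) (c := F n z₁ - g z₁)
    rw [← a3] at a4
    linarith

open Set Topology Filter ComplexConjugate

def RFam (Ω : Set ℂ) (z₀ : ℂ) (g : ℂ → ℂ) : Prop :=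
  DifferentiableOn ℂ g Ω ∧ InjOn g Ω ∧ (∀ z ∈ Ω, ‖g z‖ < 1) ∧ g z₀ = 0

lemma RFam.exists {Ω : Set ℂ} (hΩ : IsOpen Ω) (H : CompUnb Ω) (hcon : IsPreconnected Ω)
    {z₀ a : ℂ} (hz₀ : z₀ ∈ Ω) (ha : a ∉ Ω) : ∃ g, RFam Ω z₀ g ∧ deriv g z₀ ≠ 0 := by
  obtain ⟨s, hs, hs2⟩ := exists_sqrt hΩ H hcon (g := fun z => z - a) (by fun_prop)
    (fun z hz h => ha (by rw [← sub_eq_zero.1 h]; exact hz))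
  have hne : ∀ z ∈ Ω, s z ≠ 0 := by
    intro z hz h
    have := hs2 z hz
    rw [h] at this
    have : z = a := by linear_combination -this
    exact ha (this ▸ hz)
  have hsinj : ∀ z ∈ Ω, ∀ w ∈ Ω, s z ^ 2 = s w ^ 2 → z = w := by
    intro z hz w hw h
    rw [hs2 z hz, hs2 w hw] at h
    linear_combination h
  have hsd := (hs.differentiableAt (hΩ.mem_nhds hz₀)).hasDerivAt
  have hsd0 : deriv s z₀ ≠ 0 := by
    intro h0
    have h1 := (hsd.fun_pow 2).deriv
    have h2 : (fun z => s z ^ 2) =ᶠ[𝓝 z₀] fun z => z - a := by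
      filter_upwards [hΩ.mem_nhds hz₀] with z hz using hs2 z hz
    rw [h2.deriv_eq, h0] at h1
    simp at h1
  have hopen : IsOpen (s '' Ω) := by
    rcases (hs.analyticOnNhd hΩ).is_constant_or_isOpen hcon with ⟨w, hw⟩ | h
    · exfalso
      apply hsd0
      have : s =ᶠ[𝓝 z₀] fun _ => w := by
        filter_upwards [hΩ.mem_nhds hz₀] with z hz using hw z hz
      rw [this.deriv_eq]; simp
    · exact h Ω subset_rfl hΩ
  obtain ⟨r, hr, hrs⟩ := Metric.isOpen_iff.1 hopen (s z₀) ⟨z₀, hz₀, rfl⟩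
  have hfar : ∀ z ∈ Ω, r ≤ ‖s z + s z₀‖ := by
    intro z hz
    by_contra hlt
    push Not at hlt
    obtain ⟨w, hw, hws⟩ := hrs (show - s z ∈ Metric.ball (s z₀) r by
      rw [Metric.mem_ball, dist_eq_norm, ← norm_neg]
      rwa [show -(-s z - s z₀) = s z + s z₀ by ring])
    have hwz := hsinj w hw z hz (by rw [hws]; ring)
    rw [hwz] at hws
    exact hne z hz (by linear_combination hws / 2)
  have hden : ∀ z ∈ Ω, s z + s z₀ ≠ 0 := fun z hz h => by
    have := hfar z hz
    rw [h, norm_zero] at this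
    linarith
  refine ⟨fun z => (r / 3 : ℝ) * (1 / (s z + s z₀) - 1 / (s z₀ + s z₀)), ⟨?_, ?_, ?_, ?_⟩, ?_⟩
  · exact (((differentiableOn_const _).div (hs.add_const _) hden).sub_const _).const_mul _
  · intro z hz w hw h
    have hr3 : ((r / 3 : ℝ) : ℂ) ≠ 0 := by
      rw [Complex.ofReal_ne_zero]; positivity
    have h1 := mul_left_cancel₀ hr3 h
    have h2 : 1 / (s z + s z₀) = 1 / (s w + s z₀) := sub_left_injective h1
    rw [div_eq_div_iff (hden z hz) (hden w hw)] at h2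
    apply hsinj z hz w hw
    have : s z = s w := by linear_combination -h2
    rw [this]
  · intro z hz
    rw [norm_mul, Complex.norm_real, Real.norm_eq_abs, abs_of_pos (by positivity)]
    have hb : ∀ w ∈ Ω, ‖1 / (s w + s z₀)‖ ≤ 1 / r := by
      intro w hw
      rw [norm_div, norm_one]
      exact one_div_le_one_div_of_le hr (hfar w hw)
    have h1 := norm_sub_le (1 / (s z + s z₀)) (1 / (s z₀ + s z₀))
    have h2 := hb z hz
    have h3 := hb z₀ hz₀
    calc r / 3 * ‖1 / (s z + s z₀) - 1 / (s z₀ + s z₀)‖ ≤ r / 3 * (1 / r + 1 / r) := by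
          gcongr
          linarith
      _ = 2 / 3 := by field_simp; norm_num
      _ < 1 := by norm_num
  · simp
  · have h1 := ((((hasDerivAt_const z₀ (1 : ℂ)).fun_div (hsd.add_const (s z₀)) (hden z₀ hz₀)).sub_const
      (1 / (s z₀ + s z₀))).const_mul ((r / 3 : ℝ) : ℂ)).deriv
    rw [h1]
    have hr3 : ((r / 3 : ℝ) : ℂ) ≠ 0 := by
      rw [Complex.ofReal_ne_zero]; positivity
    refine mul_ne_zero hr3 (div_ne_zero ?_ (pow_ne_zero _ (hden z₀ hz₀)))
    simpa using hsd0

lemma RFam.improve {Ω : Set ℂ} (hΩ : IsOpen Ω) (H : CompUnb Ω) (hcon : IsPreconnected Ω)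
    {z₀ : ℂ} (hz₀ : z₀ ∈ Ω) {g : ℂ → ℂ} (hg : RFam Ω z₀ g) (hd : deriv g z₀ ≠ 0) {w : ℂ}
    (hw : ‖w‖ < 1) (hwg : w ∉ g '' Ω) : ∃ g₂, RFam Ω z₀ g₂ ∧ ‖deriv g z₀‖ < ‖deriv g₂ z₀‖ := by
  obtain ⟨hgd, hgi, hgb, hg0⟩ := hg
  have hmd : DifferentiableOn ℂ (fun z => mob w (g z)) Ω := by
    intro z hz
    have h1 := (hgd.differentiableAt (hΩ.mem_nhds hz)).hasDerivAt
    exact ((mob_deriv hw (hgb z hz)).comp z h1).differentiableAt.differentiableWithinAt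
  have hmne : ∀ z ∈ Ω, mob w (g z) ≠ 0 := by
    intro z hz h
    rw [mob, div_eq_zero_iff, or_iff_left (mob_den hw (hgb z hz)), sub_eq_zero] at h
    exact hwg ⟨z, hz, h⟩
  obtain ⟨s, hs, hs2⟩ := exists_sqrt hΩ H hcon hmd hmne
  have hsb : ∀ z ∈ Ω, ‖s z‖ < 1 := by
    intro z hz
    have h1 := mob_norm hw (hgb z hz)
    rw [← hs2 z hz, norm_pow] at h1
    nlinarith [norm_nonneg (s z)]
  have hsi : InjOn s Ω := by
    intro x hx y hy h
    apply hgi hx hy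
    apply mob_inj hw (hgb x hx) (hgb y hy)
    rw [← hs2 x hx, ← hs2 y hy, h]
  set α := s z₀ with hα
  have hαb : ‖α‖ < 1 := hsb z₀ hz₀
  have hα2 : α ^ 2 = -w := by rw [hα, hs2 z₀ hz₀, hg0, mob]; simp
  have hα0 : α ≠ 0 := by
    intro h
    have := hs2 z₀ hz₀
    rw [← hα, h] at this
    exact hmne z₀ hz₀ (by rw [← this]; simp)
  have hsd := (hs.differentiableAt (hΩ.mem_nhds hz₀)).hasDerivAt
  have hgdz := (hgd.differentiableAt (hΩ.mem_nhds hz₀)).hasDerivAt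
  have hrel : 2 * α * deriv s z₀ = (1 - conj w * w) * deriv g z₀ := by
    have h1 := (hsd.fun_pow 2).deriv
    have h2 : (fun z => s z ^ 2) =ᶠ[𝓝 z₀] fun z => mob w (g z) := by
      filter_upwards [hΩ.mem_nhds hz₀] with z hz using hs2 z hz
    have h3 := ((mob_deriv hw (hgb z₀ hz₀)).comp z₀ hgdz).deriv
    rw [h2.deriv_eq] at h1
    change deriv (fun z => mob w (g z)) z₀ = _ at h3
    rw [h3, hg0] at h1
    simp only [mul_zero, sub_zero, one_pow, div_one] at h1
    rw [h1]
    simp [hα]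
  refine ⟨fun z => mob α (s z), ⟨?_, ?_, ?_, ?_⟩, ?_⟩
  · intro z hz
    have h1 := (hs.differentiableAt (hΩ.mem_nhds hz)).hasDerivAt
    exact ((mob_deriv hαb (hsb z hz)).comp z h1).differentiableAt.differentiableWithinAt
  · intro x hx y hy h
    exact hsi hx hy (mob_inj hαb (hsb x hx) (hsb y hy) h)
  · intro z hz
    exact mob_norm hαb (hsb z hz)
  · simp [mob, hα]
  · have h3 := ((mob_deriv hαb (hsb z₀ hz₀)).comp z₀ hsd).deriv
    change deriv (fun z => mob α (s z)) z₀ = _ at h3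
    rw [h3, ← hα]
    have h4 : (1 - conj α * α) / (1 - conj α * α) ^ 2 = 1 / (1 - conj α * α) := by
      have := one_sub_normSq_ne hαb
      field_simp
    have hcw : ∀ b : ℂ, 1 - conj b * b = ((1 - ‖b‖ ^ 2 : ℝ) : ℂ) := by
      intro b
      rw [Complex.conj_mul']
      push_cast
      ring
    have hwn : ‖w‖ = ‖α‖ ^ 2 := by rw [← norm_pow, hα2, norm_neg]
    rw [h4, norm_mul, norm_div, norm_one]
    have hn := congrArg norm hrel
    rw [hcw, norm_mul, norm_mul, norm_mul, Complex.norm_real, hwn] at hn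
    rw [hcw, Complex.norm_real]
    have hαpos : 0 < ‖α‖ := norm_pos_iff.2 hα0
    have hgpos : 0 < ‖deriv g z₀‖ := norm_pos_iff.2 hd
    have hx1 : 0 < 1 - ‖α‖ ^ 2 := by nlinarith
    have hx2 : 1 - (‖α‖ ^ 2) ^ 2 = (1 - ‖α‖ ^ 2) * (1 + ‖α‖ ^ 2) := by ring
    rw [hx2, Real.norm_of_nonneg (by positivity)] at hn
    rw [Real.norm_of_nonneg hx1.le]
    rw [one_div, inv_mul_eq_div, lt_div_iff₀ hx1]
    simp only [Complex.norm_two] at hn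
    have hlt : 2 * ‖α‖ < 1 + ‖α‖ ^ 2 := by nlinarith [sq_pos_of_pos (sub_pos.2 hαb)]
    have : 2 * ‖α‖ * (‖deriv g z₀‖ * (1 - ‖α‖ ^ 2)) < 2 * ‖α‖ * ‖deriv s z₀‖ := by
      rw [hn]
      have : 0 < ‖deriv g z₀‖ * (1 - ‖α‖ ^ 2) := by positivity
      nlinarith
    exact lt_of_mul_lt_mul_left this (by positivity)

lemma RFam.exists_max {Ω : Set ℂ} (hΩ : IsOpen Ω) (hcon : IsPreconnected Ω)
    {z₀ : ℂ} (hz₀ : z₀ ∈ Ω) {g₀ : ℂ → ℂ} (hg₀ : RFam Ω z₀ g₀) (hd : deriv g₀ z₀ ≠ 0) :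
    ∃ g, RFam Ω z₀ g ∧ deriv g z₀ ≠ 0 ∧ ∀ g₂, RFam Ω z₀ g₂ → ‖deriv g₂ z₀‖ ≤ ‖deriv g z₀‖ := by
  set A : Set ℝ := {x | ∃ g, RFam Ω z₀ g ∧ ‖deriv g z₀‖ = x} with hA
  have hAne : A.Nonempty := ⟨_, g₀, hg₀, rfl⟩
  obtain ⟨R, hR, hRΩ⟩ := Metric.isOpen_iff.1 hΩ z₀ hz₀
  have hcb : Metric.closedBall z₀ (R / 2) ⊆ Ω :=
    (Metric.closedBall_subset_ball (by linarith)).trans hRΩ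
  have hAb : BddAbove A := by
    refine ⟨1 / (R / 2), ?_⟩
    rintro _ ⟨g, hg, rfl⟩
    exact Complex.norm_deriv_le_of_forall_mem_sphere_norm_le (half_pos hR)
      ((hg.1.mono hcb).diffContOnCl_ball subset_rfl)
      (fun z hz => (hg.2.2.1 z (hcb (Metric.sphere_subset_closedBall hz))).le)
  obtain ⟨u, -, hut, huA⟩ := exists_seq_tendsto_sSup hAne hAb
  choose G hG hGu using huA
  let p : Filter ℕ := (hyperfilter ℕ : Filter ℕ)
  have hp : p ≤ atTop := by
    rw [← Nat.cofinite_eq_atTop]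
    exact hyperfilter_le_cofinite
  have hlim : ∀ z, ∃ y, z ∈ Ω → Tendsto (fun n => G n z) p (𝓝 y) := by
    intro z
    by_cases hz : z ∈ Ω
    · have := (isCompact_closedBall (0 : ℂ) 1).ultrafilter_le_nhds
        ((hyperfilter ℕ).map fun n => G n z) ?_
      · obtain ⟨y, -, hy⟩ := this
        exact ⟨y, fun _ => hy⟩
      · rw [le_principal_iff]
        refine Ultrafilter.mem_map.2 (Eventually.of_forall (fun n : ℕ => ?_))
        simpa using ((hG n).2.2.1 z hz).le
    · exact ⟨0, fun h => absurd h hz⟩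
  choose g hg using hlim
  have htlu : TendstoLocallyUniformlyOn G g p Ω :=
    tlu_of_pointwise hΩ (fun n => (hG n).1) (fun n z hz => ((hG n).2.2.1 z hz).le) hg
  have hgd : DifferentiableOn ℂ g Ω :=
    htlu.differentiableOn (Eventually.of_forall fun n => (hG n).1) hΩ
  have hder : Tendsto (fun n => ‖deriv (G n) z₀‖) p (𝓝 ‖deriv g z₀‖) :=
    ((htlu.deriv (Eventually.of_forall fun n => (hG n).1) hΩ).tendsto_at hz₀).norm
  have hM : ‖deriv g z₀‖ = sSup A := by
    refine tendsto_nhds_unique hder ?_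
    simp only [hGu]
    exact hut.mono_left hp
  have hmax : ∀ g₂, RFam Ω z₀ g₂ → ‖deriv g₂ z₀‖ ≤ ‖deriv g z₀‖ := by
    intro g₂ hg₂
    rw [hM]
    exact le_csSup hAb ⟨g₂, hg₂, rfl⟩
  have hd' : deriv g z₀ ≠ 0 := by
    rw [← norm_pos_iff]
    exact lt_of_lt_of_le (norm_pos_iff.2 hd) (hmax g₀ hg₀)
  have hg0 : g z₀ = 0 := by
    refine tendsto_nhds_unique (hg z₀ hz₀) ?_
    simp only [fun n => (hG n).2.2.2]
    exact tendsto_const_nhds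
  have hgle : ∀ z ∈ Ω, ‖g z‖ ≤ 1 := fun z hz =>
    le_of_tendsto (hg z hz).norm (Eventually.of_forall fun n => ((hG n).2.2.1 z hz).le)
  refine ⟨g, ⟨hgd, hurwitz_inj hΩ hcon (fun n => (hG n).1) (fun n => (hG n).2.1) htlu hz₀ hd',
    ?_, hg0⟩, hd', hmax⟩
  intro z hz
  refine lt_of_le_of_ne (hgle z hz) fun h1 => ?_
  have := Complex.norm_eqOn_of_isPreconnected_of_isMaxOn hcon hΩ hgd hz
    (fun y hy => by change ‖g y‖ ≤ ‖g z‖; rw [h1]; exact hgle y hy) hz₀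
  simp [hg0, h1] at this

theorem riemann_mapping {Ω : Set ℂ} (hΩ : IsOpen Ω) (H : CompUnb Ω) (hcon : IsPreconnected Ω)
    (hne : Ω.Nonempty) : ∃ e : ℂ → ℂ, IsOpenEmbedding e ∧ range e = Ω := by
  by_cases hU : Ω = univ
  · exact ⟨id, IsOpenEmbedding.id, by simp [hU]⟩
  obtain ⟨a, ha⟩ := (ne_univ_iff_exists_notMem Ω).1 hU
  obtain ⟨z₀, hz₀⟩ := hne
  obtain ⟨g₀, hg₀, hd₀⟩ := RFam.exists hΩ H hcon hz₀ ha
  obtain ⟨g, hg, hd, hmax⟩ := RFam.exists_max hΩ hcon hz₀ hg₀ hd₀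
  have hsurj : ∀ w ∈ Metric.ball (0 : ℂ) 1, ∃ z ∈ Ω, g z = w := by
    intro w hw
    by_contra hc
    obtain ⟨g₂, h2, hlt⟩ := RFam.improve hΩ H hcon hz₀ hg hd (mem_ball_zero_iff.1 hw) hc
    exact absurd (hmax g₂ h2) (not_le.2 hlt)
  have hop : ∀ s ⊆ Ω, IsOpen s → IsOpen (g '' s) := by
    rcases (hg.1.analyticOnNhd hΩ).is_constant_or_isOpen hcon with ⟨w, hw⟩ | h
    · exfalso
      apply hd
      have : g =ᶠ[𝓝 z₀] fun _ => w := by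
        filter_upwards [hΩ.mem_nhds hz₀] with z hz using hw z hz
      rw [this.deriv_eq]; simp
    · exact h
  let G : Ω → Metric.ball (0 : ℂ) 1 := fun z => ⟨g z, mem_ball_zero_iff.2 (hg.2.2.1 z z.2)⟩
  have hGb : Function.Bijective G := by
    constructor
    · intro x y h
      exact Subtype.ext (hg.2.1 x.2 y.2 (congrArg Subtype.val h))
    · rintro ⟨w, hw⟩
      obtain ⟨z, hz, rfl⟩ := hsurj w hw
      exact ⟨⟨z, hz⟩, rfl⟩
  have hGc : Continuous G := (hg.1.continuousOn.domRestrict).subtype_mk _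
  have hGo : IsOpenMap G := by
    intro s hs
    rw [Metric.isOpen_ball.isOpenEmbedding_subtypeVal.isOpen_iff_image_isOpen]
    have : Subtype.val '' (G '' s) = g '' (Subtype.val '' s) := by
      rw [image_image, image_image]
    rw [this]
    apply hop
    · rintro _ ⟨x, _, rfl⟩
      exact x.2
    · exact hΩ.isOpenEmbedding_subtypeVal.isOpenMap s hs
  let E : Ω ≃ₜ Metric.ball (0 : ℂ) 1 := (Equiv.ofBijective G hGb).toHomeomorphOfContinuousOpen hGc hGo
  refine ⟨fun z => (E.symm (Homeomorph.unitBall z) : ℂ), ?_, ?_⟩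
  · exact (hΩ.isOpenEmbedding_subtypeVal.comp E.symm.isOpenEmbedding).comp
      Homeomorph.unitBall.isOpenEmbedding
  · ext z
    constructor
    · rintro ⟨x, rfl⟩
      exact (E.symm _).2
    · intro hz
      exact ⟨Homeomorph.unitBall.symm (E ⟨z, hz⟩), by simp⟩

open Set Topology Filter

/-- tent function -/
noncomputable def tent (u v x z : ℝ) : ℝ := max 0 (min ((z - u) / (x - u)) ((v - z) / (v - x)))

noncomputable def tmove (u v x y z : ℝ) : ℝ := z + (y - x) * tent u v x z

lemma tent_left {u v x z : ℝ} (hux : u < x) (hz : z ≤ u) : tent u v x z = 0 := by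
  apply max_eq_left
  exact (min_le_left _ _).trans (div_nonpos_of_nonpos_of_nonneg (by linarith) (by linarith))

lemma tent_right {u v x z : ℝ} (hxv : x < v) (hz : v ≤ z) : tent u v x z = 0 := by
  apply max_eq_left
  exact (min_le_right _ _).trans (div_nonpos_of_nonpos_of_nonneg (by linarith) (by linarith))

lemma tent_mid1 {u v x z : ℝ} (hux : u < x) (hxv : x < v) (h1 : u ≤ z) (h2 : z ≤ x) :
    tent u v x z = (z - u) / (x - u) := by
  have a : (z - u) / (x - u) ≤ 1 := by rw [div_le_one (by linarith)]; linarith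
  have b : 1 ≤ (v - z) / (v - x) := by rw [le_div_iff₀ (by linarith)]; linarith
  rw [tent, min_eq_left (by linarith), max_eq_right]
  exact div_nonneg (by linarith) (by linarith)

lemma tent_mid2 {u v x z : ℝ} (hux : u < x) (hxv : x < v) (h1 : x ≤ z) (h2 : z ≤ v) :
    tent u v x z = (v - z) / (v - x) := by
  have a : (v - z) / (v - x) ≤ 1 := by rw [div_le_one (by linarith)]; linarith
  have b : 1 ≤ (z - u) / (x - u) := by rw [le_div_iff₀ (by linarith)]; linarith
  rw [tent, min_eq_right (by linarith), max_eq_right]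
  exact div_nonneg (by linarith) (by linarith)

lemma tmove_x {u v x y : ℝ} (hux : u < x) (hxv : x < v) : tmove u v x y x = y := by
  rw [tmove, tent_mid1 hux hxv hux.le le_rfl, div_self (by linarith)]; ring

lemma tmove_left {u v x y z : ℝ} (hux : u < x) (hz : z ≤ u) : tmove u v x y z = z := by
  rw [tmove, tent_left hux hz]; ring

lemma tmove_right {u v x y z : ℝ} (hxv : x < v) (hz : v ≤ z) : tmove u v x y z = z := by
  rw [tmove, tent_right hxv hz]; ring

lemma tmove_inv {u v x y : ℝ} (hux : u < x) (hxv : x < v) (huy : u < y) (hyv : y < v) (z : ℝ) :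
    tmove u v y x (tmove u v x y z) = z := by
  rcases le_total z u with h | h
  · rw [tmove_left hux h, tmove_left huy h]
  rcases le_total v z with h' | h'
  · rw [tmove_right hxv h', tmove_right hyv h']
  have a1 : x - u ≠ 0 := by linarith
  have a2 : v - x ≠ 0 := by linarith
  have a3 : y - u ≠ 0 := by linarith
  have a4 : v - y ≠ 0 := by linarith
  rcases le_total z x with h2 | h2
  · have e : tmove u v x y z = u + (z - u) * ((y - u) / (x - u)) := by
      rw [tmove, tent_mid1 hux hxv h h2]; field_simp; ring
    have p1 : 0 ≤ (z - u) * ((y - u) / (x - u)) :=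
      mul_nonneg (by linarith) (div_nonneg (by linarith) (by linarith))
    have p2 : (z - u) * ((y - u) / (x - u)) ≤ y - u := by
      rw [mul_div_assoc', div_le_iff₀ (by linarith)]
      nlinarith
    rw [tmove, e, tent_mid1 huy hyv (by linarith) (by linarith)]
    field_simp; ring
  · have e : tmove u v x y z = v - (v - z) * ((v - y) / (v - x)) := by
      rw [tmove, tent_mid2 hux hxv h2 h']; field_simp; ring
    have p1 : 0 ≤ (v - z) * ((v - y) / (v - x)) :=
      mul_nonneg (by linarith) (div_nonneg (by linarith) (by linarith))
    have p2 : (v - z) * ((v - y) / (v - x)) ≤ v - y := by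
      rw [mul_div_assoc', div_le_iff₀ (by linarith)]
      nlinarith
    rw [tmove, e, tent_mid2 huy hyv (by linarith) (by linarith)]
    field_simp; ring

noncomputable def tmoveH (u v x y : ℝ) (hux : u < x) (hxv : x < v) (huy : u < y) (hyv : y < v) :
    ℝ ≃ₜ ℝ where
  toFun := tmove u v x y
  invFun := tmove u v y x
  left_inv := tmove_inv hux hxv huy hyv
  right_inv := tmove_inv huy hyv hux hxv
  continuous_toFun := by unfold tmove tent; fun_prop
  continuous_invFun := by unfold tmove tent; fun_prop

lemma exists_tmove (u v x y : ℝ) (hux : u < x) (hxv : x < v) (huy : u < y) (hyv : y < v) :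
    ∃ α : ℝ ≃ₜ ℝ, StrictMono α ∧ α x = y ∧ (∀ z ≤ u, α z = z) ∧ ∀ z ≥ v, α z = z := by
  refine ⟨tmoveH u v x y hux hxv huy hyv, ?_, tmove_x hux hxv, fun z hz => tmove_left hux hz,
    fun z hz => tmove_right hxv hz⟩
  set α := tmoveH u v x y hux hxv huy hyv
  rcases α.continuous.strictMono_of_inj α.injective with h | h
  · exact h
  · exfalso
    have h1 : α u = u := tmove_left hux le_rfl
    have h2 : α v = v := tmove_right hxv le_rfl
    have := h (hux.trans hxv)
    rw [h1, h2] at this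
    linarith

section
variable {X D : Type*} [TopologicalSpace X] [TopologicalSpace D] [T2Space D]

/-- Transport of a compactly supported homeomorphism through an open embedding. -/
lemma transport_aux {φ : X → D} (hφ : IsOpenEmbedding φ) (β : X ≃ₜ X) {C : Set X}
    (hC : IsCompact C) (hβ : ∀ x ∉ C, β x = x) (F : D → D) (hF : ∀ x, F (φ x) = φ (β x))
    (hF' : ∀ d ∉ range φ, F d = d) : Continuous F := by
  rw [continuous_iff_continuousAt]
  intro d
  by_cases hd : d ∈ φ '' C
  · obtain ⟨x, hx, rfl⟩ := hd
    rw [← hφ.continuousAt_iff]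
    have : F ∘ φ = φ ∘ β := funext hF
    rw [this]
    exact (hφ.continuous.comp β.continuous).continuousAt
  · have hcl : IsClosed (φ '' C) := (hC.image hφ.continuous).isClosed
    have : F =ᶠ[𝓝 d] id := by
      filter_upwards [hcl.isOpen_compl.mem_nhds hd] with y hy
      by_cases hyr : y ∈ range φ
      · obtain ⟨x, rfl⟩ := hyr
        rw [hF, hβ x (fun h => hy ⟨x, h, rfl⟩)]
        rfl
      · exact hF' y hyr
    exact continuousAt_id.congr this.symm

lemma exists_transport {φ : X → D} (hφ : IsOpenEmbedding φ) (β : X ≃ₜ X) {C : Set X}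
    (hC : IsCompact C) (hβ : ∀ x ∉ C, β x = x) :
    ∃ F : D ≃ₜ D, (∀ x, F (φ x) = φ (β x)) ∧ ∀ d ∉ range φ, F d = d := by
  classical
  have hβ' : ∀ x ∉ C, β.symm x = x := by
    intro x hx
    rw [Homeomorph.symm_apply_eq]
    exact (hβ x hx).symm
  let mk : (X ≃ₜ X) → D → D := fun γ d => if h : d ∈ range φ then φ (γ h.choose) else d
  have hmk : ∀ γ x, mk γ (φ x) = φ (γ x) := by
    intro γ x
    have h : φ x ∈ range φ := ⟨x, rfl⟩
    simp only [mk, h, dif_pos]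
    rw [hφ.injective h.choose_spec]
  have hmk' : ∀ γ, ∀ d ∉ range φ, mk γ d = d := by
    intro γ d hd
    simp only [mk, hd, dif_neg, not_false_eq_true]
  have hinv : ∀ γ d, mk γ.symm (mk γ d) = d := by
    intro γ d
    by_cases hd : d ∈ range φ
    · obtain ⟨x, rfl⟩ := hd
      rw [hmk, hmk]; simp
    · rw [hmk' γ d hd, hmk' _ d hd]
  refine ⟨{ toFun := mk β, invFun := mk β.symm, left_inv := hinv β,
            right_inv := fun d => by simpa using hinv β.symm d
            continuous_toFun := transport_aux hφ β hC hβ _ (hmk β) (hmk' β)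
            continuous_invFun := transport_aux hφ β.symm hC hβ' _ (hmk β.symm) (hmk' β.symm) },
    hmk β, hmk' β⟩
end

open Set Topology Filter

section
variable {T D : Type*} [TopologicalSpace T] [CompactSpace T] [TopologicalSpace D] [T2Space D]

lemma ring_transport {φ : T × ℝ → D} (hφ : IsOpenEmbedding φ) {u v x y : ℝ} (hux : u < x)
    (hxv : x < v) (huy : u < y) (hyv : y < v) :
    ∃ (α : ℝ ≃ₜ ℝ) (F : D ≃ₜ D), StrictMono α ∧ α x = y ∧ (∀ z ≤ u, α z = z) ∧
      (∀ z ≥ v, α z = z) ∧ (∀ p, F (φ p) = φ (p.1, α p.2)) ∧ ∀ d ∉ range φ, F d = d := by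
  obtain ⟨α, h1, h2, h3, h4⟩ := exists_tmove u v x y hux hxv huy hyv
  obtain ⟨F, hF, hF'⟩ := exists_transport hφ ((Homeomorph.refl T).prodCongr α)
    (C := univ ×ˢ Icc u v) (isCompact_univ.prod isCompact_Icc) (by
      rintro ⟨θ, z⟩ hz
      have : α z = z := by
        by_contra hne
        apply hz
        refine ⟨mem_univ _, ?_, ?_⟩
        · by_contra h; exact hne (h3 z (not_le.1 h).le)
        · by_contra h; exact hne (h4 z (not_le.1 h).le)
      simp [this])
  exact ⟨α, F, h1, h2, h3, h4, hF, hF'⟩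

lemma ring_bound {φ : T × ℝ → D} (hφ : IsOpenEmbedding φ) {Y : Set D} (hY : IsCompact Y)
    (hYr : Y ⊆ range φ) (s : ℝ) : ∃ t > s, Y ⊆ φ '' {p | p.2 < t} := by
  have h1 : IsCompact (φ ⁻¹' Y) := hφ.isInducing.isCompact_preimage_iff hYr |>.2 hY
  obtain ⟨t, ht⟩ := (h1.image continuous_snd).bddAbove
  refine ⟨max s t + 1, by linarith [le_max_left s t], ?_⟩
  intro y hy
  obtain ⟨p, rfl⟩ := hYr hy
  have : p.2 ≤ t := ht ⟨p, hy, rfl⟩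
  exact ⟨p, by change p.2 < _; linarith [le_max_right s t], rfl⟩

def RingCof (φ₀ φ : T × ℝ → D) : Prop :=
  (∀ s, ∃ sg, φ '' {p | p.2 < sg} ⊆ φ₀ '' {p | p.2 < s}) ∧
  (∀ s, ∃ sg, φ₀ '' {p | p.2 < sg} ⊆ φ '' {p | p.2 < s})

def RingExt (φ₀ : T × ℝ → D) : Prop :=
  ∀ Y : Set D, IsCompact Y → ∃ φ : T × ℝ → D, IsOpenEmbedding φ ∧ Y ⊆ range φ ∧
    φ₀ '' {p | p.2 ≤ 0} ⊆ range φ ∧ RingCof φ₀ φ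

lemma ring_step {φ₀ : T × ℝ → D} (h₀ : IsOpenEmbedding φ₀) (hext : RingExt φ₀) {r r' : ℝ}
    (hr : r < r') {Y : Set D} (hY : IsCompact Y) :
    ∃ F : D ≃ₜ D, (∀ p : T × ℝ, p.2 ≤ r → F (φ₀ p) = φ₀ p) ∧
      ∀ y ∈ Y, F.symm y ∈ φ₀ '' {p | p.2 < r'} := by
  have hcomp : ∀ a b, IsCompact (φ₀ '' (univ ×ˢ Icc a b)) := fun a b =>
    (isCompact_univ.prod isCompact_Icc).image h₀.continuous
  obtain ⟨φ, hφ, hYφ, h0φ, hc1, hc2⟩ := hext (Y ∪ φ₀ '' (univ ×ˢ Icc 0 r')) (hY.union (hcomp _ _))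
  have hlow : ∀ p : T × ℝ, p.2 ≤ r' → φ₀ p ∈ range φ := by
    intro p hp
    rcases le_total p.2 0 with h | h
    · exact h0φ ⟨p, h, rfl⟩
    · exact hYφ (Or.inr ⟨p, ⟨mem_univ _, h, hp⟩, rfl⟩)
  obtain ⟨s, hs⟩ := hc1 r'
  obtain ⟨sg', hσ'⟩ := hc2 (s - 1)
  set sg := min (sg' - 1) (r - 1) with hσ
  have hσr : sg < r := by linarith [min_le_right (sg' - 1) (r - 1)]
  have hσσ : sg < sg' := by linarith [min_le_left (sg' - 1) (r - 1)]
  obtain ⟨t, hts, ht⟩ := ring_bound hφ (hY.union (hcomp sg r')) (by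
    rintro y (hy | ⟨p, hp, rfl⟩)
    · exact hYφ (Or.inl hy)
    · exact hlow p hp.2.2) s
  have ht' : ∀ p : T × ℝ, p.2 ≤ r' → φ₀ p ∈ φ '' {p | p.2 < t} := by
    intro p hp
    rcases le_total p.2 sg with h | h
    · obtain ⟨q, hq, hqe⟩ := hσ' ⟨p, lt_of_le_of_lt h hσσ, rfl⟩
      refine ⟨q, ?_, hqe⟩
      change q.2 < t
      have : q.2 < s - 1 := hq
      linarith
    · exact ht (Or.inr ⟨p, ⟨mem_univ _, h, hp⟩, rfl⟩)
  obtain ⟨α, S, hα, hαr, hα1, hα2, hS, hS'⟩ := ring_transport h₀ (u := sg - 1) (v := r') (x := r)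
    (y := sg) (by linarith) hr (by linarith) (by linarith)
  obtain ⟨β, F, hβ, hβs, hβ1, hβ2, hF, hF'⟩ := ring_transport hφ (u := s - 1) (v := t + 1) (x := s)
    (y := t) (by linarith) (by linarith) (by linarith) (by linarith)
  refine ⟨(S.trans F).trans S.symm, ?_, ?_⟩
  · intro p hp
    have h1 : α p.2 ≤ sg := by rw [← hαr]; exact hα.monotone hp
    obtain ⟨q, hq, hqe⟩ := hσ' ⟨(p.1, α p.2), lt_of_le_of_lt h1 hσσ, rfl⟩
    have hq' : q.2 < s - 1 := hq
    simp only [Homeomorph.trans_apply]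
    rw [Homeomorph.symm_apply_eq, hS, ← hqe, hF, hβ1 _ hq'.le]
  · intro y hy
    simp only [Homeomorph.symm_trans_apply, Homeomorph.symm_symm]
    have hα3 : ∀ z, z < r' → α z < r' := by
      intro z hz
      rw [← hα2 r' le_rfl]; exact hα hz
    have hα4 : ∀ z, z < r' → α.symm z < r' := by
      intro z hz
      rw [← hα.lt_iff_lt, α.apply_symm_apply, hα2 r' le_rfl]
      exact hz
    have hSi : ∀ d ∈ φ₀ '' {p | p.2 < r'}, S.symm d ∈ φ₀ '' {p | p.2 < r'} := by
      rintro _ ⟨p, hp, rfl⟩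
      refine ⟨(p.1, α.symm p.2), hα4 _ hp, ?_⟩
      rw [eq_comm, Homeomorph.symm_apply_eq, hS]
      simp
    have hSy : S y ∈ φ '' {p | p.2 < t} := by
      by_cases hyr : y ∈ φ₀ '' {p | p.2 < r'}
      · obtain ⟨p, hp, rfl⟩ := hyr
        rw [hS]
        exact ht' _ (hα3 _ hp).le
      · have : S y = y := by
          by_cases hyr2 : y ∈ range φ₀
          · obtain ⟨p, rfl⟩ := hyr2
            rw [hS, hα2]
            by_contra hlt
            exact hyr ⟨p, not_le.1 hlt, rfl⟩
          · exact hS' y hyr2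
        rw [this]
        exact ht (Or.inl hy)
    apply hSi
    obtain ⟨q, hq, hqe⟩ := hSy
    rw [← hqe]
    apply hs
    refine ⟨(q.1, β.symm q.2), ?_, ?_⟩
    · change β.symm q.2 < s
      rw [← hβ.lt_iff_lt, β.apply_symm_apply, hβs]
      exact hq
    · rw [eq_comm, Homeomorph.symm_apply_eq, hF]
      simp

theorem ring_brown {φ₀ : T × ℝ → D} (h₀ : IsOpenEmbedding φ₀) (hext : RingExt φ₀)
    (Y : ℕ → Set D) (hY : ∀ n, IsCompact (Y n))
    (hcov : ∀ d, d ∈ φ₀ '' {p | p.2 ≤ 0} ∨ ∃ n, d ∈ Y n) :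
    ∃ H : T × ℝ ≃ₜ D, ∀ p, p.2 ≤ 0 → H p = φ₀ p := by
  choose F hF1 hF2 using fun (n : ℕ) (Y : {Y : Set D // IsCompact Y}) =>
    ring_step h₀ hext (r := n) (r' := n + 1) (by linarith) Y.2
  let nx : ℕ → (D ≃ₜ D) → (D ≃ₜ D) := fun n G =>
    (F n ⟨G.symm '' Y n, (hY n).image G.symm.continuous⟩).trans G
  let G : ℕ → (D ≃ₜ D) := fun n => Nat.rec (Homeomorph.refl D) nx n
  have hG0 : G 0 = Homeomorph.refl D := rfl
  have hGs : ∀ n, G (n + 1) = nx n (G n) := fun n => rfl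
  have hfix : ∀ n : ℕ, ∀ p : T × ℝ, p.2 ≤ n → G (n + 1) (φ₀ p) = G n (φ₀ p) := by
    intro n p hp
    rw [hGs]
    simp only [nx, Homeomorph.trans_apply]
    rw [hF1 n _ p hp]
  have hfix2 : ∀ n m : ℕ, n ≤ m → ∀ p : T × ℝ, p.2 ≤ n → G m (φ₀ p) = G n (φ₀ p) := by
    intro n m hnm p hp
    induction m, hnm using Nat.le_induction with
    | base => rfl
    | succ m hm ih =>
      rw [hfix m p (hp.trans (by exact_mod_cast hm)), ih]
  have hYG : ∀ n : ℕ, ∀ y ∈ Y n, ∃ p : T × ℝ, p.2 < n + 1 ∧ G (n + 1) (φ₀ p) = y := by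
    intro n y hy
    obtain ⟨p, hp, hpe⟩ := hF2 n ⟨(G n).symm '' Y n, (hY n).image (G n).symm.continuous⟩
      ((G n).symm y) ⟨y, hy, rfl⟩
    refine ⟨p, hp, ?_⟩
    rw [hGs]
    simp only [nx, Homeomorph.trans_apply]
    rw [hpe]
    simp
  let H : T × ℝ → D := fun p => G ⌈p.2⌉₊ (φ₀ p)
  have hH : ∀ n : ℕ, ∀ p : T × ℝ, p.2 ≤ n → H p = G n (φ₀ p) := by
    intro n p hp
    exact (hfix2 _ _ (Nat.ceil_le.2 hp) p (Nat.le_ceil _)).symm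
  have hev : ∀ p : T × ℝ, ∃ n : ℕ, p.2 ≤ n ∧ H =ᶠ[𝓝 p] fun q => G n (φ₀ q) := by
    intro p
    obtain ⟨n, hn⟩ := exists_nat_gt p.2
    refine ⟨n, hn.le, ?_⟩
    filter_upwards [(isOpen_lt continuous_snd continuous_const).mem_nhds hn] with q hq
    exact hH n q (le_of_lt hq)
  have hemb : ∀ n, IsOpenEmbedding fun q => G n (φ₀ q) := fun n =>
    (G n).isOpenEmbedding.comp h₀
  have hHc : Continuous H := by
    rw [continuous_iff_continuousAt]
    intro p
    obtain ⟨n, -, hn⟩ := hev p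
    exact (hemb n).continuous.continuousAt.congr hn.symm
  have hHo : IsOpenMap H := by
    rw [isOpenMap_iff_nhds_le]
    intro p
    obtain ⟨n, hpn, hn⟩ := hev p
    rw [map_congr hn, (hemb n).map_nhds_eq, hH n p hpn]
  have hHi : Function.Injective H := by
    intro p q hpq
    obtain ⟨n, hn⟩ := exists_nat_ge (max p.2 q.2)
    rw [hH n p ((le_max_left _ _).trans hn), hH n q ((le_max_right _ _).trans hn)] at hpq
    exact (hemb n).injective hpq
  have h0 : ∀ p : T × ℝ, p.2 ≤ 0 → H p = φ₀ p := by
    intro p hp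
    rw [hH 0 p (by simpa using hp), hG0]
    rfl
  have hHs : Function.Surjective H := by
    intro d
    rcases hcov d with ⟨p, hp, rfl⟩ | ⟨n, hn⟩
    · exact ⟨p, h0 p hp⟩
    · obtain ⟨p, hp, hpe⟩ := hYG n d hn
      exact ⟨p, by rw [hH (n + 1) p (by push_cast; exact hp.le), hpe]⟩
  exact ⟨(Equiv.ofBijective H ⟨hHi, hHs⟩).toHomeomorphOfContinuousOpen hHc hHo, h0⟩
end

open Set Topology Filter

lemma bd_lift (f : ℂ → ℂ) (hf : Continuous f) (h0 : ∀ z, f z ≠ 0) :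
    ∃ L : ℂ → ℂ, Continuous L ∧ ∀ z, Complex.exp (L z) = f z := by
  obtain ⟨F, ⟨-, hF⟩, -⟩ := Complex.isCoveringMap_exp.existsUnique_continuousMap_lifts
    ⟨fun z => (⟨f z, h0 z⟩ : {z : ℂ // z ≠ 0}), hf.subtype_mk _⟩ 0 (Complex.log (f 0)) (by
      apply Subtype.ext
      exact Complex.exp_log (h0 0))
  refine ⟨F, F.continuous, fun z => ?_⟩
  exact congrArg Subtype.val (congrFun hF z)

lemma bd_noLog (ℓ : ℝ → ℂ) (hℓ : Continuous ℓ) (hper : ℓ (2 * Real.pi) = ℓ 0) {ρ : ℝ} (hρ : 0 < ρ)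
    (h : ∀ t, Complex.exp (ℓ t) = ρ * Complex.exp (t * Complex.I)) : False := by
  have hz : ∀ t : ℝ, ∃ n : ℤ, ℓ t - t * Complex.I - Real.log ρ = n * (2 * Real.pi * Complex.I) := by
    intro t
    rw [← Complex.exp_eq_one_iff, Complex.exp_sub, Complex.exp_sub, h, ← Complex.ofReal_exp,
      Real.exp_log hρ]
    have : (ρ : ℂ) ≠ 0 := by exact_mod_cast hρ.ne'
    have := Complex.exp_ne_zero (t * Complex.I)
    field_simp
  choose n hn using hz
  have hc : Continuous fun t : ℝ => ((n t : ℤ) : ℝ) := by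
    have : (fun t : ℝ => ((n t : ℤ) : ℝ)) = fun t => (ℓ t - t * Complex.I - Real.log ρ).im / (2 * Real.pi) := by
      funext t
      rw [hn]
      have := Real.pi_ne_zero
      simp
    rw [this]
    fun_prop
  have hc' : Continuous n := by
    exact (Int.isClosedEmbedding_coe_real.isInducing.continuous_iff).2 hc
  have := (PreconnectedSpace.constant (inferInstance : PreconnectedSpace ℝ) hc' : n (2 * Real.pi) = n 0)
  have h1 := hn (2 * Real.pi)
  have h2 := hn 0
  rw [this, ← h2, hper] at h1
  have h3 := congrArg Complex.im h1
  simp at h3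

lemma bd_logc : ContinuousOn Complex.log {z | 0 ≤ z.im ∧ z ≠ 0} := by
  rintro z ⟨h1, h2⟩
  by_cases h : z ∈ Complex.slitPlane
  · exact (continuousAt_clog h).continuousWithinAt
  · rw [Complex.mem_slitPlane_iff] at h
    push Not at h
    refine (Complex.continuousWithinAt_log_of_re_neg_of_im_zero (lt_of_le_of_ne h.1 ?_) h.2).mono
      fun w hw => hw.1
    intro h3
    exact h2 (Complex.ext h3 h.2)

lemma half_bdry {N : Type*} [TopologicalSpace N] {x0 : N} {W : N → ℂ} {J : ℂ → N} {V0 : Set N}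
    (hV0 : V0 ∈ 𝓝 x0) (hW : ContinuousOn W V0) (hW0 : W x0 = 0) (hJ : Continuous J)
    (hJ0 : J 0 = x0) (hJW : ∀ p ∈ V0, J (W p) = p) (him : ∀ p ∈ V0, 0 ≤ (W p).im)
    (hJne : ∃ δ > 0, ∀ w : ℂ, 0 ≤ w.im → w ≠ 0 → ‖w‖ < δ → J w ≠ x0) :
    x0 ∈ spaceBoundary 2 N := by
  rintro ⟨V, hV, hx, U, hU, ⟨φ⟩⟩
  let κ : EuclideanSpace ℝ (Fin 2) ≃ₜ ℂ := Complex.orthonormalBasisOneI.repr.symm.toHomeomorph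
  have : Nonempty V := ⟨⟨x0, hx⟩⟩
  have hj : IsOpenEmbedding fun v : V => κ (φ v) :=
    κ.isOpenEmbedding.comp (hU.isOpenEmbedding_subtypeVal.comp φ.isOpenEmbedding)
  let e : OpenPartialHomeomorph N ℂ :=
    (hV.isOpenEmbedding_subtypeVal.toOpenPartialHomeomorph _).symm.trans
      (hj.toOpenPartialHomeomorph _)
  have hxe : x0 ∈ e.source := by simp [e, hx]
  clear_value e
  obtain ⟨δ, hδ, hJne⟩ := hJne
  obtain ⟨δ2, hδ2, hs⟩ := Metric.mem_nhds_iff.1 (hJ.continuousAt.preimage_mem_nhds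
    (by rw [hJ0]; exact e.open_source.mem_nhds hxe) : J ⁻¹' e.source ∈ 𝓝 0)
  set δ1 := min δ δ2 with hδ1
  have hδ1p : 0 < δ1 := lt_min hδ hδ2
  let r : ℂ → ℂ := fun z => ((min z.re (Real.log δ1 - 1) : ℝ) : ℂ) +
    ((max 0 (min z.im Real.pi) : ℝ) : ℂ) * Complex.I
  have hr : Continuous r := by fun_prop
  have hrre : ∀ z, (r z).re = min z.re (Real.log δ1 - 1) := by intro z; simp [r]
  have hrim : ∀ z, (r z).im = max 0 (min z.im Real.pi) := by intro z; simp [r]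
  have hE : ∀ z, 0 ≤ (Complex.exp (r z)).im ∧ ‖Complex.exp (r z)‖ < δ1 := by
    intro z
    rw [Complex.exp_im, Complex.norm_exp, hrre, hrim]
    constructor
    · apply mul_nonneg (Real.exp_pos _).le
      exact Real.sin_nonneg_of_nonneg_of_le_pi (le_max_left _ _)
        (max_le Real.pi_pos.le (min_le_right _ _))
    · rw [← Real.lt_log_iff_exp_lt hδ1p]
      linarith [min_le_right z.re (Real.log δ1 - 1)]
  have hJs : ∀ z, J (Complex.exp (r z)) ∈ e.source := fun z => hs (by
    rw [mem_ball_zero_iff]; exact (hE z).2.trans_le (min_le_right _ _))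
  obtain ⟨L, hL, hLe⟩ := bd_lift (fun z => e (J (Complex.exp (r z))) - e x0) (by
      refine Continuous.sub ?_ continuous_const
      exact e.continuousOn.comp_continuous (hJ.comp (Complex.continuous_exp.comp hr)) hJs) (by
      intro z hz
      exact hJne _ (hE z).1 (Complex.exp_ne_zero _) ((hE z).2.trans_le (min_le_left _ _))
        (e.injOn (hJs z) hxe (sub_eq_zero.1 hz)))
  have hWx : ContinuousAt W x0 := hW.continuousAt hV0
  have hev : ∀ᶠ u in 𝓝 (e x0), u ∈ e.target ∧ e.symm u ∈ interior V0 ∧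
      ‖W (e.symm u)‖ < δ1 * Real.exp (-1) := by
    have hc : Tendsto e.symm (𝓝 (e x0)) (𝓝 x0) := by
      have := e.continuousAt_symm (e.map_source hxe)
      rwa [ContinuousAt, e.left_inv hxe] at this
    refine (e.open_target.eventually_mem (e.map_source hxe)).and ((hc.eventually
      (interior_mem_nhds.2 hV0)).and ?_)
    have := hWx.norm
    rw [ContinuousAt, hW0, norm_zero] at this
    exact hc.eventually (this.eventually (gt_mem_nhds (by positivity)))
  obtain ⟨ρ', hρ', hb⟩ := Metric.eventually_nhds_iff.1 hev
  set ρ := ρ' / 2 with hρd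
  have hρ : 0 < ρ := by positivity
  let u : ℝ → ℂ := fun t => e x0 + ρ * Complex.exp (t * Complex.I)
  have hu : Continuous u := by fun_prop
  have hub : ∀ t, u t ∈ e.target ∧ e.symm (u t) ∈ interior V0 ∧
      ‖W (e.symm (u t))‖ < δ1 * Real.exp (-1) := by
    intro t
    apply hb
    simp only [u, dist_self_add_left, norm_mul, Complex.norm_exp_ofReal_mul_I]
    rw [Complex.norm_real, Real.norm_of_nonneg hρ.le]
    linarith
  let w : ℝ → ℂ := fun t => W (e.symm (u t))
  have hw : Continuous w := by
    refine hW.comp_continuous ?_ fun t => interior_subset (hub t).2.1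
    exact e.continuousOn_symm.comp_continuous hu fun t => (hub t).1
  have hJw : ∀ t, J (w t) = e.symm (u t) := fun t => hJW _ (interior_subset (hub t).2.1)
  have hw0 : ∀ t, w t ≠ 0 := by
    intro t h
    have h1 := hJw t
    rw [h, hJ0] at h1
    have h2 := congrArg e h1
    rw [e.right_inv (hub t).1] at h2
    simp [u, hρ.ne'] at h2
  refine bd_noLog (fun t => L (Complex.log (w t))) (hL.comp (bd_logc.comp_continuous hw
    fun t => ⟨him _ (interior_subset (hub t).2.1), hw0 t⟩)) ?_ hρ ?_
  · have : u (2 * Real.pi) = u 0 := by simp [u]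
    simp [w, this]
  · intro t
    have hrl : r (Complex.log (w t)) = Complex.log (w t) := by
      apply Complex.ext
      · rw [hrre, min_eq_left]
        rw [Complex.log_re]
        have := Real.log_le_log (norm_pos_iff.2 (hw0 t)) (hub t).2.2.le
        rwa [Real.log_mul hδ1p.ne' (Real.exp_pos _).ne', Real.log_exp, ← sub_eq_add_neg] at this
      · rw [hrim, Complex.log_im, min_eq_left (Complex.arg_le_pi _), max_eq_right]
        exact Complex.arg_nonneg_iff.2 (him _ (interior_subset (hub t).2.1))
    rw [hLe, hrl, Complex.exp_log (hw0 t), hJw, e.right_inv (hub t).1]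
    simp [u]

open Set Topology Filter

abbrev P2 := EuclideanSpace ℝ (Fin 2)
abbrev S1 := ↥(Metric.sphere (0 : EuclideanSpace ℝ (Fin 2)) 1)

lemma bd_homeo {A B : Type*} [TopologicalSpace A] [TopologicalSpace B] (e : A ≃ₜ B) (n : ℕ) {x : A}
    (hx : e x ∈ spaceBoundary n B) : x ∈ spaceBoundary n A := by
  rintro ⟨V, hV, hxV, U, hU, ⟨φ⟩⟩
  exact hx ⟨e '' V, e.isOpenMap V hV, ⟨x, hxV, rfl⟩, U, hU, ⟨(e.image V).symm.trans φ⟩⟩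

lemma bd_homeo_iff {A B : Type*} [TopologicalSpace A] [TopologicalSpace B] (e : A ≃ₜ B) (n : ℕ) {x : A} :
    e x ∈ spaceBoundary n B ↔ x ∈ spaceBoundary n A :=
  ⟨bd_homeo e n, fun h => bd_homeo e.symm n (by simpa using h)⟩

noncomputable def s1c : S1 ≃ₜ Circle where
  toFun θ := ⟨Complex.orthonormalBasisOneI.repr.symm θ, by
    change _ ∈ Metric.sphere (0 : ℂ) 1
    rw [mem_sphere_zero_iff_norm, LinearIsometryEquiv.norm_map]; exact mem_sphere_zero_iff_norm.1 θ.2⟩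
  invFun c := ⟨Complex.orthonormalBasisOneI.repr c, by
    rw [mem_sphere_zero_iff_norm, LinearIsometryEquiv.norm_map]; exact c.norm_coe⟩
  left_inv θ := Subtype.ext (LinearIsometryEquiv.apply_symm_apply _ _)
  right_inv c := Subtype.ext (LinearIsometryEquiv.symm_apply_apply _ _)
  continuous_toFun := by
    apply Continuous.subtype_mk
    exact Complex.orthonormalBasisOneI.repr.symm.continuous.comp continuous_subtype_val
  continuous_invFun := by
    apply Continuous.subtype_mk
    exact Complex.orthonormalBasisOneI.repr.continuous.comp continuous_subtype_val

lemma bd_zero {k : ℕ} (i0 : Fin k) (θ0 : S1) :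
    (((i0, θ0), ⟨0, by norm_num⟩) : (Fin k × S1) × ↥(Icc (0 : ℝ) 1)) ∈
      spaceBoundary 2 ((Fin k × S1) × ↥(Icc (0 : ℝ) 1)) := by
  let W : (Fin k × S1) × ↥(Icc (0 : ℝ) 1) → ℂ := fun p =>
    ((Complex.arg ((s1c p.1.2 / s1c θ0 : Circle) : ℂ) : ℝ) : ℂ) + ((p.2 : ℝ) : ℂ) * Complex.I
  let J : ℂ → (Fin k × S1) × ↥(Icc (0 : ℝ) 1) := fun w =>
    ((i0, s1c.symm (Circle.exp w.re * s1c θ0)), projIcc 0 1 zero_le_one w.im)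
  have hq : Continuous fun p : (Fin k × S1) × ↥(Icc (0 : ℝ) 1) => ((s1c p.1.2 / s1c θ0 : Circle) : ℂ) := by
    fun_prop
  refine half_bdry (W := W) (J := J) (V0 := {p | p.1.1 = i0 ∧
    ((s1c p.1.2 / s1c θ0 : Circle) : ℂ) ∈ Complex.slitPlane}) ?_ ?_ ?_ ?_ ?_ ?_ ?_ ?_
  · apply IsOpen.mem_nhds
    · apply IsOpen.inter
      · exact (isOpen_discrete {i0}).preimage (continuous_fst.comp continuous_fst)
      · exact Complex.isOpen_slitPlane.preimage hq
    · refine ⟨rfl, ?_⟩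
      simp
  · intro p hp
    apply ContinuousAt.continuousWithinAt
    apply ContinuousAt.add
    · exact Complex.continuous_ofReal.continuousAt.comp
        (ContinuousAt.comp (f := fun p : (Fin k × S1) × ↥(Icc (0 : ℝ) 1) =>
          ((s1c p.1.2 / s1c θ0 : Circle) : ℂ)) (Complex.continuousAt_arg hp.2) hq.continuousAt)
    · fun_prop
  · simp [W]
  · have : Continuous fun w : ℂ => projIcc (0 : ℝ) 1 zero_le_one w.im :=
      continuous_projIcc.comp Complex.continuous_im
    fun_prop
  · simp only [J, Complex.zero_re, Circle.exp_zero, one_mul, Homeomorph.symm_apply_apply,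
      Complex.zero_im]
    rw [projIcc_left]
  · rintro ⟨⟨i, θ⟩, r⟩ ⟨rfl, h2⟩
    simp only [J, W]
    have hre : (((Complex.arg ((s1c θ / s1c θ0 : Circle) : ℂ) : ℝ) : ℂ) + ((r : ℝ) : ℂ) * Complex.I).re
      = Complex.arg ((s1c θ / s1c θ0 : Circle) : ℂ) := by simp
    have him : (((Complex.arg ((s1c θ / s1c θ0 : Circle) : ℂ) : ℝ) : ℂ) + ((r : ℝ) : ℂ) * Complex.I).im
      = r := by simp
    rw [hre, him, projIcc_val, Circle.exp_arg]
    simp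
  · rintro ⟨⟨i, θ⟩, r⟩ _
    simp only [W]
    simpa using r.2.1
  · refine ⟨1, one_pos, fun w h1 h2 h3 h4 => h2 ?_⟩
    have h5 : projIcc (0 : ℝ) 1 zero_le_one w.im = ⟨0, by norm_num⟩ := congrArg Prod.snd h4
    have h6 : Circle.exp w.re = 1 := by
      have : s1c.symm (Circle.exp w.re * s1c θ0) = θ0 := congrArg (fun p => p.1.2) h4
      rw [Homeomorph.symm_apply_eq] at this
      simpa using this
    apply Complex.ext
    · have h7 : |w.re| < 1 := (Complex.abs_re_le_norm w).trans_lt h3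
      have h8 := abs_lt.1 h7
      have h9 : Complex.exp (w.re * Complex.I) = 1 := by
        rw [← Circle.coe_exp, h6]; rfl
      have := Complex.arg_exp_mul_I w.re
      have h10 := Complex.arg_cos_add_sin_mul_I (θ := w.re) ⟨by linarith [Real.pi_gt_three], by linarith [Real.pi_gt_three]⟩
      rw [← Complex.exp_mul_I, h9, Complex.arg_one] at h10
      exact h10.symm
    · have h7 : w.im < 1 := (le_abs_self _).trans_lt ((Complex.abs_im_le_norm w).trans_lt h3)
      have : ((projIcc (0 : ℝ) 1 zero_le_one w.im : Icc (0:ℝ) 1) : ℝ) = 0 := by rw [h5]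
      rw [coe_projIcc, min_eq_right h7.le, max_eq_right h1] at this
      exact this

lemma bd_int {k : ℕ} (i0 : Fin k) (θ0 : S1) (r0 : ↥(Icc (0 : ℝ) 1)) (h0 : 0 < (r0 : ℝ)) (h1 : (r0 : ℝ) < 1) :
    (((i0, θ0), r0) : (Fin k × S1) × ↥(Icc (0 : ℝ) 1)) ∉
      spaceBoundary 2 ((Fin k × S1) × ↥(Icc (0 : ℝ) 1)) := by
  intro hbd
  apply hbd
  let U : Set P2 := {x | 1 < ‖x‖ ∧ ‖x‖ < 2}
  have hU : IsOpen U := (isOpen_lt continuous_const continuous_norm).inter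
    (isOpen_lt continuous_norm continuous_const)
  let V : Set ((Fin k × S1) × ↥(Icc (0 : ℝ) 1)) := {p | p.1.1 = i0 ∧ 0 < (p.2 : ℝ) ∧ (p.2 : ℝ) < 1}
  have hV : IsOpen V := by
    apply IsOpen.inter
    · exact (isOpen_discrete {i0}).preimage (continuous_fst.comp continuous_fst)
    · have hc : Continuous fun p : (Fin k × S1) × ↥(Icc (0 : ℝ) 1) => (p.2 : ℝ) := by fun_prop
      exact (isOpen_lt continuous_const hc).inter (isOpen_lt hc continuous_const)
  have hn : ∀ θ : S1, ‖(θ : P2)‖ = 1 := fun θ => mem_sphere_zero_iff_norm.1 θ.2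
  have hU0 : ∀ x : U, ‖(x : P2)‖ ≠ 0 := fun x => (zero_lt_one.trans x.2.1).ne'
  refine ⟨V, hV, ⟨rfl, h0, h1⟩, U, hU, ⟨⟨⟨fun p => ⟨(1 + (p.1.2 : ℝ)) • ((p.1.1.2 : S1) : P2), ?_⟩,
    fun x => ⟨((i0, ⟨‖(x : P2)‖⁻¹ • (x : P2), ?_⟩), ⟨‖(x : P2)‖ - 1, ?_⟩), ?_⟩, ?_, ?_⟩, ?_, ?_⟩⟩⟩
  · have h2 := p.2.2.1
    have h3 := p.2.2.2
    change 1 < ‖_‖ ∧ ‖_‖ < 2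
    rw [norm_smul, hn, Real.norm_of_nonneg (by linarith)]
    constructor <;> linarith
  · rw [mem_sphere_zero_iff_norm, norm_smul, norm_inv, norm_norm, inv_mul_cancel₀ (hU0 x)]
  · exact ⟨by linarith [x.2.1], by linarith [x.2.2]⟩
  · exact ⟨rfl, by change 0 < ‖(x : P2)‖ - 1; linarith [x.2.1], by change ‖(x : P2)‖ - 1 < 1; linarith [x.2.2]⟩
  · rintro ⟨⟨⟨i, θ⟩, r⟩, ⟨h2, h3, h4⟩⟩
    simp only at h2 h3 h4
    have hr : ‖(1 + (r : ℝ)) • (θ : P2)‖ = 1 + r := by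
      rw [norm_smul, hn, Real.norm_of_nonneg (by linarith), mul_one]
    have hr0 : (1 + (r : ℝ)) ≠ 0 := by linarith
    apply Subtype.ext
    refine Prod.ext (Prod.ext h2.symm (Subtype.ext ?_)) (Subtype.ext ?_)
    · simp only [hr, smul_smul, inv_mul_cancel₀ hr0, one_smul]
    · simp only [hr]; ring
  · intro x
    apply Subtype.ext
    simp [smul_smul, mul_inv_cancel₀ (hU0 x)]
  · apply Continuous.subtype_mk
    fun_prop
  · apply Continuous.subtype_mk
    refine ((continuous_const.prodMk (Continuous.subtype_mk ?_ _))).prodMk (Continuous.subtype_mk ?_ _)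
    · exact (Continuous.inv₀ (by fun_prop) hU0).smul continuous_subtype_val
    · fun_prop

lemma bd_ring {k : ℕ} (p : (Fin k × S1) × ↥(Icc (0 : ℝ) 1)) :
    p ∈ spaceBoundary 2 ((Fin k × S1) × ↥(Icc (0 : ℝ) 1)) ↔ (p.2 : ℝ) = 0 ∨ (p.2 : ℝ) = 1 := by
  constructor
  · intro h
    by_contra hcon
    push Not at hcon
    exact bd_int p.1.1 p.1.2 p.2 (lt_of_le_of_ne p.2.2.1 hcon.1.symm)
      (lt_of_le_of_ne p.2.2.2 hcon.2) h
  · rintro (h | h)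
    · have := bd_zero p.1.1 p.1.2
      convert this using 2
      exact Subtype.ext h
    · rw [← bd_homeo_iff ((Homeomorph.refl (Fin k × S1)).prodCongr unitInterval.symmHomeomorph)]
      have := bd_zero p.1.1 p.1.2
      convert this using 1
      refine Prod.ext rfl (Subtype.ext ?_)
      change 1 - (p.2 : ℝ) = 0
      rw [h, sub_self]

open Set Topology Filter

lemma bd_chart {M : Type*} [TopologicalSpace M] {k : ℕ} {ψ : (Fin k × S1) × ℝ → M}
    (hψ : IsOpenEmbedding ψ) {a b : ℝ} (hab : a < b) :
    ∃ e : ((Fin k × S1) × ↥(Icc (0 : ℝ) 1)) ≃ₜ ↥(ψ '' {p | p.2 ∈ Icc a b}),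
      ∀ p, (e p : M) = ψ (p.1, a + (b - a) * p.2) := by
  have hba : 0 < b - a := sub_pos.2 hab
  let g : ((Fin k × S1) × ↥(Icc (0 : ℝ) 1)) → M := fun p => ψ (p.1, a + (b - a) * p.2)
  have hg : IsEmbedding g := by
    refine hψ.isEmbedding.comp (f := fun p : (Fin k × S1) × ↥(Icc (0 : ℝ) 1) => (p.1, a + (b - a) * (p.2 : ℝ))) ?_
    refine IsEmbedding.prodMap IsEmbedding.id (g := fun r : ↥(Icc (0 : ℝ) 1) => a + (b - a) * (r : ℝ)) ?_
    exact ((Homeomorph.addLeft a).isEmbedding.comp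
      (Homeomorph.mulLeft₀ (b - a) hba.ne').isEmbedding).comp IsEmbedding.subtypeVal
  have hr : range g = ψ '' {p | p.2 ∈ Icc a b} := by
    ext x
    constructor
    · rintro ⟨p, rfl⟩
      refine ⟨_, ⟨?_, ?_⟩, rfl⟩
      · simp only; nlinarith [p.2.2.1]
      · simp only; nlinarith [p.2.2.2]
    · rintro ⟨p, ⟨h1, h2⟩, rfl⟩
      refine ⟨(p.1, ⟨(p.2 - a) / (b - a), by apply div_nonneg <;> linarith, ?_⟩), ?_⟩
      · rw [div_le_one hba]; linarith
      · simp only [g]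
        congr 1
        refine Prod.ext rfl ?_
        simp only
        field_simp
        ring
  refine ⟨hg.toHomeomorph.trans (Homeomorph.setCongr hr), fun p => rfl⟩

lemma spine_lemma {M : Type*} [TopologicalSpace M] [T2Space M] {k : ℕ} {ψ : (Fin k × S1) × ℝ → M}
    (hψ : IsOpenEmbedding ψ) {a b : ℝ} (hab : a < b) {C Kl : Set M}
    (hC : C = ψ '' {p | p.2 ∈ Icc a b}) (hK : Kl ⊆ interior C)
    {H1 H2 : (Fin k × S1) × ↥(Ici (0 : ℝ)) → M} (hH1 : IsEmbedding H1) (hH2 : IsEmbedding H2)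
    {D1 D2 : Set M} (hD1 : IsOpen D1) (hD2 : IsOpen D2) (hr1 : range H1 = (C \ Kl) ∩ D1)
    (hr2 : range H2 = (C \ Kl) ∩ D2) (hdis : Disjoint D1 D2) (hcov : C \ Kl ⊆ D1 ∪ D2) :
    IsCompact C ∧ Nonempty (↥C ≃ₜ (Fin k × S1) × ↥(Icc (0 : ℝ) 1)) ∧ IsSpine 2 C Kl := by
  obtain ⟨e, he⟩ : ∃ e : ((Fin k × S1) × ↥(Icc (0 : ℝ) 1)) ≃ₜ ↥C,
      ∀ p, (e p : M) = ψ (p.1, a + (b - a) * p.2) := by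
    rw [hC]
    exact bd_chart hψ hab
  refine ⟨?_, ⟨e.symm⟩, hK, ?_⟩
  · rw [isCompact_iff_compactSpace]
    exact e.compactSpace
  have hpsi : ∀ t : ℝ, IsEmbedding fun x : Fin k × S1 => ψ (x, t) := fun t =>
    hψ.isEmbedding.comp (IsEmbedding.of_comp (by fun_prop) continuous_fst IsEmbedding.id)
  have hb : range (Sum.elim (fun x : Fin k × S1 => ψ (x, a)) (fun x => ψ (x, b))) = subsetBoundary 2 C := by
    ext x
    constructor
    · rintro ⟨x | x, rfl⟩
      · refine ⟨e (x, ⟨0, by norm_num⟩), ?_, ?_⟩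
        · rw [bd_homeo_iff, bd_ring]; left; rfl
        · rw [he]; simp
      · refine ⟨e (x, ⟨1, by norm_num⟩), ?_, ?_⟩
        · rw [bd_homeo_iff, bd_ring]; right; rfl
        · rw [he]; simp
    · rintro ⟨y, hy, rfl⟩
      obtain ⟨p, rfl⟩ := e.surjective y
      rw [bd_homeo_iff, bd_ring] at hy
      rcases hy with h | h
      · exact ⟨Sum.inl p.1, by rw [he, h]; simp⟩
      · exact ⟨Sum.inr p.1, by rw [he, h]; simp⟩
  have hbe : IsClosedEmbedding (Sum.elim (fun x : Fin k × S1 => ψ (x, a)) (fun x => ψ (x, b))) := by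
    apply Continuous.isClosedEmbedding
    · exact (hpsi a).continuous.sumElim (hpsi b).continuous
    · apply Function.Injective.sumElim (hpsi a).injective (hpsi b).injective
      intro x y hxy
      have := congrArg Prod.snd (hψ.injective hxy)
      exact hab.ne this
  have key : ∀ (H : (Fin k × S1) × ↥(Ici (0 : ℝ)) → M) (D : Set M) (_ : IsEmbedding H) (_ : IsOpen D)
      (_ : range H = (C \ Kl) ∩ D), ∃ h : (Fin k × S1) × ↥(Ici (0 : ℝ)) → ↥(C \ Kl),
      IsOpenEmbedding h ∧ range h = Subtype.val ⁻¹' D := by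
    intro H D hH hD hr
    have hm : ∀ p, H p ∈ C \ Kl := fun p => (hr ▸ mem_range_self p : H p ∈ (C \ Kl) ∩ D).1
    have hr' : range (fun p => (⟨H p, hm p⟩ : ↥(C \ Kl))) = Subtype.val ⁻¹' D := by
      ext y
      constructor
      · rintro ⟨p, rfl⟩
        exact (hr ▸ mem_range_self p : H p ∈ (C \ Kl) ∩ D).2
      · intro hy
        have : (y : M) ∈ range H := by rw [hr]; exact ⟨y.2, hy⟩
        obtain ⟨p, hp⟩ := this
        exact ⟨p, Subtype.ext hp⟩
    refine ⟨fun p => ⟨H p, hm p⟩, ⟨hH.codRestrict _ hm, ?_⟩, hr'⟩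
    rw [hr']
    exact hD.preimage continuous_subtype_val
  obtain ⟨h1, ho1, hr1'⟩ := key H1 D1 hH1 hD1 hr1
  obtain ⟨h2, ho2, hr2'⟩ := key H2 D2 hH2 hD2 hr2
  have hinj : Function.Injective (Sum.elim h1 h2) := by
    apply Function.Injective.sumElim ho1.injective ho2.injective
    intro x y hxy
    have hx : (h1 x : M) ∈ D1 := by
      have := mem_range_self (f := h1) x
      rw [hr1'] at this; exact this
    have hy : (h2 y : M) ∈ D2 := by
      have := mem_range_self (f := h2) y
      rw [hr2'] at this; exact this
    rw [← hxy] at hy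
    exact disjoint_left.1 hdis hx hy
  have hsurj : Function.Surjective (Sum.elim h1 h2) := by
    intro y
    rcases hcov y.2 with h | h
    · have : y ∈ range h1 := by rw [hr1']; exact h
      obtain ⟨p, hp⟩ := this
      exact ⟨Sum.inl p, hp⟩
    · have : y ∈ range h2 := by rw [hr2']; exact h
      obtain ⟨p, hp⟩ := this
      exact ⟨Sum.inr p, hp⟩
  have hS : _ ≃ₜ ↥(C \ Kl) := (Equiv.ofBijective _ ⟨hinj, hsurj⟩).toHomeomorphOfContinuousOpen
    (ho1.continuous.sumElim ho2.continuous) (ho1.isOpenMap.sumElim ho2.isOpenMap)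
  exact ⟨hS.symm.trans ((Homeomorph.sumProdDistrib).symm.trans
    ((hbe.isEmbedding.toHomeomorph.trans (Homeomorph.setCongr hb)).prodCongr (Homeomorph.refl _)))⟩

open Set Topology Filter

lemma omega_image {M : Type*} [TopologicalSpace M] (f : M ≃ₜ M) (U : Set M) :
    f '' omegaSet f U = omegaSet f U := by
  have h : ∀ n : ℕ, f '' (closure (⋃ (k : ℕ) (_ : n ≤ k), f^[k] '' U)) =
      closure (⋃ (k : ℕ) (_ : n + 1 ≤ k), f^[k] '' U) := by
    intro n
    rw [f.image_closure]
    congr 1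
    ext x
    simp only [mem_image, mem_iUnion]
    constructor
    · rintro ⟨y, ⟨k, hk, u, hu, rfl⟩, rfl⟩
      exact ⟨k + 1, by omega, u, hu, Function.iterate_succ_apply' f k u⟩
    · rintro ⟨k, hk, u, hu, rfl⟩
      obtain ⟨j, rfl⟩ : ∃ j, k = j + 1 := ⟨k - 1, by omega⟩
      exact ⟨f^[j] u, ⟨j, by omega, u, hu, rfl⟩, (Function.iterate_succ_apply' f j u).symm⟩
  unfold omegaSet
  rw [image_iInter f.bijective]
  apply Subset.antisymm
  · intro x hx
    simp only [mem_iInter] at hx ⊢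
    intro n hn
    have := hx n
    rw [image_iInter f.bijective, mem_iInter] at this
    have := this hn
    rw [h] at this
    refine closure_mono ?_ this
    exact iUnion₂_subset fun k hk => subset_iUnion₂_of_subset k (by omega) Subset.rfl
  · intro x hx
    simp only [mem_iInter] at hx ⊢
    intro n
    rw [image_iInter f.bijective, mem_iInter]
    intro hn
    rw [h]
    exact hx (n + 1) (by omega)

lemma attr_inv {M : Type*} [TopologicalSpace M] {f : M ≃ₜ M} {K : Set M} (h : IsAttractor f K) :
    f '' K = K := by
  obtain ⟨-, U, -, rfl⟩ := h
  exact omega_image f U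

lemma iter_inv {M : Type*} {f : M → M} {K : Set M} (h : f '' K = K) (n : ℕ) : f^[n] '' K = K := by
  induction n with
  | zero => simp
  | succ n ih => rw [Function.iterate_succ', image_comp, ih, h]

lemma stab {M : Type*} [TopologicalSpace M] [T2Space M] [LocallyCompactSpace M]
    [LocallyConnectedSpace M] {f : M ≃ₜ M} {K : Set M} (h : IsAttractor f K) (hK : IsConnected K) :
    ∃ V ∈ 𝓝ˢ K, ∀ W ∈ 𝓝ˢ K, ∃ n0 : ℕ, ∀ n ≥ n0, f^[n] '' V ⊆ W := by
  have hinv := attr_inv h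
  obtain ⟨hKc, U, hU, hKU⟩ := h
  obtain ⟨x0, hx0⟩ := hK.nonempty
  have hKint : K ⊆ interior U := subset_interior_iff_mem_nhdsSet.2 hU
  set V := connectedComponentIn (interior U) x0 with hV
  have hVo : IsOpen V := isOpen_interior.connectedComponentIn
  have hKV : K ⊆ V := hK.isPreconnected.subset_connectedComponentIn hx0 hKint
  refine ⟨V, hVo.mem_nhdsSet.2 hKV, fun W hW => ?_⟩
  obtain ⟨L, hL, hKL, hLW⟩ := exists_compact_between hKc isOpen_interior
    (subset_interior_iff_mem_nhdsSet.2 hW)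
  by_contra hcon
  push Not at hcon
  have hne : ∀ n : ℕ, (frontier (interior L) ∩ closure (⋃ (k : ℕ) (_ : n ≤ k), f^[k] '' U)).Nonempty := by
    intro n
    obtain ⟨m, hm, hmW⟩ := hcon n
    have hc : IsPreconnected (f^[m] '' V) := isPreconnected_connectedComponentIn.image _
      (f.continuous.iterate m).continuousOn
    obtain ⟨z, hz1, hz2⟩ : (f^[m] '' V ∩ frontier (interior L)).Nonempty := by
      by_contra hemp
      rw [not_nonempty_iff_eq_empty] at hemp
      have : IsClopen (Subtype.val ⁻¹' (interior L) : Set ↥(f^[m] '' V)) := by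
        refine ⟨?_, isOpen_interior.preimage continuous_subtype_val⟩
        rw [← closure_subset_iff_isClosed]
        intro y hy
        have h1 : (y : M) ∈ closure (interior L) := by
          have := continuous_subtype_val.closure_preimage_subset (interior L) hy
          exact this
        by_contra h2
        have : (y : M) ∈ f^[m] '' V ∩ frontier (interior L) := by
          refine ⟨y.2, h1, ?_⟩
          rwa [interior_interior]
        rw [hemp] at this
        exact this
      have hps : PreconnectedSpace ↥(f^[m] '' V) := Subtype.preconnectedSpace hc
      rcases isClopen_iff.1 this with h | h
      · have hx : x0 ∈ f^[m] '' K := by rw [iter_inv hinv]; exact hx0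
        have hx' : x0 ∈ f^[m] '' V := image_mono hKV hx
        have : (⟨x0, hx'⟩ : ↥(f^[m] '' V)) ∈ (Subtype.val ⁻¹' (interior L) : Set ↥(f^[m] '' V)) := hKL hx0
        rw [h] at this
        exact this
      · apply hmW
        intro y hy
        have : (⟨y, hy⟩ : ↥(f^[m] '' V)) ∈ (Subtype.val ⁻¹' (interior L) : Set ↥(f^[m] '' V)) := by
          rw [h]; trivial
        exact interior_subset (hLW (interior_subset this))
    refine ⟨z, hz2, subset_closure (mem_iUnion₂.2 ⟨m, hm, ?_⟩)⟩
    exact image_mono ((connectedComponentIn_subset _ _).trans interior_subset) hz1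
  have hfc : IsCompact (frontier (interior L)) :=
    hL.of_isClosed_subset isClosed_frontier (frontier_subset_closure.trans
      (closure_minimal interior_subset hL.isClosed))
  obtain ⟨z, hz⟩ := IsCompact.nonempty_iInter_of_sequence_nonempty_isCompact_isClosed _ (by
    intro n
    apply inter_subset_inter_right
    apply closure_mono
    exact iUnion₂_subset fun k hk => subset_iUnion₂_of_subset k (by omega) Subset.rfl) hne
    (hfc.inter_right isClosed_closure) (fun n => isClosed_frontier.inter isClosed_closure)
  rw [mem_iInter] at hz
  have hzK : z ∈ K := by
    rw [hKU]
    exact mem_iInter₂.2 fun n _ => (hz n).2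
  have := (hz 0).1.2
  rw [interior_interior] at this
  exact this (hKL hzK)

open Set Topology Filter

lemma fin_periodic {C : Type*} {Ψ : C → C} (hΨ : Function.Injective Ψ) {F : Set C} (hF : F.Finite)
    (h : ∀ c, ∃ n0 : ℕ, ∀ n ≥ n0, Ψ^[n] c ∈ F) (c : C) : c ∈ F := by
  obtain ⟨n0, hn0⟩ := h c
  have : Finite F := hF
  obtain ⟨i, j, hij, he⟩ := Finite.exists_ne_map_eq_of_infinite
    (fun n : ℕ => (⟨Ψ^[n + n0] c, hn0 _ (by omega)⟩ : F))
  have he' : Ψ^[i + n0] c = Ψ^[j + n0] c := congrArg Subtype.val he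
  wlog hlt : i < j generalizing i j
  · exact this j i hij.symm he.symm he'.symm (by omega)
  obtain ⟨d, hd, rfl⟩ : ∃ d, 0 < d ∧ j = i + d := ⟨j - i, by omega, by omega⟩
  rw [show i + d + n0 = (i + n0) + d by omega, Function.iterate_add_apply Ψ (i + n0) d] at he'
  have hp : Function.IsPeriodicPt Ψ d c := (hΨ.iterate _ he').symm
  have := hn0 (n0 * d) (Nat.le_mul_of_pos_right _ hd)
  rwa [(hp.const_mul n0)] at this

lemma comps_fin {X : Type*} [TopologicalSpace X] [LocallyConnectedSpace X] {K : Set X}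
    (hK : IsClosed K) [Finite (ConnectedComponents ↥(Kᶜ))] :
    ∃ (k : ℕ) (U : Fin k → Set X), (∀ i, IsOpen (U i)) ∧ (∀ i, IsConnected (U i)) ∧
      (∀ i j, i ≠ j → Disjoint (U i) (U j)) ∧ ⋃ i, U i = Kᶜ := by
  have : LocallyConnectedSpace ↥(Kᶜ) := hK.isOpen_compl.isOpenEmbedding_subtypeVal.locallyConnectedSpace
  obtain ⟨k, ⟨E⟩⟩ := Finite.exists_equiv_fin (ConnectedComponents ↥(Kᶜ))
  refine ⟨k, fun i => Subtype.val '' ((fun y : ↥(Kᶜ) => (ConnectedComponents.mk y)) ⁻¹' {E.symm i}), ?_, ?_, ?_, ?_⟩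
  · intro i
    apply hK.isOpen_compl.isOpenMap_subtype_val
    exact (isOpen_discrete _).preimage ConnectedComponents.continuous_coe
  · intro i
    obtain ⟨y, hy⟩ := ConnectedComponents.surjective_coe (E.symm i)
    beta_reduce
    rw [← hy]
    refine IsConnected.image ?_ _ continuous_subtype_val.continuousOn
    change IsConnected (ConnectedComponents.mk ⁻¹' {ConnectedComponents.mk y})
    rw [connectedComponents_preimage_singleton]
    exact isConnected_connectedComponent
  · intro i j hij
    apply Disjoint.image ?_ Subtype.val_injective.injOn (subset_univ _) (subset_univ _)
    apply Disjoint.preimage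
    simpa using hij
  · ext x
    simp only [mem_iUnion, mem_image, mem_preimage, mem_singleton_iff]
    constructor
    · rintro ⟨i, y, -, rfl⟩
      exact y.2
    · intro hx
      exact ⟨E (ConnectedComponents.mk ⟨x, hx⟩), ⟨x, hx⟩, by simp, rfl⟩

lemma fin_comps {X : Type*} [TopologicalSpace X] [CompactSpace X] [T2Space X]
    [LocallyConnectedSpace X] (f : X ≃ₜ X) {K : Set X} (hK : IsClosed K) (hfK : f '' K = K)
    {V : Set X} (hV : V ∈ 𝓝ˢ K) (hst : ∀ W ∈ 𝓝ˢ K, ∃ n0 : ℕ, ∀ n ≥ n0, f^[n] '' V ⊆ W) :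
    ∃ (k : ℕ) (U : Fin k → Set X), (∀ i, IsOpen (U i)) ∧ (∀ i, IsConnected (U i)) ∧
      (∀ i j, i ≠ j → Disjoint (U i) (U j)) ∧ ⋃ i, U i = Kᶜ := by
  suffices Finite (ConnectedComponents ↥(Kᶜ)) from comps_fin hK
  have : LocallyConnectedSpace ↥(Kᶜ) := hK.isOpen_compl.isOpenEmbedding_subtypeVal.locallyConnectedSpace
  have hmem : ∀ x, x ∈ Kᶜ → f.symm x ∈ Kᶜ := by
    intro x hx h
    apply hx
    rw [← hfK]
    exact ⟨_, h, by simp⟩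
  have hmem' : ∀ x, x ∈ Kᶜ → f x ∈ Kᶜ := by
    intro x hx h
    apply hx
    rw [← hfK] at h
    obtain ⟨y, hy, he⟩ := h
    rwa [← f.injective he]
  let g : ↥(Kᶜ) → ↥(Kᶜ) := fun y => ⟨f.symm y, hmem _ y.2⟩
  let g' : ↥(Kᶜ) → ↥(Kᶜ) := fun y => ⟨f y, hmem' _ y.2⟩
  have hg : Continuous g := (f.symm.continuous.comp continuous_subtype_val).subtype_mk _
  have hg' : Continuous g' := (f.continuous.comp continuous_subtype_val).subtype_mk _
  have hinj : Function.Injective hg.connectedComponentsMap := by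
    apply Function.LeftInverse.injective (g := hg'.connectedComponentsMap)
    intro c
    obtain ⟨y, rfl⟩ := ConnectedComponents.surjective_coe c
    change ConnectedComponents.mk (g' (g y)) = _
    congr 1
    apply Subtype.ext
    simp [g, g']
  have hit : ∀ (n : ℕ) (y : ↥(Kᶜ)), hg.connectedComponentsMap^[n] (ConnectedComponents.mk y) =
      ConnectedComponents.mk (g^[n] y) := by
    intro n y
    induction n with
    | zero => rfl
    | succ n ih =>
      rw [Function.iterate_succ_apply', ih, Function.iterate_succ_apply']
      rfl
  have hfg : ∀ (n : ℕ) (y : ↥(Kᶜ)), f^[n] (g^[n] y : ↥(Kᶜ)) = y := by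
    intro n
    induction n with
    | zero => intro y; rfl
    | succ n ih =>
      intro y
      rw [Function.iterate_succ_apply, Function.iterate_succ_apply']
      simp only [g, Homeomorph.apply_symm_apply]
      exact ih y
  let L : Set ↥(Kᶜ) := Subtype.val ⁻¹' (interior V)ᶜ
  have hL : IsCompact L := by
    have h1 : IsCompact ((interior V)ᶜ : Set X) := isOpen_interior.isClosed_compl.isCompact
    refine (hK.isOpen_compl.isOpenEmbedding_subtypeVal.isInducing.isCompact_preimage_iff ?_).2 h1
    rw [Subtype.range_coe]
    exact compl_subset_compl.2 (subset_interior_iff_mem_nhdsSet.2 hV)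
  have hF : ((ConnectedComponents.mk : ↥(Kᶜ) → _) '' L).Finite :=
    (hL.image ConnectedComponents.continuous_coe).finite_of_discrete
  refine Set.finite_univ_iff.1 (hF.subset fun c _ => fin_periodic hinj hF ?_ c)
  intro c
  obtain ⟨y, rfl⟩ := ConnectedComponents.surjective_coe c
  obtain ⟨n0, hn0⟩ := hst {(y : X)}ᶜ (isOpen_compl_singleton.mem_nhdsSet.2 (by
    intro x hx hxy
    rw [mem_singleton_iff] at hxy
    exact y.2 (hxy ▸ hx)))
  refine ⟨n0, fun n hn => ?_⟩
  rw [hit]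
  refine ⟨_, ?_, rfl⟩
  intro h
  exact hn0 n hn ⟨_, interior_subset h, hfg n y⟩ rfl

lemma comps_equiv {X : Type*} [TopologicalSpace X] {K : Set X} {k : ℕ} {U : Fin k → Set X}
    (ho : ∀ i, IsOpen (U i)) (hc : ∀ i, IsConnected (U i)) (hd : ∀ i j, i ≠ j → Disjoint (U i) (U j))
    (hU : ⋃ i, U i = Kᶜ) : Nonempty (ConnectedComponents ↥(Kᶜ) ≃ Fin k) := by
  have hsub : ∀ i, U i ⊆ Kᶜ := fun i => hU ▸ subset_iUnion U i
  have hcov : ∀ y : ↥(Kᶜ), ∃ i, (y : X) ∈ U i := fun y => by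
    exact mem_iUnion.1 (hU.symm ▸ y.2 : (y : X) ∈ ⋃ i, U i)
  choose s hs using hcov
  have huniq : ∀ (y : ↥(Kᶜ)) i, (y : X) ∈ U i → s y = i := by
    intro y i hy
    by_contra hne
    exact disjoint_left.1 (hd _ _ hne) (hs y) hy
  have hsc : Continuous s := by
    rw [continuous_discrete_rng]
    intro i
    have : s ⁻¹' {i} = Subtype.val ⁻¹' U i := by
      ext y
      exact ⟨fun h => by rw [← (h : s y = i)]; exact hs y, huniq y i⟩
    rw [this]
    exact (ho i).preimage continuous_subtype_val
  refine ⟨Equiv.ofBijective hsc.connectedComponentsLift ⟨?_, ?_⟩⟩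
  · intro c d
    obtain ⟨y, rfl⟩ := ConnectedComponents.surjective_coe c
    obtain ⟨z, rfl⟩ := ConnectedComponents.surjective_coe d
    intro h
    have h : s y = s z := h
    rw [ConnectedComponents.coe_eq_coe']
    have h1 : IsPreconnected (Subtype.val ⁻¹' U (s z) : Set ↥(Kᶜ)) := by
      rw [← IsInducing.subtypeVal.isPreconnected_image, Subtype.image_preimage_coe,
        inter_eq_right.2 (hsub _)]
      exact (hc _).isPreconnected
    exact h1.subset_connectedComponent (hs z) (h ▸ hs y : (y : X) ∈ U (s z))
  · intro i
    obtain ⟨x, hx⟩ := (hc i).nonempty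
    exact ⟨ConnectedComponents.mk ⟨x, hsub i hx⟩, huniq _ _ hx⟩

open Set Topology Filter

abbrev S2 := ↥(Metric.sphere (0 : EuclideanSpace ℝ (Fin 3)) 1)

lemma compl_conn {X : Type*} [TopologicalSpace X] [ConnectedSpace X] {K : Set X} {k : ℕ}
    {U : Fin k → Set X} (hK : IsConnected K)
    (ho : ∀ i, IsOpen (U i)) (hc : ∀ i, IsConnected (U i)) (hd : ∀ i j, i ≠ j → Disjoint (U i) (U j))
    (hU : ⋃ i, U i = Kᶜ) (i : Fin k) : IsPreconnected (U i)ᶜ := by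
  obtain ⟨x0, hx0⟩ := hK.nonempty
  have hsub : ∀ i, U i ⊆ Kᶜ := fun i => hU ▸ subset_iUnion U i
  have hcl : ∀ j, closure (U j) ⊆ U j ∪ K := by
    intro j x hx
    by_contra h
    simp only [mem_union, not_or] at h
    have : x ∈ ⋃ i, U i := by rw [hU]; exact h.2
    obtain ⟨l, hl⟩ := mem_iUnion.1 this
    have hlj : l ≠ j := fun hlj => h.1 (hlj ▸ hl)
    obtain ⟨y, hy1, hy2⟩ := mem_closure_iff.1 hx (U l) (ho l) hl
    exact disjoint_left.1 (hd _ _ hlj) hy1 hy2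
  have hpc : ∀ j, IsPreconnected (K ∪ closure (U j)) := by
    intro j
    have hne : (K ∩ closure (U j)).Nonempty := by
      by_contra hemp
      rw [not_nonempty_iff_eq_empty] at hemp
      have : IsClopen (U j) := by
        refine ⟨closure_subset_iff_isClosed.1 fun x hx => (hcl j hx).resolve_right fun hxK => ?_, ho j⟩
        have : x ∈ K ∩ closure (U j) := ⟨hxK, hx⟩
        rw [hemp] at this
        exact this
      rcases isClopen_iff.1 this with h | h
      · exact (hc j).nonempty.ne_empty h
      · exact hsub j (h ▸ mem_univ x0) hx0
    obtain ⟨y, hy1, hy2⟩ := hne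
    exact hK.isPreconnected.union y hy1 hy2 (hc j).isPreconnected.closure
  have : (U i)ᶜ = ⋃₀ ({K} ∪ ⋃ j, {S | S = K ∪ closure (U j) ∧ j ≠ i}) := by
    ext x
    constructor
    · intro hx
      by_cases hxK : x ∈ K
      · exact ⟨K, Or.inl rfl, hxK⟩
      · have : x ∈ ⋃ i, U i := by rw [hU]; exact hxK
        obtain ⟨j, hj⟩ := mem_iUnion.1 this
        exact ⟨_, Or.inr (mem_iUnion.2 ⟨j, rfl, fun h => hx (h ▸ hj)⟩), Or.inr (subset_closure hj)⟩
    · rintro ⟨S, hS | hS, hx⟩ hxi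
      · rw [mem_singleton_iff] at hS
        exact hsub i hxi (hS ▸ hx)
      · obtain ⟨j, rfl, hji⟩ := mem_iUnion.1 hS
        rcases hx with hx | hx
        · exact hsub i hxi hx
        · rcases hcl j hx with h | h
          · exact disjoint_left.1 (hd _ _ hji) h hxi
          · exact hsub i hxi h
  rw [this]
  apply isPreconnected_sUnion x0
  · rintro S (hS | hS)
    · rw [mem_singleton_iff] at hS
      exact hS ▸ hx0
    · obtain ⟨j, rfl, -⟩ := mem_iUnion.1 hS
      exact Or.inl hx0
  · rintro S (hS | hS)
    · rw [mem_singleton_iff] at hS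
      exact hS ▸ hK.isPreconnected
    · obtain ⟨j, rfl, -⟩ := mem_iUnion.1 hS
      exact hpc j

lemma stereo (p : S2) : ∃ j : ℂ → S2, IsOpenEmbedding j ∧ range j = {p}ᶜ := by
  have : Fact (Module.finrank ℝ (EuclideanSpace ℝ (Fin 3)) = 2 + 1) := ⟨by simp⟩
  let κ : EuclideanSpace ℝ (Fin 2) ≃ₜ ℂ := Complex.orthonormalBasisOneI.repr.symm.toHomeomorph
  have h1 : IsOpenEmbedding (stereographic' 2 p).symm :=
    (stereographic' 2 p).symm.to_isOpenEmbedding (by simp)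
  refine ⟨(stereographic' 2 p).symm ∘ κ.symm, h1.comp κ.symm.isOpenEmbedding, ?_⟩
  rw [range_comp, κ.symm.range_coe, image_univ]
  have := (stereographic' 2 p).symm_image_target_eq_source
  rwa [stereographic'_target, stereographic'_source, image_univ] at this

lemma cell_of {U : Set S2} (ho : IsOpen U) (hc : IsConnected U) (hcc : IsPreconnected Uᶜ) {p : S2}
    (hp : p ∉ U) {c : S2} (hcU : c ∈ U) :
    ∃ e : P2 → S2, IsOpenEmbedding e ∧ range e = U ∧ e 0 = c := by
  obtain ⟨j, hj, hjr⟩ := stereo p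
  have hUr : U ⊆ range j := by
    rw [hjr]
    intro x hx hxp
    rw [mem_singleton_iff] at hxp
    exact hp (hxp ▸ hx)
  have hjU : j '' (j ⁻¹' U) = U := image_preimage_eq_of_subset hUr
  obtain ⟨e, he, her⟩ := riemann_mapping (Ω := j ⁻¹' U) (ho.preimage hj.continuous) (by
      intro T hT hTc hTcl
      by_contra hne
      have hB : IsClosed (Uᶜ \ j '' T) := by
        rw [← isOpen_compl_iff]
        have : (Uᶜ \ j '' T)ᶜ = j '' ((j ⁻¹' U)ᶜ \ T)ᶜ := by
          ext x
          constructor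
          · intro hx
            rw [mem_compl_iff, mem_diff, not_and_or, not_not, mem_compl_iff, not_not] at hx
            rcases hx with hx | ⟨t, ht, rfl⟩
            · obtain ⟨z, rfl⟩ := hUr hx
              exact ⟨z, fun h => h.1 hx, rfl⟩
            · exact ⟨t, fun h => h.2 ht, rfl⟩
          · rintro ⟨z, hz, rfl⟩ ⟨h1, h2⟩
            exact hz ⟨h1, fun h => h2 ⟨z, h, rfl⟩⟩
        rw [this]
        exact hj.isOpenMap _ hTcl.isOpen_compl
      obtain ⟨t, ht⟩ := nonempty_iff_ne_empty.2 hne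
      obtain ⟨x, hx1, hx2, hx3⟩ := isPreconnected_closed_iff.1 hcc (j '' T) (Uᶜ \ j '' T)
        (hTc.image hj.continuous).isClosed hB (by
          intro x hx
          by_cases h : x ∈ j '' T
          · exact Or.inl h
          · exact Or.inr ⟨hx, h⟩) ⟨j t, hT ht, t, ht, rfl⟩ ⟨p, hp, hp, by
            rintro ⟨t, ht, h⟩
            have : p ∈ range j := ⟨t, h⟩
            rw [hjr] at this
            exact this rfl⟩
      exact hx3.2 hx2) (by
      rw [← hj.isInducing.isPreconnected_image, hjU]
      exact hc.isPreconnected) (by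
      obtain ⟨x, hx⟩ := hc.nonempty
      obtain ⟨z, rfl⟩ := hUr hx
      exact ⟨z, hx⟩)
  let κ : EuclideanSpace ℝ (Fin 2) ≃ₜ ℂ := Complex.orthonormalBasisOneI.repr.symm.toHomeomorph
  have hE : IsOpenEmbedding (j ∘ e ∘ κ) := hj.comp (he.comp κ.isOpenEmbedding)
  have hEr : range (j ∘ e ∘ κ) = U := by
    rw [range_comp, range_comp, κ.range_coe, image_univ, her, hjU]
  obtain ⟨q, hq⟩ : c ∈ range (j ∘ e ∘ κ) := hEr ▸ hcU
  refine ⟨(j ∘ e ∘ κ) ∘ (Homeomorph.addLeft q), hE.comp (Homeomorph.isOpenEmbedding _), ?_, ?_⟩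
  · rw [range_comp _ (Homeomorph.addLeft q), Homeomorph.range_coe, image_univ, hEr]
  · simpa using hq

open Set Topology Filter

def EndBasis {T X : Type*} [TopologicalSpace X] (φ : T × ℝ → X) (E : Set X) : Prop :=
  (∀ s : ℝ, φ '' {p | p.2 < s} ∪ E ∈ 𝓝ˢ E) ∧ ∀ W ∈ 𝓝ˢ E, ∃ sg : ℝ, φ '' {p | p.2 < sg} ⊆ W

lemma exists_beta {δ : ℝ} (hδ : 0 < δ) : ∃ β : ℝ → ℝ, IsOpenEmbedding β ∧ (∀ r ≤ 0, β r = r) ∧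
    (∀ r, β r < δ) ∧ ∀ r, β r < 0 → r < 0 := by
  let β : ℝ → ℝ := fun r => min r 0 + δ * (1 - Real.exp (-(max r 0) / δ))
  have hβ0 : ∀ r ≤ 0, β r = r := by
    intro r hr
    simp [β, min_eq_left hr, max_eq_right hr]
  have hβ1 : ∀ r, 0 ≤ r → β r = δ * (1 - Real.exp (-r / δ)) := by
    intro r hr
    simp [β, min_eq_right hr, max_eq_left hr]
  have hβn : ∀ r, 0 ≤ r → 0 ≤ β r := by
    intro r hr
    rw [hβ1 r hr]
    apply mul_nonneg hδ.le
    rw [sub_nonneg, Real.exp_le_one_iff]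
    apply div_nonpos_of_nonpos_of_nonneg (by linarith) hδ.le
  have hβδ : ∀ r, β r < δ := by
    intro r
    rcases le_total r 0 with h | h
    · rw [hβ0 r h]; linarith
    · rw [hβ1 r h]; nlinarith [Real.exp_pos (-r / δ)]
  have hcont : Continuous β := by fun_prop
  have hmono : StrictMono β := by
    intro r s hrs
    rcases lt_or_ge r 0 with h | h
    · rcases le_total s 0 with h' | h'
      · rw [hβ0 r h.le, hβ0 s h']; exact hrs
      · rw [hβ0 r h.le]; exact h.trans_le (hβn s h')
    · rw [hβ1 r h, hβ1 s (h.trans hrs.le)]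
      have : Real.exp (-s / δ) < Real.exp (-r / δ) := by
        apply Real.exp_lt_exp.2
        gcongr
      nlinarith
  have hran : range β = Iio δ := by
    ext y
    constructor
    · rintro ⟨r, rfl⟩; exact hβδ r
    · intro hy
      have hy : y < δ := hy
      rcases le_total y 0 with h | h
      · exact ⟨y, hβ0 y h⟩
      · have hpos : 0 < 1 - y / δ := by rw [sub_pos, div_lt_one hδ]; exact hy
        have hlog : Real.log (1 - y / δ) ≤ 0 := Real.log_nonpos hpos.le (by
          have := div_nonneg h hδ.le
          linarith)
        refine ⟨-δ * Real.log (1 - y / δ), ?_⟩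
        rw [hβ1 _ (by nlinarith)]
        rw [show -(-δ * Real.log (1 - y / δ)) / δ = Real.log (1 - y / δ) by field_simp,
          Real.exp_log hpos]
        field_simp
        ring
  refine ⟨β, ⟨hmono.isEmbedding_of_ordConnected (by rw [hran]; exact ordConnected_Iio), ?_⟩, hβ0, hβδ, ?_⟩
  · rw [hran]; exact isOpen_Iio
  · intro r hr
    by_contra h
    exact absurd (hβn r (not_lt.1 h)) (not_le.2 hr)

section
variable {T X : Type*} [TopologicalSpace T] [CompactSpace T] [TopologicalSpace X] [T2Space X]

theorem ring_union (g : X ≃ₜ X) {E B B' : Set X} (hEc : IsClosed E) {φ₁ : T × ℝ → X}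
    (h : IsOpenEmbedding φ₁) (hE : Disjoint (range φ₁) E) (hb : EndBasis φ₁ E)
    (hB : B = E ∪ φ₁ '' {p | p.2 < 0}) (hB' : B' = E ∪ φ₁ '' {p | p.2 ≤ 0}) (hBo : IsOpen B)
    (hBc : IsCompact B') (hBg : B' ⊆ g '' B)
    (hφ : ∀ n : ℕ, 1 ≤ n → ∃ φ : T × ℝ → X, IsOpenEmbedding φ ∧ range φ = (g^[n] '' B) \ E ∧
      EndBasis φ E) :
    ∃ H : T × ↥(Ici (0 : ℝ)) → X, IsEmbedding H ∧ range H = (⋃ n : ℕ, g^[n] '' B) \ B := by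
  have hBB' : B ⊆ B' := by
    rw [hB, hB']
    exact union_subset_union_right _ (image_mono fun p (hp : p.2 < 0) => (hp.le : p.2 ≤ 0))
  have hmono : Monotone fun n : ℕ => g^[n] '' B := by
    apply monotone_nat_of_le_succ
    intro n
    rw [Function.iterate_succ, image_comp]
    exact image_mono (hBB'.trans hBg)
  have hop : ∀ n : ℕ, IsOpen (g^[n] '' B) := by
    intro n
    induction n with
    | zero => simpa using hBo
    | succ n ih =>
      rw [Function.iterate_succ', image_comp]
      exact g.isOpenMap _ ih
  obtain ⟨δ, hδ, hδg⟩ : ∃ δ > 0, ∀ p : T × ℝ, p.2 < δ → φ₁ p ∈ g '' B := by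
    have hS : IsOpen (φ₁ ⁻¹' (g '' B)) := (g.isOpenMap B hBo).preimage h.continuous
    obtain ⟨u, v, hu, hv, hTu, h0v, huv⟩ := generalized_tube_lemma (s := (univ : Set T)) isCompact_univ
      (t := {(0 : ℝ)}) isCompact_singleton hS (by
        rintro ⟨x, r⟩ ⟨-, hr⟩
        exact hBg (by rw [hB']; exact Or.inr ⟨_, le_of_eq hr, rfl⟩))
    obtain ⟨δ, hδ, hb⟩ := Metric.mem_nhds_iff.1 (hv.mem_nhds (h0v rfl))
    refine ⟨δ, hδ, fun p hp => ?_⟩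
    rcases le_total p.2 0 with h0 | h0
    · exact hBg (by rw [hB']; exact Or.inr ⟨_, h0, rfl⟩)
    · refine huv (mk_mem_prod (hTu (mem_univ p.1)) (hb ?_))
      rw [Metric.mem_ball, Real.dist_eq, sub_zero, abs_of_nonneg h0]
      exact hp
  obtain ⟨β, hβ, hβ0, hβδ, hβn⟩ := exists_beta hδ
  set D : Set X := ⋃ n : ℕ, g^[n] '' B with hD
  have hDo : IsOpen D := isOpen_iUnion hop
  have hDE : IsOpen (D \ E) := hDo.sdiff hEc
  have hlift : ∀ φ : T × ℝ → X, IsOpenEmbedding φ → range φ ⊆ D \ E →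
      ∃ φ' : T × ℝ → ↥(D \ E), IsOpenEmbedding φ' ∧ ∀ p, (φ' p : X) = φ p := by
    intro φ h1 h2
    refine ⟨fun p => ⟨φ p, h2 ⟨p, rfl⟩⟩, ?_, fun p => rfl⟩
    exact IsOpenEmbedding.of_comp _ hDE.isOpenEmbedding_subtypeVal h1
  have hgD : g '' B ⊆ D := subset_iUnion (fun n : ℕ => g^[n] '' B) 1
  obtain ⟨φ₀, hφ₀, hφ₀e⟩ := hlift (φ₁ ∘ Prod.map id β) (h.comp (IsOpenEmbedding.id.prodMap hβ)) (by
    rintro _ ⟨p, rfl⟩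
    exact ⟨hgD (hδg _ (hβδ _)), fun hm => disjoint_left.1 hE ⟨_, rfl⟩ hm⟩)
  have hφ₀0 : ∀ p : T × ℝ, p.2 ≤ 0 → (φ₀ p : X) = φ₁ p := by
    intro p hp
    rw [hφ₀e]
    simp [Prod.map, hβ0 _ hp]
  have hcof : ∀ φ : T × ℝ → X, EndBasis φ E → range φ ⊆ D \ E → ∀ φ' : T × ℝ → ↥(D \ E),
      (∀ p, (φ' p : X) = φ p) → RingCof φ₀ φ' := by
    intro φ h1 h2 φ' h3
    constructor
    · intro s
      obtain ⟨sg, hσ⟩ := h1.2 _ (hb.1 (min s 0))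
      refine ⟨sg, ?_⟩
      rintro _ ⟨p, hp, rfl⟩
      rcases hσ ⟨p, hp, rfl⟩ with ⟨q, hq, hqe⟩ | hEm
      · have hq' : q.2 < min s 0 := hq
        refine ⟨q, hq'.trans_le (min_le_left _ _), Subtype.ext ?_⟩
        rw [h3, hφ₀0 _ (hq'.le.trans (min_le_right _ _)), hqe]
      · exact absurd hEm (h2 ⟨p, rfl⟩).2
    · intro s
      obtain ⟨sg, hσ⟩ := hb.2 _ (h1.1 s)
      refine ⟨min sg 0, ?_⟩
      rintro _ ⟨p, hp, rfl⟩
      have hp' : p.2 < min sg 0 := hp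
      have hpe := hφ₀0 p (hp'.le.trans (min_le_right _ _))
      rcases hσ ⟨p, hp'.trans_le (min_le_left _ _), rfl⟩ with ⟨q, hq, hqe⟩ | hEm
      · refine ⟨q, hq, Subtype.ext ?_⟩
        rw [h3, hqe, hpe]
      · rw [← hpe] at hEm
        exact absurd hEm (φ₀ p).2.2
  have hext : RingExt φ₀ := by
    intro Y hY
    have hY' : IsCompact (Subtype.val '' Y : Set X) := hY.image continuous_subtype_val
    obtain ⟨n, hn⟩ := hY'.elim_directed_cover (fun n : ℕ => g^[n] '' B) hop (by
      rintro _ ⟨y, -, rfl⟩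
      exact y.2.1) hmono.directed_le
    obtain ⟨φ, h1, h2, h3⟩ := hφ (n + 1) (by omega)
    have h2' : range φ ⊆ D \ E := by
      rw [h2]
      exact sdiff_subset_sdiff_left (subset_iUnion (fun n : ℕ => g^[n] '' B) _)
    obtain ⟨φ', h4, h5⟩ := hlift φ h1 h2'
    have h6 : ∀ y : ↥(D \ E), (y : X) ∈ g^[n + 1] '' B → y ∈ range φ' := by
      intro y hy
      have : (y : X) ∈ range φ := by rw [h2]; exact ⟨hy, y.2.2⟩
      obtain ⟨p, hp⟩ := this
      exact ⟨p, Subtype.ext (by rw [h5, hp])⟩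
    refine ⟨φ', h4, fun y hy => h6 y (hmono (Nat.le_succ n) (hn ⟨y, hy, rfl⟩)), ?_, hcof φ h3 h2' φ' h5⟩
    rintro _ ⟨p, hp, rfl⟩
    apply h6
    have : (φ₀ p : X) ∈ g^[1] '' B := by
      rw [hφ₀0 p hp]
      exact hBg (by rw [hB']; exact Or.inr ⟨_, hp, rfl⟩)
    exact hmono (show 1 ≤ n + 1 by omega) this
  obtain ⟨H, hH⟩ := ring_brown hφ₀ hext (fun n : ℕ => (Subtype.val ⁻¹' (g^[n] '' B' \ B) : Set ↥(D \ E))) (by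
    intro n
    refine (hDE.isOpenEmbedding_subtypeVal.isInducing.isCompact_preimage_iff ?_).2
      ((hBc.image (g.continuous.iterate n)).diff hBo)
    rw [Subtype.range_coe]
    rintro x ⟨⟨y, hy, rfl⟩, hx⟩
    refine ⟨?_, fun hxE => hx (by rw [hB]; exact Or.inl hxE)⟩
    refine mem_iUnion.2 ⟨n + 1, ?_⟩
    rw [Function.iterate_succ, image_comp]
    exact ⟨y, hBg hy, rfl⟩) (by
    intro d
    by_cases hd : (d : X) ∈ B
    · left
      rw [hB] at hd
      rcases hd with hd | ⟨p, hp, hpe⟩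
      · exact absurd hd d.2.2
      · exact ⟨p, (show p.2 ≤ 0 from le_of_lt hp), Subtype.ext (by rw [hφ₀0 p (le_of_lt hp), hpe])⟩
    · right
      obtain ⟨n, hn⟩ := mem_iUnion.1 d.2.1
      exact ⟨n, image_mono hBB' hn, hd⟩)
  refine ⟨fun p => H (p.1, p.2), ?_, ?_⟩
  · exact IsEmbedding.subtypeVal.comp (H.isEmbedding.comp (IsEmbedding.id.prodMap IsEmbedding.subtypeVal))
  · ext x
    constructor
    · rintro ⟨p, rfl⟩
      refine ⟨(H (p.1, p.2)).2.1, fun hm => ?_⟩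
      rw [hB] at hm
      rcases hm with hm | ⟨q, hq, hqe⟩
      · exact (H (p.1, p.2)).2.2 hm
      · have hq' : q.2 < 0 := hq
        rw [← hφ₀0 q hq'.le, ← hH q hq'.le] at hqe
        have := H.injective (Subtype.ext hqe)
        rw [this] at hq'
        exact absurd p.2.2 (not_le.2 hq')
    · rintro ⟨h1, h2⟩
      have h3 : x ∈ D \ E := ⟨h1, fun hm => h2 (by rw [hB]; exact Or.inl hm)⟩
      obtain ⟨q, hq⟩ := H.surjective ⟨x, h3⟩
      have hq0 : 0 ≤ q.2 := by
        by_contra hlt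
        push Not at hlt
        apply h2
        rw [hB]
        refine Or.inr ⟨q, hlt, ?_⟩
        rw [← hφ₀0 q hlt.le, ← hH q hlt.le, hq]
      exact ⟨(q.1, ⟨q.2, hq0⟩), by simp [hq]⟩
end

open Set Topology Filter

noncomputable def pol (p : S1 × ℝ) : P2 := Real.exp p.2 • (p.1 : P2)

lemma s1_norm (θ : S1) : ‖(θ : P2)‖ = 1 := by
  have := θ.2
  rwa [mem_sphere_zero_iff_norm] at this

lemma pol_norm (p : S1 × ℝ) : ‖pol p‖ = Real.exp p.2 := by
  rw [pol, norm_smul, s1_norm, mul_one, Real.norm_eq_abs, abs_of_pos (Real.exp_pos _)]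

lemma pol_ne (p : S1 × ℝ) : pol p ≠ 0 := by
  rw [← norm_pos_iff, pol_norm]; exact Real.exp_pos _

lemma pol_surj (v : P2) (hv : v ≠ 0) : ∃ θ : S1, pol (θ, Real.log ‖v‖) = v := by
  have hn : 0 < ‖v‖ := norm_pos_iff.2 hv
  refine ⟨⟨‖v‖⁻¹ • v, ?_⟩, ?_⟩
  · rw [mem_sphere_zero_iff_norm, norm_smul, norm_inv, norm_norm]; exact inv_mul_cancel₀ hn.ne'
  · simp only [pol]
    rw [Real.exp_log hn, smul_smul, mul_inv_cancel₀ hn.ne', one_smul]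

lemma pol_open : IsOpenEmbedding pol := by
  have h1 : IsOpenEmbedding (fun p : S1 × ℝ => ((homeomorphUnitSphereProd P2).symm
      (p.1, Real.expOrderIso.toHomeomorph p.2) : P2)) :=
    (isOpen_compl_singleton.isOpenEmbedding_subtypeVal).comp
      (((homeomorphUnitSphereProd P2).symm.isOpenEmbedding).comp
        ((IsOpenEmbedding.id).prodMap Real.expOrderIso.toHomeomorph.isOpenEmbedding))
  have h2 : pol = fun p : S1 × ℝ => ((homeomorphUnitSphereProd P2).symm
      (p.1, Real.expOrderIso.toHomeomorph p.2) : P2) := by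
    funext p
    rfl
  rw [h2]; exact h1

section
set_option linter.unusedSectionVars false
variable {X : Type*} [TopologicalSpace X] {k : ℕ} {e : Fin k → P2 → X}

noncomputable def psi (e : Fin k → P2 → X) (p : (Fin k × S1) × ℝ) : X := e p.1.1 (pol (p.1.2, p.2))

def cen (e : Fin k → P2 → X) : Set X := range fun i => e i 0
def OO (e : Fin k → P2 → X) (t : ℝ) : Set X := ⋃ i, e i '' Metric.ball 0 (Real.exp t)
def OC (e : Fin k → P2 → X) (t : ℝ) : Set X := ⋃ i, e i '' Metric.closedBall 0 (Real.exp t)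

structure Cells (e : Fin k → P2 → X) : Prop where
  op : ∀ i, IsOpenEmbedding (e i)
  dis : ∀ i j, i ≠ j → Disjoint (range (e i)) (range (e j))

lemma Cells.inj (h : Cells e) {i j : Fin k} {v w : P2} (hv : e i v = e j w) : i = j ∧ v = w := by
  have hij : i = j := by
    by_contra hne
    exact disjoint_left.1 (h.dis i j hne) ⟨v, rfl⟩ ⟨w, hv.symm⟩
  subst hij
  exact ⟨rfl, (h.op i).injective hv⟩

lemma Cells.psi_open (h : Cells e) : IsOpenEmbedding (psi e) := by
  have hc : Continuous (psi e) := by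
    rw [continuous_iff_continuousAt]
    rintro ⟨⟨i, θ⟩, r⟩
    have hU : IsOpen {p : (Fin k × S1) × ℝ | p.1.1 = i} :=
      (isOpen_discrete {i}).preimage (continuous_fst.comp continuous_fst)
    have : ContinuousAt (fun p : (Fin k × S1) × ℝ => e i (pol (p.1.2, p.2))) ((i, θ), r) := by
      apply Continuous.continuousAt
      exact (h.op i).continuous.comp (pol_open.continuous.comp (by fun_prop))
    refine this.congr ?_
    filter_upwards [hU.mem_nhds (show ((i, θ), r) ∈ {p : (Fin k × S1) × ℝ | p.1.1 = i} from rfl)] with p hp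
    have hp' : p.1.1 = i := hp
    simp [psi, hp']
  refine IsOpenEmbedding.of_continuous_injective_isOpenMap hc ?_ ?_
  · rintro ⟨⟨i, θ⟩, r⟩ ⟨⟨j, θ'⟩, r'⟩ hpq
    obtain ⟨h1, h2⟩ := h.inj hpq
    have h3 := pol_open.injective h2
    simp only [Prod.mk.injEq] at h1 h3 ⊢
    exact ⟨⟨h1, h3.1⟩, h3.2⟩
  · intro S hS
    have : psi e '' S = ⋃ i, e i '' (pol '' {q | ((i, q.1), q.2) ∈ S}) := by
      ext x
      simp only [mem_iUnion]
      constructor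
      · rintro ⟨⟨⟨i, θ⟩, r⟩, hp, rfl⟩
        exact ⟨i, _, ⟨(θ, r), hp, rfl⟩, rfl⟩
      · rintro ⟨i, _, ⟨⟨θ, r⟩, hp, rfl⟩, rfl⟩
        exact ⟨((i, θ), r), hp, rfl⟩
    rw [this]
    refine isOpen_iUnion fun i => (h.op i).isOpenMap _ (pol_open.isOpenMap _ ?_)
    exact hS.preimage (by fun_prop)

lemma OO_open (h : Cells e) (t : ℝ) : IsOpen (OO e t) :=
  isOpen_iUnion fun i => (h.op i).isOpenMap _ Metric.isOpen_ball

lemma OC_compact (h : Cells e) (t : ℝ) : IsCompact (OC e t) :=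
  isCompact_iUnion fun i => (isCompact_closedBall _ _).image (h.op i).continuous

lemma psi_cen_dis (h : Cells e) : Disjoint (range (psi e)) (cen e) := by
  rw [disjoint_left]
  rintro _ ⟨p, rfl⟩ ⟨j, hj⟩
  exact pol_ne _ (h.inj hj).2.symm

lemma OO_eq (t : ℝ) : OO e t = cen e ∪ psi e '' {p | p.2 < t} := by
  ext x
  simp only [OO, mem_iUnion]
  constructor
  · rintro ⟨i, v, hv, rfl⟩
    by_cases h0 : v = 0
    · left; exact ⟨i, by simp [h0]⟩
    · right
      obtain ⟨θ, hθ⟩ := pol_surj v h0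
      refine ⟨((i, θ), Real.log ‖v‖), ?_, by simp [psi, hθ]⟩
      rw [mem_ball_zero_iff] at hv
      exact (Real.log_lt_iff_lt_exp (norm_pos_iff.2 h0)).2 hv
  · rintro (⟨i, rfl⟩ | ⟨p, hp, rfl⟩)
    · exact ⟨i, 0, Metric.mem_ball_self (Real.exp_pos _), rfl⟩
    · refine ⟨p.1.1, _, ?_, rfl⟩
      rw [mem_ball_zero_iff, pol_norm]
      exact Real.exp_lt_exp.2 hp

lemma OC_eq (t : ℝ) : OC e t = cen e ∪ psi e '' {p | p.2 ≤ t} := by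
  ext x
  simp only [OC, mem_iUnion]
  constructor
  · rintro ⟨i, v, hv, rfl⟩
    by_cases h0 : v = 0
    · left; exact ⟨i, by simp [h0]⟩
    · right
      obtain ⟨θ, hθ⟩ := pol_surj v h0
      refine ⟨((i, θ), Real.log ‖v‖), ?_, by simp [psi, hθ]⟩
      rw [mem_closedBall_zero_iff] at hv
      exact (Real.log_le_iff_le_exp (norm_pos_iff.2 h0)).2 hv
  · rintro (⟨i, rfl⟩ | ⟨p, hp, rfl⟩)
    · exact ⟨i, 0, Metric.mem_closedBall_self (Real.exp_pos _).le, rfl⟩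
    · refine ⟨p.1.1, _, ?_, rfl⟩
      rw [mem_closedBall_zero_iff, pol_norm]
      exact Real.exp_le_exp.2 hp

lemma range_eq_cen : ⋃ i, range (e i) = cen e ∪ range (psi e) := by
  ext x
  simp only [mem_iUnion]
  constructor
  · rintro ⟨i, v, rfl⟩
    by_cases h0 : v = 0
    · left; exact ⟨i, by simp [h0]⟩
    · right
      obtain ⟨θ, hθ⟩ := pol_surj v h0
      exact ⟨((i, θ), Real.log ‖v‖), by simp [psi, hθ]⟩
  · rintro (⟨i, rfl⟩ | ⟨p, rfl⟩)
    · exact ⟨i, 0, rfl⟩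
    · exact ⟨p.1.1, _, rfl⟩

lemma range_psi (h : Cells e) : range (psi e) = (⋃ i, range (e i)) \ cen e := by
  rw [range_eq_cen, union_sdiff_left]
  exact (psi_cen_dis h).sdiff_eq_left.symm

lemma cen_basis (h : Cells e) : EndBasis (psi e) (cen e) := by
  constructor
  · intro s
    rw [union_comm, ← OO_eq]
    apply (OO_open h s).mem_nhdsSet.2
    rw [OO_eq]; exact subset_union_left
  · intro W hW
    have : ∀ i, ∀ᶠ s : ℝ in atBot, e i '' Metric.ball 0 (Real.exp s) ⊆ W := by
      intro i
      have h1 : W ∈ 𝓝 (e i 0) := mem_nhdsSet_iff_forall.1 hW _ ⟨i, rfl⟩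
      obtain ⟨ε, hε, hb⟩ := Metric.mem_nhds_iff.1 ((h.op i).continuous.continuousAt.preimage_mem_nhds h1)
      filter_upwards [eventually_le_atBot (Real.log ε)] with s hs
      rw [image_subset_iff]
      refine (Metric.ball_subset_ball ?_).trans hb
      exact (Real.exp_le_exp.2 hs).trans (Real.exp_log hε).le
    obtain ⟨sg, hσ⟩ := (eventually_all.2 this).exists
    refine ⟨sg, ?_⟩
    have h2 : OO e sg ⊆ W := iUnion_subset hσ
    rw [OO_eq] at h2
    exact subset_union_right.trans h2

lemma basis_shift {T : Type*} {φ : T × ℝ → X} {E : Set X} (h : EndBasis φ E) (a : ℝ) :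
    EndBasis (fun p => φ (p.1, p.2 + a)) E := by
  have key : ∀ s : ℝ, (fun p : T × ℝ => φ (p.1, p.2 + a)) '' {p | p.2 < s} = φ '' {p | p.2 < s + a} := by
    intro s
    ext x
    constructor
    · rintro ⟨p, hp, rfl⟩
      have hp : p.2 < s := hp
      exact ⟨_, (by simpa using hp : p.2 + a < s + a), rfl⟩
    · rintro ⟨p, hp, rfl⟩
      have hp : p.2 < s + a := hp
      exact ⟨(p.1, p.2 - a), (by linarith : p.2 - a < s), by simp⟩
  constructor
  · intro s
    rw [key]; exact h.1 _
  · intro W hW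
    obtain ⟨sg, hσ⟩ := h.2 W hW
    exact ⟨sg - a, by rw [key]; simpa using hσ⟩

lemma open_shift {T : Type*} [TopologicalSpace T] {φ : T × ℝ → X} (h : IsOpenEmbedding φ) (a : ℝ) :
    IsOpenEmbedding (fun p : T × ℝ => φ (p.1, p.2 + a)) :=
  h.comp (IsOpenEmbedding.id.prodMap (Homeomorph.addRight a).isOpenEmbedding)

/-- Nested sets around K. -/
lemma N_basis [CompactSpace X] (h : Cells e) {K : Set X} (hU : ⋃ i, range (e i) = Kᶜ) {W : Set X}
    (hW : W ∈ 𝓝ˢ K) (t0 : ℝ) : ∃ t > t0, (OO e t)ᶜ ⊆ W := by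
  obtain ⟨W', hW'o, hKW', hW'⟩ := mem_nhdsSet_iff_exists.1 hW
  have hmono : Monotone (OO e) := fun s t hst => iUnion_mono fun i =>
    image_mono (Metric.ball_subset_ball (Real.exp_le_exp.2 hst))
  obtain ⟨t, ht⟩ := hW'o.isClosed_compl.isCompact.elim_directed_cover (OO e) (OO_open h) (by
    intro x hx
    have : x ∈ ⋃ i, range (e i) := by rw [hU]; exact fun hK => hx (hKW' hK)
    obtain ⟨i, v, rfl⟩ := mem_iUnion.1 this
    refine mem_iUnion.2 ⟨‖v‖, mem_iUnion.2 ⟨i, v, ?_, rfl⟩⟩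
    rw [mem_ball_zero_iff]
    linarith [Real.add_one_le_exp ‖v‖]) hmono.directed_le
  refine ⟨max t (t0 + 1), by simp, ?_⟩
  exact (compl_subset_comm.1 (ht.trans (hmono (le_max_left _ _)))).trans hW'

lemma OO_sub_OC (t : ℝ) : OO e t ⊆ OC e t := iUnion_mono fun _ => image_mono Metric.ball_subset_closedBall

lemma OC_sub_OO {s t : ℝ} (h : s < t) : OC e s ⊆ OO e t := iUnion_mono fun _ =>
  image_mono (Metric.closedBall_subset_ball (Real.exp_lt_exp.2 h))

/-- basis at K -/
lemma K_basis [CompactSpace X] [T2Space X] (h : Cells e) {K : Set X} (hU : ⋃ i, range (e i) = Kᶜ) (b : ℝ) :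
    EndBasis (fun p => psi e (p.1, b - p.2)) K := by
  have key : ∀ s : ℝ, (fun p : (Fin k × S1) × ℝ => psi e (p.1, b - p.2)) '' {p | p.2 < s} ∪ K = (OC e (b - s))ᶜ := by
    intro s
    ext x
    rw [OC_eq]
    constructor
    · rintro (⟨p, hp, rfl⟩ | hx)
      · have hp : p.2 < s := hp
        rintro (hm | ⟨q, hq, hqe⟩)
        · exact disjoint_left.1 (psi_cen_dis h) ⟨_, rfl⟩ hm
        · have hq : q.2 ≤ b - s := hq
          have := h.psi_open.injective hqe
          rw [this] at hq
          simp at hq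
          linarith
      · intro hm
        have : x ∈ Kᶜ := by
          rw [← hU, range_eq_cen]
          rcases hm with hm | ⟨q, -, hq⟩
          · exact Or.inl hm
          · exact Or.inr ⟨q, hq⟩
        exact this hx
    · intro hx
      by_cases hK : x ∈ K
      · exact Or.inr hK
      · left
        have : x ∈ Kᶜ := hK
        rw [← hU, range_eq_cen] at this
        rcases this with hm | ⟨q, rfl⟩
        · exact absurd (Or.inl hm) hx
        · refine ⟨(q.1, b - q.2), ?_, by simp⟩
          show b - q.2 < s
          by_contra hlt
          exact hx (Or.inr ⟨q, by show q.2 ≤ b - s; linarith, rfl⟩)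
  have hsub : ∀ s, K ⊆ (OC e s)ᶜ := by
    intro s
    have := key (b - s)
    rw [sub_sub_cancel] at this
    rw [← this]; exact subset_union_right
  constructor
  · intro s
    rw [key]
    exact (OC_compact h _).isClosed.isOpen_compl.mem_nhdsSet.2 (hsub _)
  · intro W hW
    obtain ⟨t, -, ht⟩ := N_basis h hU hW 0
    refine ⟨b - t, ?_⟩
    have := key (b - t)
    rw [sub_sub_cancel] at this
    exact subset_union_left.trans (this.le.trans ((compl_subset_compl.2 (OO_sub_OC t)).trans ht))
end

open Set Topology Filter

section
set_option linter.unusedSectionVars false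
variable {X : Type*} [TopologicalSpace X]

lemma iter_homeo (F : X ≃ₜ X) (p : ℕ) : ∃ g : X ≃ₜ X, ⇑g = F^[p] ∧ ⇑g.symm = F.symm^[p] := by
  induction p with
  | zero => exact ⟨Homeomorph.refl X, rfl, rfl⟩
  | succ p ih =>
    obtain ⟨g, h1, h2⟩ := ih
    refine ⟨F.trans g, ?_, ?_⟩
    · funext x; simp [Function.iterate_succ, h1]
    · funext x
      rw [Function.iterate_succ']
      simp [← h2]

def Tr (g : X ≃ₜ X) (P : Set X) : Set X := {x | ∀ n : ℕ, g.symm^[n] x ∈ P}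

lemma mem_iter (g : X ≃ₜ X) (n : ℕ) (B : Set X) (x : X) : x ∈ g^[n] '' B ↔ g.symm^[n] x ∈ B := by
  have h1 : Function.LeftInverse g.symm^[n] g^[n] := Function.LeftInverse.iterate g.symm_apply_apply n
  have h2 : Function.LeftInverse g^[n] g.symm^[n] := Function.LeftInverse.iterate g.apply_symm_apply n
  constructor
  · rintro ⟨y, hy, rfl⟩; rwa [h1]
  · intro h; exact ⟨_, h, h2 x⟩

lemma Tr_compl (g : X ≃ₜ X) (B : Set X) : (⋃ n : ℕ, g^[n] '' B) = (Tr g Bᶜ)ᶜ := by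
  ext x
  simp only [mem_iUnion, mem_iter, Tr, mem_compl_iff, mem_ofPred_eq, not_forall, not_not]

lemma inv_core (F g : X ≃ₜ X) {p : ℕ} (hp : 1 ≤ p) (hg : ⇑g = F^[p]) {P P0 : Set X} (hPP : P ⊆ P0)
    (hF : F '' P ⊆ P0) (hgP : g '' P0 ⊆ P) : F '' Tr g P = Tr g P ∧ Tr g P = Tr g P0 := by
  have hPP0 : Tr g P = Tr g P0 := by
    apply subset_antisymm
    · intro x hx n; exact hPP (hx n)
    · intro x hx n
      have := hx (n + 1)
      rw [Function.iterate_succ_apply'] at this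
      have h2 := hgP ⟨_, this, rfl⟩
      simpa using h2
  have hcom : ∀ x, g.symm (F x) = F (g.symm x) := by
    intro x
    apply g.injective
    rw [g.apply_symm_apply]
    conv_lhs => rw [← g.apply_symm_apply x]
    rw [hg]
    exact (Function.iterate_succ_apply' F p _).symm.trans (Function.iterate_succ_apply F p _)
  have hcomn : ∀ (n : ℕ) x, g.symm^[n] (F x) = F (g.symm^[n] x) := by
    intro n
    induction n with
    | zero => intro x; rfl
    | succ n ih => intro x; rw [Function.iterate_succ_apply, hcom, ih, Function.iterate_succ_apply]
  have h1 : ∀ x ∈ Tr g P, F x ∈ Tr g P := by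
    intro x hx
    rw [hPP0]
    intro n
    rw [hcomn]
    exact hF ⟨_, hx n, rfl⟩
  refine ⟨subset_antisymm (image_subset_iff.2 h1) ?_, hPP0⟩
  intro x hx
  have h2 : ∀ n : ℕ, ∀ y ∈ Tr g P, F^[n] y ∈ Tr g P := by
    intro n
    induction n with
    | zero => intro y hy; exact hy
    | succ n ih => intro y hy; rw [Function.iterate_succ_apply]; exact ih _ (h1 y hy)
  have h3 : g.symm x ∈ Tr g P := by
    intro n
    rw [← Function.iterate_succ_apply]; exact hx _
  refine ⟨_, h2 (p - 1) _ h3, ?_⟩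
  rw [← Function.iterate_succ_apply' F, Nat.succ_eq_add_one, Nat.sub_add_cancel hp, ← hg, g.apply_symm_apply]

lemma iter_sub {F : X → X} {P : Set X} (h : F '' P ⊆ P) (n : ℕ) : F^[n] '' P ⊆ P := by
  induction n with
  | zero => simp
  | succ n ih =>
    rw [Function.iterate_succ, image_comp]
    exact (image_mono h).trans ih

/-- convergence of iterates -/
lemma conv_core [T2Space X] (F g : X ≃ₜ X) {p : ℕ} (hp : 1 ≤ p) (hg : ⇑g = F^[p]) {C Kl : Set X}
    (hC : IsCompact C) (hgC : g '' C ⊆ C) (hKl : Kl = Tr g C) (hF : F '' Kl = Kl) :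
    ∀ W ∈ 𝓝ˢ Kl, ∃ n0 : ℕ, ∀ n ≥ n0, F^[n] '' C ⊆ W := by
  intro W hW
  obtain ⟨W1, hW1, hKW, hW1W⟩ := mem_nhdsSet_iff_exists.1 hW
  set W' : Set X := ⋂ j : Fin p, F^[j] ⁻¹' W1 with hW'
  have hW'o : IsOpen W' := isOpen_iInter_of_finite fun j => hW1.preimage (F.continuous.iterate j)
  have hKW' : Kl ⊆ W' := by
    intro x hx
    refine mem_iInter.2 fun j => hKW ?_
    have := iter_inv hF (j : ℕ)
    rw [← this]
    exact ⟨x, hx, rfl⟩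
  have hanti : Antitone fun n : ℕ => g^[n] '' C := by
    apply antitone_nat_of_succ_le
    intro n
    rw [Function.iterate_succ, image_comp]
    exact image_mono hgC
  obtain ⟨n1, hn1⟩ : ∃ n1 : ℕ, g^[n1] '' C ⊆ W' := by
    have hcp : ∀ n : ℕ, IsCompact (g^[n] '' C) := fun n => hC.image (g.continuous.iterate n)
    apply exists_subset_nhds_of_isCompact' (V := fun n : ℕ => g^[n] '' C) hanti.directed_ge hcp
      (fun n => (hcp n).isClosed)
    intro x hx
    apply hW'o.mem_nhds
    apply hKW'
    rw [hKl]
    intro n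
    rw [← mem_iter]
    exact mem_iInter.1 hx n
  refine ⟨p * n1, fun n hn => ?_⟩
  have hq : n1 ≤ n / p := by
    rw [Nat.le_div_iff_mul_le (by omega), mul_comm]; exact hn
  rintro _ ⟨x, hx, rfl⟩
  have h1 : g^[n / p] x ∈ W' := hn1 (hanti hq ⟨x, hx, rfl⟩)
  have h2 := mem_iInter.1 h1 ⟨n % p, Nat.mod_lt _ (by omega)⟩
  apply hW1W
  have h3 : F^[n % p] (g^[n / p] x) ∈ W1 := h2
  rw [hg, ← Function.iterate_mul, ← Function.iterate_add_apply, Nat.mod_add_div] at h3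
  exact h3

/-- attractor from convergence -/
lemma attr_of_conv [T2Space X] [LocallyCompactSpace X] (F : X ≃ₜ X) {C Kl : Set X} (hKc : IsCompact Kl)
    (hKC : Kl ⊆ interior C)
    (hF : F '' Kl = Kl) (hconv : ∀ W ∈ 𝓝ˢ Kl, ∃ n0 : ℕ, ∀ n ≥ n0, F^[n] '' C ⊆ W) : IsAttractor F Kl := by
  refine ⟨hKc, C, mem_nhdsSet_iff_exists.2 ⟨_, isOpen_interior, hKC, interior_subset⟩, ?_⟩
  apply subset_antisymm
  · refine subset_iInter₂ fun n _ => subset_closure.trans' ?_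
    refine (subset_iUnion₂_of_subset n le_rfl ?_)
    rw [← iter_inv hF n]
    conv_lhs => rw [iter_inv hF n, ← iter_inv hF n]
    exact image_mono (hKC.trans interior_subset)
  · intro x hx
    by_contra hxK
    obtain ⟨L, hL, hKL, hLsub⟩ := exists_compact_between hKc (isOpen_compl_singleton (x := x))
      (fun y hy hyx => hxK (hyx ▸ hy))
    obtain ⟨n0, hn0⟩ := hconv L (mem_nhdsSet_iff_exists.2 ⟨_, isOpen_interior, hKL, interior_subset⟩)
    have h1 := mem_iInter₂.1 hx (n0 + 1) (by omega)
    have h2 : closure (⋃ (k : ℕ) (_ : n0 + 1 ≤ k), F^[k] '' C) ⊆ L := by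
      apply closure_minimal _ hL.isClosed
      exact iUnion₂_subset fun k hk => hn0 k (by omega)
    exact hLsub (h2 h1) rfl
end

open Set Topology Filter

section
set_option linter.unusedSectionVars false
variable {X : Type*} [TopologicalSpace X] {k : ℕ} {e : Fin k → P2 → X}

lemma step_core (h : Cells e) {K : Set X} (hU : ⋃ i, range (e i) = Kᶜ) (F : X ≃ₜ X) (hF : F '' K = K)
    (i : Fin k) : ∃ j, ∀ v, F (e i v) ∈ range (e j) := by
  have hFc : ∀ x, x ∈ Kᶜ → F x ∈ Kᶜ := by
    intro x hx hm
    rw [← hF] at hm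
    obtain ⟨y, hy, hyx⟩ := hm
    exact hx (F.injective hyx ▸ hy)
  have hin : ∀ v, F (e i v) ∈ ⋃ i, range (e i) := by
    intro v
    rw [hU]; apply hFc; rw [← hU]; exact mem_iUnion.2 ⟨i, v, rfl⟩
  obtain ⟨j, hj⟩ := mem_iUnion.1 (hin 0)
  refine ⟨j, ?_⟩
  have hs : IsPreconnected (range fun v => F (e i v)) :=
    isPreconnected_range (F.continuous.comp (h.op i).continuous)
  have := hs.subset_left_of_subset_union (u := range (e j)) (v := ⋃ l, ⋃ (_ : l ≠ j), range (e l))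
    (h.op j).isOpen_range (isOpen_iUnion fun l => isOpen_iUnion fun _ => (h.op l).isOpen_range)
    (by
      rw [disjoint_iUnion₂_right]
      intro l hl
      exact h.dis _ _ hl.symm)
    (by
      rintro _ ⟨v, rfl⟩
      obtain ⟨l, hl⟩ := mem_iUnion.1 (hin v)
      by_cases hlj : l = j
      · exact Or.inl (hlj ▸ hl)
      · exact Or.inr (mem_iUnion₂.2 ⟨l, hlj, hl⟩))
    ⟨F (e i 0), mem_range_self (f := fun v => F (e i v)) 0, hj⟩
  exact fun v => this ⟨v, rfl⟩

lemma perm_core (h : Cells e) {K : Set X} (hU : ⋃ i, range (e i) = Kᶜ) (F : X ≃ₜ X) (hF : F '' K = K) :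
    ∃ N : ℕ, 1 ≤ N ∧ ∀ (n : ℕ) i v, F^[N * n] (e i v) ∈ range (e i) := by
  have hFs : F.symm '' K = K := by
    conv_lhs => rw [← hF]
    rw [← image_comp]; simp
  choose sg hσ using step_core h hU F hF
  choose τ hτ using step_core h hU F.symm hFs
  have hinj : Function.Injective sg := by
    intro i j hij
    have key : ∀ i, τ (sg i) = i := by
      intro i
      obtain ⟨w, hw⟩ := hσ i 0
      obtain ⟨u, hu⟩ := hτ (sg i) w
      rw [hw, F.symm_apply_apply] at hu
      exact (h.inj hu).1
    rw [← key i, hij, key]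
  let s : Equiv.Perm (Fin k) := Equiv.ofBijective sg hinj.bijective_of_finite
  have hn : ∀ (n : ℕ) i v, F^[n] (e i v) ∈ range (e ((s ^ n) i)) := by
    intro n
    induction n with
    | zero => intro i v; exact ⟨v, rfl⟩
    | succ n ih =>
      intro i v
      rw [Function.iterate_succ_apply', pow_succ', Equiv.Perm.mul_apply]
      obtain ⟨w, hw⟩ := ih i v
      rw [← hw]
      exact hσ _ w
  refine ⟨Fintype.card (Equiv.Perm (Fin k)), Fintype.card_pos, fun n i v => ?_⟩
  have := hn (Fintype.card (Equiv.Perm (Fin k)) * n) i v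
  rwa [pow_mul, pow_card_eq_one, one_pow] at this

/-- the outer collar family -/
lemma phi_out (h : Cells e) (G : X ≃ₜ X) (hG : ∀ i v, G (e i v) ∈ range (e i)) (a : ℝ)
    (hZ : cen e ⊆ G '' OO e a) :
    ∃ φ : (Fin k × S1) × ℝ → X, IsOpenEmbedding φ ∧ range φ = (G '' OO e a) \ cen e ∧
      EndBasis φ (cen e) := by
  let χ := OpenPartialHomeomorph.univBall (0 : P2) (Real.exp a)
  have hχ : IsOpenEmbedding χ := χ.isOpenEmbedding (OpenPartialHomeomorph.univBall_source _ _)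
  have hχr : range χ = Metric.ball 0 (Real.exp a) := by
    rw [← image_univ, ← OpenPartialHomeomorph.univBall_source (0 : P2) (Real.exp a),
      χ.image_source_eq_target]
    exact OpenPartialHomeomorph.univBall_target _ (Real.exp_pos a)
  have hy : ∀ i, ∃ y, G (e i (χ y)) = e i 0 := by
    intro i
    obtain ⟨x, hx, hxe⟩ := hZ ⟨i, rfl⟩
    obtain ⟨j, v, hv, rfl⟩ := mem_iUnion.1 hx
    obtain ⟨w, hw⟩ := hG j v
    have : j = i := (h.inj (hw.trans hxe)).1
    subst this
    rw [← hχr] at hv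
    obtain ⟨y, rfl⟩ := hv
    exact ⟨y, hxe⟩
  choose y hy using hy
  let e' : Fin k → P2 → X := fun i v => G (e i (χ (v + y i)))
  have hr : ∀ i, range (e' i) = G '' (e i '' Metric.ball 0 (Real.exp a)) := by
    intro i
    rw [← hχr, ← range_comp, ← range_comp]
    ext x
    constructor
    · rintro ⟨v, rfl⟩; exact ⟨v + y i, rfl⟩
    · rintro ⟨v, rfl⟩; exact ⟨v - y i, by simp [e']⟩
  have hcen : cen e' = cen e := by
    simp [cen, e', hy]
  have h' : Cells e' := by
    constructor
    · intro i
      exact G.isOpenEmbedding.comp ((h.op i).comp (hχ.comp (Homeomorph.addRight (y i)).isOpenEmbedding))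
    · intro i j hij
      refine (h.dis i j hij).mono ?_ ?_ <;>
      · rintro _ ⟨v, rfl⟩
        exact hG _ _
  refine ⟨psi e', h'.psi_open, ?_, hcen ▸ cen_basis h'⟩
  rw [range_psi h', hcen]
  congr 1
  rw [OO, image_iUnion]
  exact iUnion_congr hr

/-- the inner collar family -/
lemma phi_in {T : Type*} [TopologicalSpace T] {φ : T × ℝ → X} (h : IsOpenEmbedding φ) {K : Set X}
    (hb : EndBasis φ K) (hK : Disjoint (range φ) K) (G : X ≃ₜ X) (hG : G '' K = K) {B : Set X} (hB : B = K ∪ φ '' {p | p.2 < 0}) :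
    ∃ φ' : T × ℝ → X, IsOpenEmbedding φ' ∧ range φ' = (G '' B) \ K ∧ EndBasis φ' K := by
  let β : ℝ → ℝ := fun r => - Real.exp (-r)
  have hβm : StrictMono β := by
    intro r s hrs
    simp only [β, neg_lt_neg_iff, Real.exp_lt_exp]
    exact hrs
  have hβr : range β = Iio 0 := by
    ext y
    constructor
    · rintro ⟨r, rfl⟩
      have := Real.exp_pos (-r)
      show - Real.exp (-r) < 0
      linarith
    · intro hy
      have hy : y < 0 := hy
      exact ⟨- Real.log (-y), by show - Real.exp (- - Real.log (-y)) = y; rw [neg_neg, Real.exp_log (neg_pos.2 hy), neg_neg]⟩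
  have hβ : IsOpenEmbedding β :=
    ⟨hβm.isEmbedding_of_ordConnected (by rw [hβr]; exact ordConnected_Iio), by rw [hβr]; exact isOpen_Iio⟩
  have key : ∀ s, (fun p : T × ℝ => G (φ (p.1, β p.2))) '' {p | p.2 < s} = G '' (φ '' {p | p.2 < β s}) := by
    intro s
    ext x
    constructor
    · rintro ⟨p, hp, rfl⟩
      exact ⟨_, ⟨(p.1, β p.2), hβm hp, rfl⟩, rfl⟩
    · rintro ⟨_, ⟨q, hq, rfl⟩, rfl⟩
      have hq : q.2 < β s := hq
      have h0 : q.2 ∈ range β := by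
        rw [hβr]
        exact hq.trans (by rw [← mem_Iio, ← hβr]; exact ⟨s, rfl⟩)
      obtain ⟨r, hr⟩ := h0
      exact ⟨(q.1, r), hβm.lt_iff_lt.1 (by rw [hr]; exact hq), by simp [hr]⟩
  refine ⟨fun p => G (φ (p.1, β p.2)), ?_, ?_, ?_, ?_⟩
  · exact G.isOpenEmbedding.comp (h.comp (IsOpenEmbedding.id.prodMap hβ))
  · have h1 : range (fun p : T × ℝ => G (φ (p.1, β p.2))) = G '' (φ '' {p | p.2 < 0}) := by
      ext x
      constructor
      · rintro ⟨p, rfl⟩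
        refine ⟨_, ⟨(p.1, β p.2), ?_, rfl⟩, rfl⟩
        show β p.2 < 0
        rw [← mem_Iio, ← hβr]; exact ⟨_, rfl⟩
      · rintro ⟨_, ⟨q, hq, rfl⟩, rfl⟩
        have h0 : q.2 ∈ range β := by rw [hβr]; exact hq
        obtain ⟨r, hr⟩ := h0
        exact ⟨(q.1, r), by simp [hr]⟩
    rw [h1, hB, image_union, hG, union_sdiff_left]
    refine (Disjoint.sdiff_eq_left ?_).symm
    rw [← hG]
    exact (disjoint_image_iff G.injective).2 (hK.mono_left (image_subset_range _ _))
  · intro s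
    rw [key]
    obtain ⟨W, hW, hKW, hWs⟩ := mem_nhdsSet_iff_exists.1 (hb.1 (β s))
    refine mem_nhdsSet_iff_exists.2 ⟨G '' W, G.isOpenMap W hW, ?_, ?_⟩
    · rw [← hG]; exact image_mono hKW
    · have := image_mono (f := G) hWs
      rwa [image_union, hG] at this
  · intro W hW
    have h3 : G ⁻¹' W ∈ 𝓝ˢ K := by
      rw [← hG] at hW
      exact G.continuous.tendsto_nhdsSet (mapsTo_image G K) hW
    obtain ⟨sg, hσ⟩ := hb.2 _ h3
    refine ⟨- Real.log (max (-sg) 1), ?_⟩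
    rw [key, image_subset_iff]
    refine (image_mono ?_).trans hσ
    intro p hp
    have hp : p.2 < - Real.exp (- - Real.log (max (-sg) 1)) := hp
    rw [neg_neg, Real.exp_log (by positivity)] at hp
    show p.2 < sg
    have := le_max_left (-sg) 1
    linarith
end

open Set Topology Filter

section
set_option linter.unusedSectionVars false
variable {X : Type*} [TopologicalSpace X] {k : ℕ} {e : Fin k → P2 → X}

lemma V_sup {K : Set X} (hU : ⋃ i, range (e i) = Kᶜ) (t : ℝ) : K ⊆ (OC e t)ᶜ := by
  intro x hx hm
  obtain ⟨i, v, -, rfl⟩ := mem_iUnion.1 hm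
  have : e i v ∈ Kᶜ := by rw [← hU]; exact mem_iUnion.2 ⟨i, v, rfl⟩
  exact this hx

lemma V_open [T2Space X] (h : Cells e) (t : ℝ) : IsOpen (OC e t)ᶜ := (OC_compact h t).isClosed.isOpen_compl

lemma V_nhds [T2Space X] (h : Cells e) {K : Set X} (hU : ⋃ i, range (e i) = Kᶜ) (t : ℝ) : (OC e t)ᶜ ∈ 𝓝ˢ K :=
  (V_open h t).mem_nhdsSet.2 (V_sup hU t)

lemma C_eq (h : Cells e) (a b : ℝ) : psi e '' {p | p.2 ∈ Icc a b} = (OO e a)ᶜ ∩ OC e b := by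
  rw [OO_eq, OC_eq]
  ext x
  constructor
  · rintro ⟨p, hp, rfl⟩
    refine ⟨?_, Or.inr ⟨p, hp.2, rfl⟩⟩
    rintro (hm | ⟨q, hq, hqe⟩)
    · exact disjoint_left.1 (psi_cen_dis h) ⟨_, rfl⟩ hm
    · rw [h.psi_open.injective hqe] at hq
      exact absurd hp.1 (not_le.2 hq)
  · rintro ⟨h1, hm | ⟨q, hq, rfl⟩⟩
    · exact absurd (Or.inl hm) h1
    · refine ⟨q, ⟨?_, hq⟩, rfl⟩
      by_contra hlt
      exact h1 (Or.inr ⟨q, not_le.1 hlt, rfl⟩)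

lemma image_compl_sub (g : X ≃ₜ X) {P Q : Set X} (h : g '' Pᶜ ⊆ Qᶜ) : Q ⊆ g '' P := by
  intro x hx
  by_contra hm
  refine h ⟨g.symm x, fun hP => hm ⟨_, hP, by simp⟩, by simp⟩ hx

theorem dyn [CompactSpace X] [T2Space X] (h : Cells e) {K : Set X} (hKcl : IsClosed K)
    (hU : ⋃ i, range (e i) = Kᶜ) (F : X ≃ₜ X)
    (hF : F '' K = K) {V : Set X} (hV : V ∈ 𝓝ˢ K)
    (hst : ∀ W ∈ 𝓝ˢ K, ∃ n0 : ℕ, ∀ n ≥ n0, F.symm^[n] '' V ⊆ W) {a0 a : ℝ} (ha : a0 < a) {m : ℕ} (hm : 1 ≤ m)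
    (hF1 : F '' (OO e a)ᶜ ⊆ (OC e a0)ᶜ) (hF2 : F^[m] '' (OO e a0)ᶜ ⊆ (OC e a)ᶜ) :
    ∃ (Kl A C : Set X) (b : ℝ), a < b ∧ C = psi e '' {p | p.2 ∈ Icc a b} ∧ IsCompact Kl ∧ Kl ⊆ A ∧
      F '' A = A ∧ A ⊆ (OO e a)ᶜ ∧ F '' Kl = Kl ∧
      (∀ W ∈ 𝓝ˢ Kl, ∃ n0 : ℕ, ∀ n ≥ n0, F^[n] '' C ⊆ W) ∧ Kl ⊆ interior C ∧
      ∃ (H1 H2 : (Fin k × S1) × ↥(Ici (0:ℝ)) → X) (D1 D2 : Set X), IsEmbedding H1 ∧ IsEmbedding H2 ∧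
        IsOpen D1 ∧ IsOpen D2 ∧ range H1 = (C \ Kl) ∩ D1 ∧ range H2 = (C \ Kl) ∩ D2 ∧ Disjoint D1 D2 ∧
        C \ Kl ⊆ D1 ∪ D2 := by
  have hFs : F.symm '' K = K := by
    conv_lhs => rw [← hF]
    rw [← image_comp]; simp
  have hNV : ∀ s t : ℝ, s < t → (OO e t)ᶜ ⊆ (OC e s)ᶜ := fun s t hst => compl_subset_compl.2 (OC_sub_OO hst)
  have hVN : ∀ t : ℝ, (OC e t)ᶜ ⊆ (OO e t)ᶜ := fun t => compl_subset_compl.2 (OO_sub_OC t)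
  obtain ⟨b0, hab0, hb0⟩ := N_basis h hU hV a
  have hpre : F.symm ⁻¹' (OC e b0)ᶜ ∈ 𝓝ˢ K := by
    refine ((V_open h b0).preimage F.symm.continuous).mem_nhdsSet.2 ?_
    intro x hx
    refine V_sup hU b0 ?_
    rw [← hFs]; exact ⟨x, hx, rfl⟩
  obtain ⟨b, hb0b, hb⟩ := N_basis h hU hpre b0
  obtain ⟨q, hq⟩ := hst _ (V_nhds h hU b)
  obtain ⟨N, hN, hNe⟩ := perm_core h hU F hF
  have hG1 : F.symm '' (OO e b)ᶜ ⊆ (OC e b0)ᶜ := image_subset_iff.2 hb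
  -- period
  set p : ℕ := N * (m * (q + 1)) with hp
  have hp1 : 1 ≤ p := Nat.succ_le_of_lt (by positivity)
  obtain ⟨g, hg, hgs⟩ := iter_homeo F p
  have hgK : g '' K = K := by rw [hg]; exact iter_inv hF p
  have hgnK : ∀ n : ℕ, g^[n] '' K = K := iter_inv hgK
  have hga : g '' (OO e a0)ᶜ ⊆ (OC e a)ᶜ := by
    have h1 : F^[m] '' (OO e a0)ᶜ ⊆ (OO e a0)ᶜ := hF2.trans ((hVN a).trans ((hNV _ _ ha).trans (hVN a0)))
    obtain ⟨j, hj⟩ : ∃ j, p = m + m * j := by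
      obtain ⟨j, hj⟩ : ∃ j, N * (q + 1) = j + 1 := ⟨N * (q + 1) - 1, by
        have : 0 < N * (q + 1) := by positivity
        omega⟩
      refine ⟨j, ?_⟩
      rw [hp, show N * (m * (q + 1)) = m * (N * (q + 1)) by ring, hj]; ring
    rw [hg, hj, Function.iterate_add, image_comp, Function.iterate_mul]
    exact (image_mono (iter_sub h1 j)).trans hF2
  have hgb : g.symm '' (OO e b0)ᶜ ⊆ (OC e b)ᶜ := by
    rw [hgs]
    refine (image_mono hb0).trans (hq p ?_)
    have h1 : q ≤ q + 1 := by omega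
    calc q ≤ 1 * (1 * (q + 1)) := by omega
      _ ≤ N * (m * (q + 1)) := by gcongr
  have hNb : (OO e b)ᶜ ⊆ (OO e b0)ᶜ := (hNV _ _ hb0b).trans (hVN _)
  have hNa : (OO e a)ᶜ ⊆ (OO e a0)ᶜ := (hNV _ _ ha).trans (hVN _)
  -- forward versions
  have hgb' : g '' OC e b ⊆ OO e b0 := by
    rintro _ ⟨x, hx, rfl⟩
    by_contra hm
    exact hgb ⟨g x, hm, g.symm_apply_apply x⟩ hx
  have hFb' : F '' OC e b0 ⊆ OC e b := by
    rintro _ ⟨x, hx, rfl⟩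
    by_contra hm
    exact hG1 ⟨F x, hVN b hm, F.symm_apply_apply x⟩ hx
  obtain ⟨hA, hA0⟩ := inv_core F g hp1 hg hNa (hF1.trans (hVN a0)) (hga.trans (hVN a))
  obtain ⟨hR, hR0⟩ := inv_core F g hp1 hg ((OC_sub_OO hb0b).trans (OO_sub_OC b)) hFb' (hgb'.trans (OO_sub_OC b0))
  set A := Tr g (OO e a)ᶜ with hAdef
  set Q := Tr g (OC e b) with hQdef
  rw [hR0] at hR
  have hAN : A ⊆ (OO e a)ᶜ := fun x hx => hx 0
  have hQC : Q ⊆ OC e b := fun x hx => hx 0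
  set C := (OO e a)ᶜ ∩ OC e b with hC
  have hKl : A ∩ Q = Tr g C := by
    ext x
    exact ⟨fun hx n => ⟨hx.1 n, hx.2 n⟩, fun hx => ⟨fun n => (hx n).1, fun n => (hx n).2⟩⟩
  have hgCi : g '' C ⊆ (OC e a)ᶜ ∩ OO e b0 := by
    rintro _ ⟨x, hx, rfl⟩
    exact ⟨hga ⟨x, hNa hx.1, rfl⟩, hgb' ⟨x, hx.2, rfl⟩⟩
  have hsubC : (OC e a)ᶜ ∩ OO e b0 ⊆ C :=
    inter_subset_inter (hVN a) ((OO_sub_OC b0).trans ((OC_sub_OO hb0b).trans (OO_sub_OC b)))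
  have hgC : g '' C ⊆ C := hgCi.trans hsubC
  have hCc : IsCompact C := by
    rw [hC, inter_comm]
    exact (OC_compact h b).inter_right (OO_open h a).isClosed_compl
  have hinv : F '' (A ∩ Q) = A ∩ Q := by
    rw [image_inter F.injective, hA, hR]
  have hTrC : ∀ P : Set X, IsClosed P → IsClosed (Tr g P) := by
    intro P hP
    have : Tr g P = ⋂ n : ℕ, g.symm^[n] ⁻¹' P := by
      ext x
      simp [Tr]
    rw [this]
    exact isClosed_iInter fun n => hP.preimage (g.symm.continuous.iterate n)
  have hAcl : IsClosed A := hTrC _ (OO_open h a).isClosed_compl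
  have hQcl : IsClosed Q := hTrC _ (OC_compact h b).isClosed
  have hKlc : IsCompact (A ∩ Q) := (hAcl.inter hQcl).isCompact
  have hKlint : A ∩ Q ⊆ interior C := by
    refine Subset.trans ?_ (interior_maximal hsubC ((V_open h a).inter (OO_open h b0)))
    intro x hx
    rw [hKl] at hx
    have := hx 1
    exact hgCi ⟨g.symm x, this, by simp⟩
  -- R subset A
  have hQA : Qᶜ ⊆ A := by
    intro x hx n
    have hx' : ∃ n : ℕ, g.symm^[n] x ∈ (OC e b)ᶜ := by
      by_contra hcon
      push Not at hcon
      exact hx fun n => not_not.1 (hcon n)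
    obtain ⟨j, hj⟩ := hx'
    have hVV : g.symm '' (OC e b)ᶜ ⊆ (OC e b)ᶜ := (image_mono ((hVN b).trans hNb)).trans hgb
    have hVb : (OC e b)ᶜ ⊆ (OO e a)ᶜ := (hVN b).trans (hNb.trans ((hNV _ _ hab0).trans (hVN a)))
    by_cases hnj : j ≤ n
    · obtain ⟨i, rfl⟩ := Nat.exists_eq_add_of_le hnj
      rw [add_comm, Function.iterate_add_apply]
      exact hVb (iter_sub hVV i ⟨_, hj, rfl⟩)
    · obtain ⟨i, rfl⟩ := Nat.exists_eq_add_of_le (not_le.1 hnj).le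
      rw [add_comm, Function.iterate_add_apply] at hj
      have h1 : g.symm^[n] x ∈ g^[i] '' (OC e b)ᶜ := (mem_iter g i _ _).2 hj
      have h2 : g '' (OO e a)ᶜ ⊆ (OO e a)ᶜ := (image_mono hNa).trans (hga.trans (hVN a))
      exact iter_sub h2 i (image_mono hVb h1)
  -- outer collar
  have hB1 : OC e a ⊆ g '' OO e a := image_compl_sub g ((image_mono hNa).trans hga)
  have hmonoO : ∀ n : ℕ, OO e a ⊆ g^[n] '' OO e a := by
    intro n
    induction n with
    | zero => simp
    | succ n ih =>
      rw [Function.iterate_succ', image_comp]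
      exact ((OO_sub_OC a).trans hB1).trans (image_mono ih)
  have e1 : ∀ s : Set ℝ, (fun p : (Fin k × S1) × ℝ => psi e (p.1, p.2 + a)) '' {p | p.2 ∈ s} =
      psi e '' {p | p.2 - a ∈ s} := by
    intro s
    ext x
    constructor
    · rintro ⟨p, hp, rfl⟩
      exact ⟨_, (by simpa using hp : p.2 + a - a ∈ s), rfl⟩
    · rintro ⟨p, hp, rfl⟩
      exact ⟨(p.1, p.2 - a), hp, by simp⟩
  have e2 : ∀ s : Set ℝ, (fun p : (Fin k × S1) × ℝ => psi e (p.1, b - p.2)) '' {p | p.2 ∈ s} =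
      psi e '' {p | b - p.2 ∈ s} := by
    intro s
    ext x
    constructor
    · rintro ⟨p, hp, rfl⟩
      exact ⟨_, (by simpa using hp : b - (b - p.2) ∈ s), rfl⟩
    · rintro ⟨p, hp, rfl⟩
      exact ⟨(p.1, b - p.2), hp, by simp⟩
  have hcov : ∀ S : Set ℝ, (cen e ∪ psi e '' {p | p.2 ∈ S})ᶜ = K ∪ psi e '' {p | p.2 ∈ Sᶜ} := by
    intro S
    ext x
    constructor
    · intro hx
      by_cases hK : x ∈ K
      · exact Or.inl hK
      · have : x ∈ Kᶜ := hK
        rw [← hU, range_eq_cen] at this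
        rcases this with hm | ⟨r, rfl⟩
        · exact absurd (Or.inl hm) hx
        · exact Or.inr ⟨r, fun hr => hx (Or.inr ⟨r, hr, rfl⟩), rfl⟩
    · rintro hx hm
      have hKc : x ∈ Kᶜ := by
        rw [← hU, range_eq_cen]
        rcases hm with hm | ⟨r, -, rfl⟩
        · exact Or.inl hm
        · exact Or.inr ⟨r, rfl⟩
      rcases hx with hx | ⟨r, hr, rfl⟩
      · exact hKc hx
      · rcases hm with hm | ⟨s, hs, hse⟩
        · exact disjoint_left.1 (psi_cen_dis h) ⟨_, rfl⟩ hm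
        · rw [h.psi_open.injective hse] at hs
          exact hr hs
  have hZc : IsClosed (cen e) := (finite_range _).isClosed
  obtain ⟨H1, hH1, hH1r⟩ := ring_union (B := OO e a) (B' := OC e a) g hZc (open_shift h.psi_open a)
    ((psi_cen_dis h).mono_left (by rintro _ ⟨p, rfl⟩; exact ⟨_, rfl⟩))
    (basis_shift (cen_basis h) a)
    (by
      have := e1 (Iio 0)
      simp only [mem_Iio, sub_neg] at this
      rw [this, OO_eq])
    (by
      have := e1 (Iic 0)
      simp only [mem_Iic, sub_nonpos] at this
      rw [this, OC_eq])
    (OO_open h a) (OC_compact h a) hB1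
    (by
      intro n hn
      obtain ⟨G, hG, -⟩ := iter_homeo g n
      have := phi_out h G (by
        intro i v
        rw [hG, hg, ← Function.iterate_mul, hp, mul_assoc]
        exact hNe _ i v) a (by
        rw [hG]
        refine Subset.trans ?_ (hmonoO n)
        rw [OO_eq]; exact subset_union_left)
      rwa [hG] at this)
  have hφ1 : IsOpenEmbedding (fun p : (Fin k × S1) × ℝ => psi e (p.1, b - p.2)) :=
    h.psi_open.comp (IsOpenEmbedding.id.prodMap (Homeomorph.subLeft b).isOpenEmbedding)
  have hdisK : Disjoint (range fun p : (Fin k × S1) × ℝ => psi e (p.1, b - p.2)) K := by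
    rw [disjoint_left]
    rintro _ ⟨p, rfl⟩ hm
    have : psi e (p.1, b - p.2) ∈ Kᶜ := by
      rw [← hU, range_eq_cen]; exact Or.inr ⟨_, rfl⟩
    exact this hm
  have hBV : (OC e b)ᶜ = K ∪ (fun p : (Fin k × S1) × ℝ => psi e (p.1, b - p.2)) '' {p | p.2 < 0} := by
    have := e2 (Iio 0)
    simp only [mem_Iio, sub_neg] at this
    rw [this, OC_eq]
    have := hcov (Iic b)
    simp only [mem_Iic, compl_Iic, mem_Ioi] at this
    exact this
  obtain ⟨H2, hH2, hH2r⟩ := ring_union (B := (OC e b)ᶜ) (B' := (OO e b)ᶜ) g hKcl hφ1 hdisK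
    (K_basis h hU b) hBV
    (by
      have := e2 (Iic 0)
      simp only [mem_Iic, sub_nonpos] at this
      rw [this, OO_eq]
      have := hcov (Iio b)
      simp only [mem_Iio, compl_Iio, mem_Ici] at this
      exact this)
    (V_open h b) (OO_open h b).isClosed_compl.isCompact
    (by
      intro x hx
      exact ⟨g.symm x, hgb ⟨x, hNb hx, rfl⟩, by simp⟩)
    (by
      intro n hn
      obtain ⟨G, hG, -⟩ := iter_homeo g n
      have := phi_in hφ1 (K_basis h hU b) hdisK G (by rw [hG]; exact hgnK n) hBV
      rwa [hG] at this)
  rw [Tr_compl] at hH1r hH2r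
  rw [compl_compl] at hH2r
  refine ⟨A ∩ Q, A, C, b, hab0.trans hb0b, (C_eq h a b).symm, hKlc, inter_subset_left, hA, hAN, hinv,
    conv_core F g hp1 hg hCc hgC hKl hinv, hKlint, H1, H2, Aᶜ, Qᶜ, hH1, hH2, hAcl.isOpen_compl, hQcl.isOpen_compl,
    ?_, ?_, ?_, ?_⟩
  · rw [hH1r]
    ext x
    constructor
    · rintro ⟨h1, h2⟩
      refine ⟨⟨⟨h2, ?_⟩, fun h3 => h1 h3.1⟩, h1⟩
      apply hQC
      by_contra h3
      exact h1 (hQA h3)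
    · rintro ⟨⟨⟨h1, -⟩, -⟩, h2⟩
      exact ⟨h2, h1⟩
  · rw [hH2r]
    ext x
    constructor
    · rintro ⟨h1, h2⟩
      exact ⟨⟨⟨hAN (hQA h1), not_not.1 h2⟩, fun h3 => h1 h3.2⟩, h1⟩
    · rintro ⟨⟨⟨-, h1⟩, -⟩, h2⟩
      exact ⟨h2, fun h3 => h3 h1⟩
  · rw [disjoint_left]
    intro x h1 h2
    exact h1 (hQA h2)
  · rintro x ⟨-, h2⟩
    by_cases h1 : x ∈ A
    · exact Or.inr fun h3 => h2 ⟨h1, h3⟩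
    · exact Or.inl h1
end

open Set Topology Filter

lemma s2_lc : LocallyConnectedSpace S2 := by
  haveI : Fact (Module.finrank ℝ (EuclideanSpace ℝ (Fin 3)) = 2 + 1) := ⟨by simp⟩
  haveI : LocallyConnectedSpace (EuclideanSpace ℝ (Fin 2)) := inferInstance
  exact ChartedSpace.locallyConnectedSpace (EuclideanSpace ℝ (Fin 2)) S2

lemma rank_fin (n : ℕ) (hn : 2 ≤ n) : 1 < Module.rank ℝ (EuclideanSpace ℝ (Fin n)) := by
  rw [← Module.finrank_eq_rank]
  simp only [finrank_euclideanSpace, Fintype.card_fin]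
  exact_mod_cast hn

lemma s2_conn : ConnectedSpace S2 :=
  Subtype.connectedSpace (isConnected_sphere (rank_fin 3 (by norm_num)) 0 zero_le_one)

lemma lc_of_open {A B : Type*} [TopologicalSpace A] [TopologicalSpace B] [LocallyConnectedSpace B] {i : A → B}
    (hi : IsOpenEmbedding i) : LocallyConnectedSpace A := by
  rw [locallyConnectedSpace_iff_subsets_isOpen_isConnected]
  intro x U hU
  obtain ⟨V, hVU, hVo, hxV, hVc⟩ := locallyConnectedSpace_iff_subsets_isOpen_isConnected.1 ‹_› (i x) (i '' U)
    (hi.isOpenMap.image_mem_nhds hU)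
  have hVr : i '' (i ⁻¹' V) = V := image_preimage_eq_of_subset (hVU.trans (image_subset_range _ _))
  refine ⟨i ⁻¹' V, ?_, hVo.preimage hi.continuous, hxV, ⟨x, hxV⟩, ?_⟩
  · intro y hy
    obtain ⟨z, hz, hzy⟩ := hVU hy
    exact hi.injective hzy ▸ hz
  · rw [← hi.isInducing.isPreconnected_image, hVr]
    exact hVc.isPreconnected

lemma transfer {M : Type*} [TopologicalSpace M]
    (hM : Nonempty (M ≃ₜ EuclideanSpace ℝ (Fin 2)) ∨
      Nonempty (M ≃ₜ ↥(Metric.sphere (0 : EuclideanSpace ℝ (Fin 3)) 1))) :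
    ∃ i : M → S2, IsOpenEmbedding i ∧ (range i)ᶜ.Subsingleton ∧
      ∀ f : M ≃ₜ M, ∃ F : S2 ≃ₜ S2, ∀ x, F (i x) = i (f x) := by
  rcases hM with ⟨⟨h⟩⟩ | ⟨⟨h⟩⟩
  · let j : OnePoint M ≃ₜ S2 := (h.onePointCongr).trans
      (onePointEquivSphereOfFinrankEq (ι := Fin 3) (V := EuclideanSpace ℝ (Fin 2)) (by simp))
    refine ⟨fun x => j (x : OnePoint M), j.isOpenEmbedding.comp OnePoint.isOpenEmbedding_coe, ?_, ?_⟩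
    · have key : ∀ x ∈ (range fun x : M => j (x : OnePoint M))ᶜ, x = j OnePoint.infty := by
        intro x hx
        obtain ⟨y, rfl⟩ := j.surjective x
        induction y using OnePoint.rec with
        | infty => rfl
        | coe y => exact absurd ⟨y, rfl⟩ hx
      intro x hx y hy
      rw [key x hx, key y hy]
    · intro f
      refine ⟨(j.symm.trans f.onePointCongr).trans j, fun x => ?_⟩
      simp
  · refine ⟨h, h.isOpenEmbedding, ?_, fun f => ⟨(h.symm.trans f).trans h, fun x => by simp⟩⟩
    rw [h.surjective.range_eq]
    simp

section
variable {M X : Type*} [TopologicalSpace M] [TopologicalSpace X] {i : M → X}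

lemma semi_iter {f : M → M} {F : X → X} (hs : ∀ x, F (i x) = i (f x)) (n : ℕ) (x : M) :
    F^[n] (i x) = i (f^[n] x) := by
  have : Function.Semiconj i f F := fun x => (hs x).symm
  exact (this.iterate_right n x).symm

lemma nhds_up (hi : IsOpenEmbedding i) {K V : Set M} (hV : V ∈ 𝓝ˢ K) : i '' V ∈ 𝓝ˢ (i '' K) := by
  obtain ⟨W, hW, hKW, hWV⟩ := mem_nhdsSet_iff_exists.1 hV
  exact mem_nhdsSet_iff_exists.2 ⟨i '' W, hi.isOpenMap W hW, image_mono hKW, image_mono hWV⟩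

lemma nhds_down (hi : IsOpenEmbedding i) {K : Set M} {V : Set X} (hV : V ∈ 𝓝ˢ (i '' K)) : i ⁻¹' V ∈ 𝓝ˢ K :=
  hi.continuous.tendsto_nhdsSet (mapsTo_image i K) hV

lemma stab_up (hi : IsOpenEmbedding i) {f : M → M} {F : X → X} (hs : ∀ x, F (i x) = i (f x)) {K V : Set M}
    (hst : ∀ W ∈ 𝓝ˢ K, ∃ n0 : ℕ, ∀ n ≥ n0, f^[n] '' V ⊆ W) :
    ∀ W ∈ 𝓝ˢ (i '' K), ∃ n0 : ℕ, ∀ n ≥ n0, F^[n] '' (i '' V) ⊆ W := by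
  intro W hW
  obtain ⟨n0, hn0⟩ := hst _ (nhds_down hi hW)
  refine ⟨n0, fun n hn => ?_⟩
  rintro _ ⟨_, ⟨x, hx, rfl⟩, rfl⟩
  rw [semi_iter hs]
  exact hn0 n hn ⟨x, hx, rfl⟩

lemma inv_up {f : M → M} {F : X → X} (hs : ∀ x, F (i x) = i (f x)) {K : Set M} (h : f '' K = K) :
    F '' (i '' K) = i '' K := by
  conv_rhs => rw [← h]
  rw [← image_comp, ← image_comp]
  exact image_congr fun x _ => hs x

lemma lift_emb {T : Type*} [TopologicalSpace T] (hi : IsOpenEmbedding i) {φ : T → X} (hr : range φ ⊆ range i) :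
    ∃ φ' : T → M, (∀ x, i (φ' x) = φ x) ∧ (IsOpenEmbedding φ → IsOpenEmbedding φ') ∧
      (IsEmbedding φ → IsEmbedding φ') ∧ ∀ S, φ' '' S = i ⁻¹' (φ '' S) := by
  choose φ' hφ' using fun x => hr ⟨x, rfl⟩
  have hc : i ∘ φ' = φ := funext hφ'
  refine ⟨φ', hφ', fun h => ?_, fun h => ?_, fun S => ?_⟩
  · rw [← hi.of_comp_iff, hc]; exact h
  · rw [← hi.isEmbedding.of_comp_iff, hc]; exact h
  · ext x
    constructor
    · rintro ⟨y, hy, rfl⟩; exact ⟨y, hy, (hφ' y).symm⟩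
    · rintro ⟨y, hy, hyx⟩
      exact ⟨y, hy, hi.injective (by rw [hφ', hyx])⟩

lemma fam_iter {f : unitInterval → M ≃ₜ M} (hf : ContinuousFamily f) (n : ℕ) :
    Continuous fun p : unitInterval × M => (f p.1)^[n] p.2 := by
  induction n with
  | zero => exact continuous_snd
  | succ n ih =>
    simp only [Function.iterate_succ_apply']
    exact hf.1.comp (continuous_fst.prodMk ih)

lemma small_lam (hi : IsOpenEmbedding i) {f : unitInterval → M ≃ₜ M} (hf : ContinuousFamily f)
    {F : unitInterval → X ≃ₜ X} (hs : ∀ l x, F l (i x) = i (f l x)) (n : ℕ) {L W : Set X} (hL : IsCompact L)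
    (hLr : L ⊆ range i) (hW : IsOpen W) (h0 : (F 0)^[n] '' L ⊆ W) :
    ∃ l1 : ℝ, 0 < l1 ∧ ∀ l : unitInterval, (l : ℝ) < l1 → (F l)^[n] '' L ⊆ W := by
  have hLM : IsCompact (i ⁻¹' L) := (hi.isInducing.isCompact_preimage_iff hLr).2 hL
  have hS : IsOpen {p : unitInterval × M | i ((f p.1)^[n] p.2) ∈ W} :=
    hW.preimage (hi.continuous.comp (fam_iter hf n))
  obtain ⟨u, v, hu, hv, h0u, hLv, huv⟩ := generalized_tube_lemma (s := {(0 : unitInterval)}) isCompact_singleton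
    (t := i ⁻¹' L) hLM hS (by
      rintro ⟨l, x⟩ ⟨hl, hx⟩
      have hl : l = 0 := hl
      show i ((f l)^[n] x) ∈ W
      rw [hl, ← semi_iter (hs 0)]
      exact h0 ⟨_, hx, rfl⟩)
  obtain ⟨ε, hε, hb⟩ := Metric.mem_nhds_iff.1 (hu.mem_nhds (h0u rfl))
  refine ⟨ε, hε, fun l hl => ?_⟩
  rintro _ ⟨x, hx, rfl⟩
  obtain ⟨y, rfl⟩ := hLr hx
  rw [semi_iter (hs l)]
  refine huv (mk_mem_prod (hb ?_) (hLv hx))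
  rw [Metric.mem_ball, Subtype.dist_eq, Real.dist_eq]
  simpa [abs_of_nonneg l.2.1] using hl
end

open Set Topology Filter

/-- **Hopf bifurcation in the plane and the 2-sphere: counting components.** If `M` is
either `ℝ²` or `S²` and `K ⊊ M` is a connected compact attractor of `f₀` that is a
repeller of `f_λ` for every `λ > 0`, then `M \ K` has a finite number `k` of connected
components and for all sufficiently small `λ > 0` there is a compact attractor `K_λ` of
`f_λ` which is a topological spine of a compact subset of `M` homeomorphic to
`(Fin k × S¹) × [0,1]`, converging to `K` upper semicontinuously as `λ → 0`. -/
theorem hopf_plane_sphere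
    {M : Type*} [MetricSpace M] [LocallyCompactSpace M]
    (hM : Nonempty (M ≃ₜ EuclideanSpace ℝ (Fin 2)) ∨
      Nonempty (M ≃ₜ ↥(Metric.sphere (0 : EuclideanSpace ℝ (Fin 3)) 1)))
    (f : unitInterval → M ≃ₜ M) (hf : ContinuousFamily f)
    (K : Set M) (hKne : K ≠ Set.univ) (hKconn : IsConnected K) (hKc : IsCompact K)
    (hKattr : IsAttractor (f 0) K)
    (hhopf : ∀ lam : unitInterval, 0 < (lam : ℝ) → IsRepeller (f lam) K) :
    ∃ k : ℕ, Nonempty (ConnectedComponents ↥(Kᶜ) ≃ Fin k) ∧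
      ∃ lam₀ : ℝ, 0 < lam₀ ∧ ∃ Kfam : unitInterval → Set M,
        (∀ lam : unitInterval, 0 < (lam : ℝ) → (lam : ℝ) < lam₀ →
          IsCompact (Kfam lam) ∧ IsAttractor (f lam) (Kfam lam) ∧
          ∃ C : Set M, IsCompact C ∧
            Nonempty (↥C ≃ₜ
              (Fin k × ↥(Metric.sphere (0 : EuclideanSpace ℝ (Fin 2)) 1)) ×
                ↥(Set.Icc (0 : ℝ) 1)) ∧
            IsSpine 2 C (Kfam lam)) ∧
        (∀ V : Set M, V ∈ 𝓝ˢ K → ∃ lam₁ : ℝ, 0 < lam₁ ∧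
          ∀ lam : unitInterval, 0 < (lam : ℝ) → (lam : ℝ) < lam₁ → Kfam lam ⊆ V) := by
  obtain ⟨i, hi, hsub, hext⟩ := transfer hM
  choose! FF hFF using hext
  let F : unitInterval → S2 ≃ₜ S2 := fun l => FF (f l)
  have hs : ∀ l x, F l (i x) = i (f l x) := fun l x => hFF (f l) x
  have hsymm : ∀ l x, (F l).symm (i x) = i ((f l).symm x) := by
    intro l x
    apply (F l).injective
    rw [(F l).apply_symm_apply, hs, (f l).apply_symm_apply]
  have : LocallyConnectedSpace S2 := s2_lc
  have : ConnectedSpace S2 := s2_conn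
  have : LocallyConnectedSpace M := lc_of_open hi
  have : CompactSpace S2 := Metric.sphere.compactSpace _ _
  -- invariance
  have hinv0 : F 0 '' (i '' K) = i '' K := inv_up (hs 0) (attr_inv hKattr)
  have hinv : ∀ l : unitInterval, 0 < (l : ℝ) → F l '' (i '' K) = i '' K := by
    intro l hl
    have h1 : (f l).symm '' K = K := attr_inv (hhopf l hl)
    refine inv_up (hs l) ?_
    conv_lhs => rw [← h1]
    rw [← image_comp]; simp
  obtain ⟨V0, hV0, hst0⟩ := stab hKattr hKconn
  have hst0' := stab_up hi (hs 0) hst0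
  have hV0' := nhds_up hi hV0
  have hKc' : IsCompact (i '' K) := hKc.image hi.continuous
  have hKcl : IsClosed (i '' K) := hKc'.isClosed
  have hKconn' : IsConnected (i '' K) := hKconn.image i hi.continuous.continuousOn
  obtain ⟨k, U, hUo, hUc, hUd, hUU⟩ := fin_comps (F 0) hKcl hinv0 hV0' hst0'
  have hUK : ∀ j, U j ⊆ (i '' K)ᶜ := fun j => hUU ▸ subset_iUnion U j
  have hcen : ∀ j, ∃ c ∈ U j, ∀ x ∈ U j, x ∉ range i → x = c := by
    intro j
    by_cases hx : ∃ x ∈ U j, x ∉ range i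
    · obtain ⟨x, hx1, hx2⟩ := hx
      exact ⟨x, hx1, fun y _ hy => hsub hy hx2⟩
    · obtain ⟨c, hc⟩ := (hUc j).nonempty
      exact ⟨c, hc, fun y hy1 hy2 => absurd ⟨y, hy1, hy2⟩ hx⟩
  choose c hcU hc using hcen
  obtain ⟨p0, hp0⟩ := hKconn'.nonempty
  choose e heo her he0 using fun j => cell_of (hUo j) (hUc j) (compl_conn hKconn' hUo hUc hUd hUU j)
    (fun h => hUK j h hp0) (hcU j)
  have h : Cells e := ⟨heo, fun a b hab => by rw [her, her]; exact hUd a b hab⟩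
  have hU : ⋃ j, range (e j) = (i '' K)ᶜ := by rw [← hUU]; exact iUnion_congr her
  have hpsi : range (psi e) ⊆ range i := by
    rintro _ ⟨p, rfl⟩
    by_contra hm
    have h1 := hc p.1.1 (psi e p) (by rw [← her]; exact ⟨_, rfl⟩) hm
    rw [← he0] at h1
    exact pol_ne _ (h.inj h1).2
  have hNr : ∀ t, (OO e t)ᶜ ⊆ range i := by
    intro t x hx
    by_cases hxK : x ∈ i '' K
    · exact image_subset_range _ _ hxK
    · have : x ∈ (i '' K)ᶜ := hxK
      rw [← hU, range_eq_cen] at this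
      rcases this with hm | hm
      · exact absurd (by rw [OO_eq]; exact Or.inl hm) hx
      · exact hpsi hm
  have hNc : ∀ t, IsCompact (OO e t)ᶜ := fun t => (OO_open h t).isClosed_compl.isCompact
  refine ⟨k, ?_, ?_⟩
  · refine comps_equiv (U := fun j => i ⁻¹' U j) (fun j => (hUo j).preimage hi.continuous) ?_
      (fun a b hab => (hUd a b hab).preimage i) ?_
    · intro j
      have hcon : IsConnected (U j ∩ range i) := by
        by_cases hcr : c j ∈ range i
        · have : U j ∩ range i = U j := by
            apply inter_eq_left.2
            intro x hx
            by_contra hm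
            exact hm (hc j x hx hm ▸ hcr)
          rw [this]; exact hUc j
        · have : U j ∩ range i = e j '' {0}ᶜ := by
            rw [← her]
            ext x
            constructor
            · rintro ⟨⟨v, rfl⟩, hv⟩
              refine ⟨v, fun h0 => hcr ?_, rfl⟩
              have h0 : v = 0 := h0
              rw [← he0, ← h0]; exact hv
            · rintro ⟨v, hv, rfl⟩
              refine ⟨⟨v, rfl⟩, ?_⟩
              by_contra hm
              have h1 := hc j (e j v) (by rw [← her]; exact ⟨_, rfl⟩) hm
              rw [← he0] at h1
              exact hv (h.inj h1).2
          rw [this]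
          exact (isConnected_compl_singleton_of_one_lt_rank (rank_fin 2 le_rfl) 0).image _
            (heo j).continuous.continuousOn
      constructor
      · obtain ⟨x, hx, y, rfl⟩ := hcon.nonempty
        exact ⟨y, hx⟩
      · rw [← hi.isInducing.isPreconnected_image, image_preimage_eq_inter_range]
        exact hcon.isPreconnected
    · rw [← preimage_iUnion, hUU, preimage_compl, preimage_image_eq _ hi.injective]
  -- choice of radii
  obtain ⟨a0, -, ha0⟩ := N_basis h hU hV0' 0
  have hpre : F 0 ⁻¹' (OC e a0)ᶜ ∈ 𝓝ˢ (i '' K) := by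
    refine ((V_open h a0).preimage (F 0).continuous).mem_nhdsSet.2 ?_
    intro x hx
    refine V_sup hU a0 ?_
    rw [← hinv0]; exact ⟨x, hx, rfl⟩
  obtain ⟨a, haa, ha⟩ := N_basis h hU hpre a0
  obtain ⟨n0, hn0⟩ := hst0' _ (V_nhds h hU a)
  obtain ⟨l1, hl1, hl1'⟩ := small_lam hi hf hs 1 (hNc a) (hNr a) (V_open h a0) (image_subset_iff.2 ha)
  obtain ⟨l2, hl2, hl2'⟩ := small_lam hi hf hs (n0 + 1) (hNc a0) (hNr a0) (V_open h a)
    ((image_mono ha0).trans (hn0 (n0 + 1) (by omega)))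
  have hmain : ∀ l : unitInterval, ∃ Kl : Set M, 0 < (l : ℝ) → (l : ℝ) < min l1 l2 →
      (IsCompact Kl ∧ IsAttractor (f l) Kl ∧
          ∃ C : Set M, IsCompact C ∧
            Nonempty (↥C ≃ₜ
              (Fin k × ↥(Metric.sphere (0 : EuclideanSpace ℝ (Fin 2)) 1)) ×
                ↥(Set.Icc (0 : ℝ) 1)) ∧
            IsSpine 2 C Kl) ∧ ∃ A : Set S2, i '' Kl ⊆ A ∧ F l '' A = A ∧ A ⊆ (OO e a)ᶜ := by
    intro l
    by_cases hl : 0 < (l : ℝ) ∧ (l : ℝ) < min l1 l2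
    swap
    · exact ⟨∅, fun h1 h2 => absurd ⟨h1, h2⟩ hl⟩
    obtain ⟨hl0, hll⟩ := hl
    obtain ⟨V, hV, hst⟩ := stab (hhopf l hl0) hKconn
    obtain ⟨Kl, A, C, b, hab, hC, hKlc, hKlA, hA, hAN, hKlinv, hconv, hKlC, H1, H2, D1, D2, hH1, hH2, hD1, hD2,
      hr1, hr2, hdis, hcov⟩ := dyn h hKcl hU (F l) (hinv l hl0) (nhds_up hi hV) (stab_up hi (hsymm l) hst) haa
      (m := n0 + 1) (by omega) (hl1' l (hll.trans_le (min_le_left _ _))) (hl2' l (hll.trans_le (min_le_right _ _)))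
    have hCr : C ⊆ range i := by rw [hC]; exact (image_subset_range _ _).trans hpsi
    have hKlr : Kl ⊆ range i := hKlC.trans (interior_subset.trans hCr)
    have hKlM : i '' (i ⁻¹' Kl) = Kl := image_preimage_eq_of_subset hKlr
    have hKlcM : IsCompact (i ⁻¹' Kl) := (hi.isInducing.isCompact_preimage_iff hKlr).2 hKlc
    have hint : i ⁻¹' Kl ⊆ interior (i ⁻¹' C) := by
      rw [← hi.isOpenMap.preimage_interior_eq_interior_preimage hi.continuous]
      exact preimage_mono hKlC
    refine ⟨i ⁻¹' Kl, fun _ _ => ⟨⟨hKlcM, ?_, i ⁻¹' C, ?_⟩, A, by rw [hKlM]; exact hKlA, hA, hAN⟩⟩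
    · refine attr_of_conv (f l) (C := i ⁻¹' C) hKlcM hint ?_ ?_
      · apply image_injective.2 hi.injective
        rw [hKlM, ← image_comp]
        conv_rhs => rw [← hKlinv, ← hKlM, ← image_comp]
        exact image_congr fun x _ => (hs l x).symm
      · intro W hW
        have hW' := nhds_up hi hW
        rw [hKlM] at hW'
        obtain ⟨n1, hn1⟩ := hconv _ hW'
        refine ⟨n1, fun n hn => ?_⟩
        rintro _ ⟨x, hx, rfl⟩
        obtain ⟨y, hy, hye⟩ := hn1 n hn ⟨i x, hx, rfl⟩
        rw [semi_iter (hs l)] at hye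
        rw [← hi.injective hye]; exact hy
    · obtain ⟨ψ', -, hψ1, -, hψ2⟩ := lift_emb hi hpsi
      have hr1' : range H1 ⊆ range i := by
        rw [hr1]; exact inter_subset_left.trans (sdiff_subset.trans hCr)
      have hr2' : range H2 ⊆ range i := by
        rw [hr2]; exact inter_subset_left.trans (sdiff_subset.trans hCr)
      obtain ⟨H1', -, -, hH1', hH1i⟩ := lift_emb hi hr1'
      obtain ⟨H2', -, -, hH2', hH2i⟩ := lift_emb hi hr2'
      refine spine_lemma (hψ1 h.psi_open) hab (by rw [hψ2, hC]) hint (hH1' hH1) (hH2' hH2)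
        (hD1.preimage hi.continuous) (hD2.preimage hi.continuous) ?_ ?_ (hdis.preimage i) ?_
      · rw [← image_univ, hH1i, image_univ, hr1]; rfl
      · rw [← image_univ, hH2i, image_univ, hr2]; rfl
      · exact fun x hx => hcov hx
  choose Kfam hKfam using hmain
  refine ⟨min l1 l2, lt_min hl1 hl2, Kfam, fun l h1 h2 => (hKfam l h1 h2).1, ?_⟩
  intro V hV
  obtain ⟨W, hW, hKW, hWV⟩ := mem_nhdsSet_iff_exists.1 (nhds_up hi hV)
  obtain ⟨n, hn⟩ := hst0' W (hW.mem_nhdsSet.2 hKW)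
  obtain ⟨l3, hl3, hl3'⟩ := small_lam hi hf hs n (hNc a0) (hNr a0) hW
    ((image_mono ha0).trans (hn n le_rfl))
  refine ⟨min l3 (min l1 l2), lt_min hl3 (lt_min hl1 hl2), fun l h1 h2 => ?_⟩
  obtain ⟨-, A, hKA, hA, hAN⟩ := hKfam l h1 (h2.trans_le (min_le_right _ _))
  intro x hx
  have h3 : i x ∈ (F l)^[n] '' A := by rw [iter_inv hA n]; exact hKA ⟨x, hx, rfl⟩
  have hNN : (OO e a)ᶜ ⊆ (OO e a0)ᶜ := compl_subset_compl.2 ((OO_sub_OC a0).trans (OC_sub_OO haa))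
  obtain ⟨y, hy, hye⟩ := hWV (hl3' l (h2.trans_le (min_le_left _ _)) (image_mono (hAN.trans hNN) h3))
  rw [← hi.injective hye]; exact hy
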